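/- arXiv:1712.07191 — 3 statements merged into one kernel-verified Lean document; each statement's English description precedes it below -/
import Mathlib

section
/- Let G be a residually solvable group, let A, B ≤ G be subgroups, let φ: B → A be a group isomorphism, and suppose there exists a group homomorphism π: G → A × B such that π(a) = (a,1) for all a ∈ A and π(b) = (1,b) for all b ∈ B. Then for every integer k ≥ 4, both Hig_k(G,φ) and bar-Hig_k(G,φ) are residually solvable. -/
universe u

/-- A group is residually solvable if every nonidentity element admits a homomorphism to a
solvable group with nonidentity image. -/
def ResiduallySolvable (G : Type u) [Group G] : Prop :=
  ∀ x : G, x ≠ 1 → ∃ (H : Type u) (_ : Group H) (f : G →* H), IsSolvable H ∧ f x ≠ 1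

variable (G : Type u) [Group G] (A B : Subgroup G) (φ : B ≃* A) (k : ℕ)

/-- The stable generator `t` inside the free product `G ∗ ⟨t⟩`. -/
def higT : Monoid.Coprod G (FreeGroup Unit) := Monoid.Coprod.inr (FreeGroup.of ())

/-- Defining relators of `Hig_k(G, φ)`:  `t^k` and `t⁻¹ b t φ(b)⁻¹` for `b ∈ B`. -/
def higRels : Set (Monoid.Coprod G (FreeGroup Unit)) :=
  {higT G ^ k} ∪
    ⋃ b : B, {(higT G)⁻¹ * Monoid.Coprod.inl (b : G) * higT G *
      (Monoid.Coprod.inl ((φ b : G)) : Monoid.Coprod G (FreeGroup Unit))⁻¹}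

/-- `Hig_k(G, φ) = ⟨G, t ∣ t^k = 1, b^t = φ(b) ∀ b ∈ B⟩`, the quotient of the free product
`G ∗ ⟨t⟩` by the normal closure of the relators. -/
def Hig : Type u :=
  Monoid.Coprod G (FreeGroup Unit) ⧸ Subgroup.normalClosure (higRels G A B φ k)

instance : Group (Hig G A B φ k) :=
  inferInstanceAs (Group (Monoid.Coprod G (FreeGroup Unit) ⧸
    Subgroup.normalClosure (higRels G A B φ k)))

/-- Defining relators of `bar-Hig_k(G, φ)`: `b_i φ_i(b_i)⁻¹` with the copies of `G`
indexed by `ℤ/kℤ`. -/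
def barHigRels : Set (Monoid.CoprodI (fun _ : ZMod k => G)) :=
  ⋃ (i : ZMod k) (b : B),
    {Monoid.CoprodI.of (M := fun _ : ZMod k => G) (i := i) ((b : G)) *
      (Monoid.CoprodI.of (M := fun _ : ZMod k => G) (i := i + 1) ((φ b : G)))⁻¹}

/-- `bar-Hig_k(G, φ)`: the cyclic amalgam of `k` copies of `G`, i.e. the quotient of
the free product of `k` copies of `G` by the normal closure of `{b_i φ_i(b_i)⁻¹}`. -/
def BarHig : Type u :=
  Monoid.CoprodI (fun _ : ZMod k => G) ⧸ Subgroup.normalClosure (barHigRels G A B φ k)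

instance : Group (BarHig G A B φ k) :=
  inferInstanceAs (Group (Monoid.CoprodI (fun _ : ZMod k => G) ⧸
    Subgroup.normalClosure (barHigRels G A B φ k)))


theorem rs_iff {X : Type u} [Group X] :
    ResiduallySolvable X ↔ ∀ x : X, x ≠ 1 → ∃ n, x ∉ derivedSeries X n := by
  constructor
  · intro h x hx
    obtain ⟨S, _, f, hS, hfx⟩ := h x hx
    obtain ⟨n, hn⟩ := hS.solvable
    refine ⟨n, fun hmem => hfx ?_⟩
    have := map_derivedSeries_le_derivedSeries f n (Subgroup.mem_map_of_mem f hmem)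
    rw [hn] at this
    simpa using this
  · intro h x hx
    obtain ⟨n, hn⟩ := h x hx
    refine ⟨X ⧸ derivedSeries X n, inferInstance, QuotientGroup.mk' _, ?_, ?_⟩
    · refine ⟨n, ?_⟩
      rw [← map_derivedSeries_eq (QuotientGroup.mk'_surjective (derivedSeries X n))]
      rw [Subgroup.map_eq_bot_iff, QuotientGroup.ker_mk']
    · intro h1
      exact hn ((QuotientGroup.eq_one_iff x).1 h1)

theorem solvable_quot_derived (X : Type u) [Group X] (n : ℕ) :
    Group.IsSolvable (X ⧸ derivedSeries X n) := by
  refine ⟨n, ?_⟩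
  rw [← map_derivedSeries_eq (QuotientGroup.mk'_surjective (derivedSeries X n))]
  rw [Subgroup.map_eq_bot_iff, QuotientGroup.ker_mk']

theorem solvable_pi {ι : Type*} {X : Type*} [Group X] (h : Group.IsSolvable X) :
    Group.IsSolvable (ι → X) := by
  obtain ⟨n, hn⟩ := h.solvable
  refine ⟨n, ?_⟩
  rw [eq_bot_iff]
  intro y hy
  rw [Subgroup.mem_bot]
  funext i
  have := map_derivedSeries_le_derivedSeries (Pi.evalMonoidHom (fun _ : ι => X) i) n
    (Subgroup.mem_map_of_mem _ hy)
  rw [hn] at this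
  simpa using this

def wrBase (D S : Type*) [Group D] [Group S] : (S → D) →* D ≀ᵣ S where
  toFun y := ⟨y, 1⟩
  map_one' := rfl
  map_mul' a b := by ext <;> simp

theorem wr_ker_le (D S : Type*) [Group D] [Group S] :
    (RegularWreathProduct.rightHom : D ≀ᵣ S →* S).ker ≤ (wrBase D S).range := by
  intro y hy
  refine ⟨y.left, ?_⟩
  have : y.right = 1 := hy
  ext <;> simp [wrBase, this]

theorem wr_solvable {D S : Type*} [Group D] [Group S] (hD : Group.IsSolvable D) (hS : Group.IsSolvable S) :
    Group.IsSolvable (D ≀ᵣ S) := by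
  have := solvable_pi (ι := S) hD
  have := hS
  exact Group.isSolvable_of_ker_le_range (wrBase D S) RegularWreathProduct.rightHom (wr_ker_le D S)

theorem rs_of_injective {X Y : Type u} [Group X] [Group Y] (f : X →* Y)
    (hf : Function.Injective f) (hY : ResiduallySolvable Y) : ResiduallySolvable X := by
  intro x hx
  obtain ⟨S, i, g, hS, hg⟩ := hY (f x) (by rwa [Ne, map_eq_one_iff f hf])
  exact ⟨S, i, g.comp f, hS, hg⟩

/-- The regular wreath product of a residually solvable group by a solvable group. -/
theorem wr_rs {D : Type u} {S : Type} [Group D] [Group S] (hD : ResiduallySolvable D)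
    (hS : Group.IsSolvable S) : ResiduallySolvable (D ≀ᵣ S) := by
  intro x hx
  by_cases hr : x.right = 1
  · have : ∃ s, x.left s ≠ 1 := by
      by_contra hcon
      push Not at hcon
      exact hx (by ext s <;> simp [hcon, hr])
    obtain ⟨s, hs⟩ := this
    obtain ⟨n, hn⟩ := rs_iff.1 hD _ hs
    let q := QuotientGroup.mk' (derivedSeries D n)
    refine ⟨(D ⧸ derivedSeries D n) ≀ᵣ S, inferInstance,
      { toFun := fun y => ⟨fun s => q (y.left s), y.right⟩
        map_one' := by ext <;> simp
        map_mul' := fun a b => by ext <;> simp }, wr_solvable (solvable_quot_derived _ _) hS, ?_⟩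
    intro h1
    have h2 : q (x.left s) = 1 := congrFun (congrArg RegularWreathProduct.left h1) s
    exact hn ((QuotientGroup.eq_one_iff _).1 h2)
  · refine ⟨ULift.{u} S, inferInstance,
      MulEquiv.ulift.symm.toMonoidHom.comp RegularWreathProduct.rightHom, ?_, ?_⟩
    · have := hS
      exact Group.isSolvable_of_surjective (f := (MulEquiv.ulift : ULift.{u} S ≃* S).symm.toMonoidHom)
        ((MulEquiv.ulift : ULift.{u} S ≃* S).symm.surjective)
    · intro h1
      exact hr (by simpa using h1)

section amalgam

variable {ι : Type} {M : ι → Type u} [∀ i, Group (M i)] {C H : Type u} [Group C] [Group H]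

/-- Evaluation of a list of letters. -/
def ev (e : ∀ i, M i →* H) (l : List (Σ i, M i)) : H := (l.map fun a => e a.1 a.2).prod

@[simp] theorem ev_nil (e : ∀ i, M i →* H) : ev e [] = 1 := rfl
@[simp] theorem ev_cons (e : ∀ i, M i →* H) (a : Σ i, M i) (l : List (Σ i, M i)) :
    ev e (a :: l) = e a.1 a.2 * ev e l := by simp [ev]
@[simp] theorem ev_append (e : ∀ i, M i →* H) (l l' : List (Σ i, M i)) :
    ev e (l ++ l') = ev e l * ev e l' := by simp [ev]

/-- The universal property of the amalgam. -/
structure IsAmalgam (α : ∀ i, C →* M i) (r : ∀ i, M i →* C) (e : ∀ i, M i →* H) : Prop where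
  retr : ∀ i c, r i (α i c) = c
  comm : ∀ i j c, e i (α i c) = e j (α j c)
  lift : ∀ (X : Type u) [Group X] (f : ∀ i, M i →* X),
    (∀ i j c, f i (α i c) = f j (α j c)) → ∃ h : H →* X, ∀ i m, h (e i m) = f i m
  gen : ∀ K : Subgroup H, (∀ i m, e i m ∈ K) → ∀ h, h ∈ K

variable {α : ∀ i, C →* M i} {r : ∀ i, M i →* C} {e : ∀ i, M i →* H}

theorem exists_list (hA : IsAmalgam α r e) (h : H) : ∃ l, ev e l = h := by
  let K : Subgroup H :=
    { carrier := {h | ∃ l, ev e l = h}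
      one_mem' := ⟨[], rfl⟩
      mul_mem' := by
        rintro _ _ ⟨l, rfl⟩ ⟨l', rfl⟩
        exact ⟨l ++ l', by simp⟩
      inv_mem' := by
        rintro _ ⟨l, rfl⟩
        induction l with
        | nil => exact ⟨[], by simp⟩
        | cons a l ih =>
          obtain ⟨l', hl'⟩ := ih
          exact ⟨l' ++ [⟨a.1, a.2⁻¹⟩], by simp [hl']⟩ }
  exact hA.gen K (fun i m => ⟨[⟨i, m⟩], by simp⟩) h

/-- Alternating words with letters outside the amalgamated subgroup. -/
def AltWord (α : ∀ i, C →* M i) (l : List (Σ i, M i)) : Prop :=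
  l.IsChain (fun a b => a.1 ≠ b.1) ∧ ∀ a ∈ l, ∀ c, a.2 ≠ α a.1 c

theorem AltWord.of_cons {a : Σ i, M i} {l : List (Σ i, M i)} (h : AltWord α (a :: l)) :
    AltWord α l := ⟨h.1.tail, fun b hb => h.2 b (List.mem_cons_of_mem _ hb)⟩

/-- Absorb an element of the amalgamated subgroup. -/
theorem absorb (hA : IsAmalgam α r e) (i : ι) (c : C) (a : Σ i, M i) (l : List (Σ i, M i))
    (h : AltWord α (a :: l)) :
    ∃ l', l' ≠ [] ∧ AltWord α l' ∧ ev e l' = e i (α i c) * ev e (a :: l) := by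
  obtain ⟨j, y⟩ := a
  refine ⟨⟨j, α j c * y⟩ :: l, by simp, ⟨?_, ?_⟩, ?_⟩
  · have := h.1
    cases l with
    | nil => simp
    | cons b l => simpa using this
  · intro b hb c'
    rcases List.mem_cons.1 hb with rfl | hb
    · intro h1
      refine h.2 _ List.mem_cons_self (c⁻¹ * c') ?_
      simp only [map_mul, map_inv]
      simp only at h1
      rw [← h1]; group
    · exact h.2 b (List.mem_cons_of_mem _ hb) c'
  · simp [hA.comm i j c, mul_assoc]

theorem normal_form (hA : IsAmalgam α r e) (l : List (Σ i, M i)) :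
    (ev e l = 1 ∨ ∃ i c, ev e l = e i (α i c)) ∨
      ∃ l', l' ≠ [] ∧ AltWord α l' ∧ ev e l' = ev e l := by
  induction l with
  | nil => left; left; rfl
  | cons a l ih =>
    obtain ⟨i, x⟩ := a
    -- a single letter
    have single : ∀ z : M i, e i z = ev e (⟨i, x⟩ :: l) →
        (ev e (⟨i, x⟩ :: l) = 1 ∨ ∃ i' c, ev e (⟨i, x⟩ :: l) = e i' (α i' c)) ∨
        ∃ l', l' ≠ [] ∧ AltWord α l' ∧ ev e l' = ev e (⟨i, x⟩ :: l) := by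
      intro z hz
      by_cases hc : ∃ c, z = α i c
      · obtain ⟨c, rfl⟩ := hc
        exact Or.inl (Or.inr ⟨i, c, hz.symm⟩)
      · push Not at hc
        exact Or.inr ⟨[⟨i, z⟩], by simp, ⟨by simp, by simpa using hc⟩, by rw [← hz]; simp⟩
    rcases ih with (h1 | ⟨j, c, h1⟩) | ⟨l', hne, hl', h1⟩
    · exact single x (by simp [h1])
    · exact single (x * α i c) (by simp [h1, hA.comm i j])
    · obtain ⟨⟨j, y⟩, m, rfl⟩ := List.exists_cons_of_ne_nil hne
      by_cases hij : i = j
      · subst hij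
        by_cases hc : ∃ c, x * y = α i c
        · obtain ⟨c, hc⟩ := hc
          have hev : ev e (⟨i, x⟩ :: l) = e i (α i c) * ev e m := by
            rw [← hc]; simp [← h1, mul_assoc]
          cases m with
          | nil => exact Or.inl (Or.inr ⟨i, c, by rw [hev]; simp⟩)
          | cons b m =>
            obtain ⟨l'', h2, h3, h4⟩ := absorb hA i c b m hl'.of_cons
            exact Or.inr ⟨l'', h2, h3, by rw [h4, hev]⟩
        · push Not at hc
          refine Or.inr ⟨⟨i, x * y⟩ :: m, by simp, ⟨?_, ?_⟩, ?_⟩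
          · have := hl'.1
            cases m with
            | nil => simp
            | cons b l => simpa using this
          · intro b hb c'
            rcases List.mem_cons.1 hb with rfl | hb
            · exact hc c'
            · exact hl'.2 b (List.mem_cons_of_mem _ hb) c'
          · simp [← h1, mul_assoc]
      · by_cases hc : ∃ c, x = α i c
        · obtain ⟨c, rfl⟩ := hc
          obtain ⟨l'', h2, h3, h4⟩ := absorb hA i c _ _ hl'
          exact Or.inr ⟨l'', h2, h3, by rw [h4, h1]; simp⟩
        · push Not at hc
          refine Or.inr ⟨⟨i, x⟩ :: ⟨j, y⟩ :: m, by simp, ⟨?_, ?_⟩, ?_⟩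
          · exact List.isChain_cons_cons.2 ⟨hij, hl'.1⟩
          · intro b hb c'
            rcases List.mem_cons.1 hb with rfl | hb
            · exact hc c'
            · exact hl'.2 b hb c'
          · rw [ev_cons, h1, ev_cons]

open Classical in
/-- The retraction `M j → M i`: identity for `j = i`, and through `C` otherwise. -/
noncomputable def sideHom (α : ∀ i, C →* M i) (r : ∀ i, M i →* C) (i j : ι) : M j →* M i :=
  if h : j = i then h ▸ MonoidHom.id (M j) else (α i).comp (r j)

theorem sideHom_self (i : ι) (m : M i) : sideHom α r i i m = m := by simp [sideHom]

theorem sideHom_ne {i j : ι} (h : j ≠ i) (m : M j) : sideHom α r i j m = α i (r j m) := by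
  simp [sideHom, h]

open Classical in
theorem sep_step (hA : IsAmalgam α r e) (i : ι) (hM : ResiduallySolvable (M i)) (p : M i)
    (hp : ∀ c, p ≠ α i c) (S : Type u) [Group S] (hS : Group.IsSolvable S) (f : H →* S)
    (u : List (Σ i, M i))
    (hu : ∀ v, v <:+ u → v ≠ [] → f (ev e v) ∉ (f.comp (e i)).range) :
    ∃ (S' : Type u) (_ : Group S') (g : H →* S'), Group.IsSolvable S' ∧
      ∀ j, j ≠ i → g (ev e (u ++ [⟨i, p⟩])) ∉ (g.comp (e j)).range := by
  have hne : p⁻¹ * α i (r i p) ≠ 1 := fun h => hp _ (inv_mul_eq_one.1 h)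
  obtain ⟨n, hn⟩ := rs_iff.1 hM _ hne
  set q := QuotientGroup.mk' (derivedSeries (M i) n) with hq
  -- the image of `C`
  set Cb := (q.comp (α i)).range with hCb
  have hpC : q p ∉ Cb := by
    rintro ⟨c, hc⟩
    have h1 : p⁻¹ * α i c ∈ derivedSeries (M i) n := QuotientGroup.eq.1 hc.symm
    have h2 := map_derivedSeries_le_derivedSeries ((α i).comp (r i)) n
      (Subgroup.mem_map_of_mem _ h1)
    apply hn
    have h3 := mul_mem h1 (inv_mem h2)
    simpa [hA.retr, mul_assoc] using h3
  set T := (f.comp (e i)).range with hT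
  let F : ∀ j, M j →* ((M i ⧸ derivedSeries (M i) n) ≀ᵣ S) := fun j => MonoidHom.mk'
    (fun m => ⟨fun x => if x ∈ T then q (sideHom α r i j m) else q (α i (r j m)), f (e j m)⟩)
    (by
      intro a b
      ext x
      · by_cases hj : j = i
        · subst hj
          have hTx : (f (e j a))⁻¹ * x ∈ T ↔ x ∈ T :=
            Subgroup.mul_mem_cancel_left _ (inv_mem ⟨a, rfl⟩)
          by_cases hx : x ∈ T <;> simp [hTx, hx]
        · simp [sideHom_ne hj]
      · simp)
  have Fval : ∀ j m x, (F j m).left x =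
      if x ∈ T then q (sideHom α r i j m) else q (α i (r j m)) := fun _ _ _ => rfl
  have side_alpha : ∀ j c, sideHom α r i j (α j c) = α i c := by
    intro j c
    by_cases hj : j = i
    · subst hj; exact sideHom_self _ _
    · rw [sideHom_ne hj, hA.retr]
  obtain ⟨g, hg⟩ := hA.lift _ F (by
    intro j j' c
    ext x
    · simp [Fval, side_alpha, hA.retr]
    · change f (e j (α j c)) = f (e j' (α j' c))
      rw [hA.comm j j'])
  have hright : ∀ l, (g (ev e l)).right = f (ev e l) := by
    intro l
    induction l with
    | nil => simp
    | cons a l ih =>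
      rw [ev_cons, map_mul, map_mul, RegularWreathProduct.mul_right, ih, hg]; rfl
  refine ⟨_, inferInstance, g, wr_solvable (solvable_quot_derived _ _) hS, ?_⟩
  -- value on `u`
  have hval : ∀ v, v <:+ u → (g (ev e v)).left (f (ev e v)) ∈ Cb := by
    intro v
    induction v with
    | nil => intro _; simp
    | cons a v ih =>
      intro hsuf
      have hsuf' : v <:+ u := (List.suffix_cons a v).trans hsuf
      have key : (g (ev e (a :: v))).left (f (ev e (a :: v))) =
          (F a.1 a.2).left (f (ev e (a :: v))) * (g (ev e v)).left (f (ev e v)) := by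
        have hr : (F a.1 a.2).right = f (e a.1 a.2) := rfl
        rw [ev_cons, map_mul, RegularWreathProduct.mul_left, Pi.mul_apply, hg, hr, map_mul,
          inv_mul_cancel_left]
      rw [key]
      refine mul_mem ?_ (ih hsuf')
      obtain ⟨j, y⟩ := a
      have hx := hu _ hsuf (by simp)
      rw [Fval, if_neg hx]
      exact ⟨r j y, rfl⟩
  intro j hj hmem
  obtain ⟨m, hm⟩ := hmem
  have h1 : (g (ev e (u ++ [⟨i, p⟩]))).left (f (ev e u)) ∈ Cb := by
    rw [← hm, MonoidHom.comp_apply, hg, Fval, sideHom_ne hj, ite_self]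
    exact ⟨r j m, rfl⟩
  have h2 : (g (ev e (u ++ [⟨i, p⟩]))).left (f (ev e u)) =
      (g (ev e u)).left (f (ev e u)) * q p := by
    have : ev e [⟨i, p⟩] = e i p := by simp
    rw [ev_append, this, map_mul, RegularWreathProduct.mul_left, Pi.mul_apply, hright, hg,
      inv_mul_cancel, Fval, if_pos (one_mem _), sideHom_self]
  rw [h2] at h1
  exact hpC ((Subgroup.mul_mem_cancel_left _ (hval u List.suffix_rfl)).1 h1)

theorem common_sep (i : ι) (u : List (Σ i, M i))
    (hu : ∀ v, v <:+ u → v ≠ [] → ∃ (S : Type u) (_ : Group S) (f : H →* S), Group.IsSolvable S ∧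
      f (ev e v) ∉ (f.comp (e i)).range) :
    ∃ (S : Type u) (_ : Group S) (f : H →* S), Group.IsSolvable S ∧
      ∀ v, v <:+ u → v ≠ [] → f (ev e v) ∉ (f.comp (e i)).range := by
  induction u with
  | nil =>
    refine ⟨PUnit, inferInstance, 1, inferInstance, ?_⟩
    intro v hv hv'
    exact absurd (List.suffix_nil.1 hv) hv'
  | cons a u ih =>
    obtain ⟨S, _, f, hS, hf⟩ := ih (fun v hv => hu v (hv.trans (List.suffix_cons a u)))
    obtain ⟨S', _, f', hS', hf'⟩ := hu (a :: u) List.suffix_rfl (by simp)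
    refine ⟨S × S', inferInstance, f.prod f', inferInstance, ?_⟩
    intro v hv hv'
    rintro ⟨m, hm⟩
    rw [MonoidHom.comp_apply, MonoidHom.prod_apply, MonoidHom.prod_apply, Prod.mk.injEq] at hm
    rcases List.suffix_cons_iff.1 hv with rfl | hv
    · exact hf' ⟨m, hm.2⟩
    · exact hf v hv hv' ⟨m, hm.1⟩

theorem sep (hA : IsAmalgam α r e) (hM : ∀ i, ResiduallySolvable (M i)) (n : ℕ) :
    ∀ (u : List (Σ i, M i)) (i : ι) (p : M i), u.length = n → AltWord α (u ++ [⟨i, p⟩]) →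
    ∀ j, j ≠ i → ∃ (S : Type u) (_ : Group S) (f : H →* S), Group.IsSolvable S ∧
      f (ev e (u ++ [⟨i, p⟩])) ∉ (f.comp (e j)).range := by
  induction n using Nat.strong_induction_on with
  | _ n ih =>
    intro u i p hlen hw j hj
    obtain ⟨S, _, f, hS, hf⟩ := common_sep (e := e) i u (by
      intro v hv hv'
      obtain ⟨w, ⟨j, y⟩, rfl⟩ := (List.eq_nil_or_concat v).resolve_left hv'
      rw [List.concat_eq_append] at hv ⊢
      have hsuf : w ++ [⟨j, y⟩] ++ [⟨i, p⟩] <:+ u ++ [⟨i, p⟩] := by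
        obtain ⟨t, ht⟩ := hv
        exact ⟨t, by rw [← ht]; simp⟩
      have hch := hw.1.suffix hsuf
      have hji : j ≠ i := by
        have h1 : w ++ [⟨j, y⟩] ++ [⟨i, p⟩] = w ++ ⟨j, y⟩ :: ⟨i, p⟩ :: [] := by simp
        rw [h1] at hch
        exact (List.isChain_append_cons_cons.1 hch).2.1
      refine ih w.length ?_ w j y rfl ⟨hch.left_of_append, ?_⟩ i hji.symm
      · have := hv.length_le
        simp at this
        omega
      · intro b hb
        exact hw.2 b (hsuf.subset (List.mem_append_left _ hb)))
    obtain ⟨S', iS', g, hS', hg⟩ := sep_step hA i (hM i) p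
      (hw.2 ⟨i, p⟩ (by simp)) S hS f u hf
    exact ⟨S', iS', g, hS', hg j hj⟩

theorem amalgam_rs (hA : IsAmalgam α r e) (hM : ∀ i, ResiduallySolvable (M i))
    (hι : ∀ i : ι, ∃ j, j ≠ i) : ResiduallySolvable H := by
  intro h hh
  obtain ⟨l, rfl⟩ := exists_list hA h
  rcases normal_form hA l with (h1 | ⟨i, c, h1⟩) | ⟨w, hne, hw, h1⟩
  · exact absurd h1 hh
  · obtain ⟨g, hg⟩ := hA.lift (M i) (fun j => (α i).comp (r j)) (by
      intro j j' c
      simp [hA.retr])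
    have hne : α i c ≠ 1 := by
      intro h2
      rw [h1, h2, map_one] at hh
      exact hh rfl
    obtain ⟨S, _, f, hS, hf⟩ := hM i _ hne
    refine ⟨S, inferInstance, f.comp g, hS, ?_⟩
    rw [h1, MonoidHom.comp_apply, hg]
    simpa [hA.retr] using hf
  · obtain ⟨u, ⟨i, p⟩, rfl⟩ := (List.eq_nil_or_concat w).resolve_left hne
    rw [List.concat_eq_append] at hw h1
    obtain ⟨j, hj⟩ := hι i
    obtain ⟨S, _, f, hS, hf⟩ := sep hA hM u.length u i p rfl hw j hj
    refine ⟨S, inferInstance, f, hS, ?_⟩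
    rw [← h1]
    intro h2
    exact hf (by rw [h2]; exact one_mem _)

end amalgam

section binary

variable {P Q C H : Type u} [Group P] [Group Q] [Group C] [Group H]

instance condGroup (b : Bool) : Group (cond b P Q) :=
  match b with
  | true => inferInstanceAs (Group P)
  | false => inferInstanceAs (Group Q)

theorem amalgam2_rs (α : C →* P) (β : C →* Q) (rP : P →* C) (rQ : Q →* C)
    (eP : P →* H) (eQ : Q →* H)
    (hα : ∀ c, rP (α c) = c) (hβ : ∀ c, rQ (β c) = c)
    (comm : ∀ c, eP (α c) = eQ (β c))
    (lift : ∀ (X : Type u) [Group X] (f : P →* X) (g : Q →* X), (∀ c, f (α c) = g (β c)) →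
      ∃ h : H →* X, (∀ p, h (eP p) = f p) ∧ (∀ q, h (eQ q) = g q))
    (gen : ∀ K : Subgroup H, (∀ p, eP p ∈ K) → (∀ q, eQ q ∈ K) → ∀ h, h ∈ K)
    (hP : ResiduallySolvable P) (hQ : ResiduallySolvable Q) : ResiduallySolvable H := by
  let M : Bool → Type u := fun b => cond b P Q
  let α' : ∀ b, C →* M b := fun b => match b with
    | true => α
    | false => β
  let r' : ∀ b, M b →* C := fun b => match b with
    | true => rP
    | false => rQ
  let e' : ∀ b, M b →* H := fun b => match b with
    | true => eP
    | false => eQ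
  have hA : IsAmalgam α' r' e' :=
    { retr := by
        intro b c
        cases b
        · exact hβ c
        · exact hα c
      comm := by
        intro i j c
        cases i <;> cases j
        · rfl
        · exact (comm c).symm
        · exact comm c
        · rfl
      lift := by
        intro X _ f hf
        obtain ⟨h, h1, h2⟩ := lift X (f true) (f false) (fun c => hf true false c)
        refine ⟨h, fun i => ?_⟩
        cases i
        · exact h2
        · exact h1
      gen := fun K hK => gen K (hK true) (hK false) }
  refine amalgam_rs hA ?_ (fun i => ⟨!i, by cases i <;> simp⟩)
  intro i
  cases i
  · exact hQ
  · exact hP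

/-- The relators of the amalgamated product. -/
def amRels (α : C →* P) (β : C →* Q) : Set (Monoid.Coprod P Q) :=
  Set.range fun c => Monoid.Coprod.inl (α c) * (Monoid.Coprod.inr (β c))⁻¹

theorem exists_amalgam2 (α : C →* P) (β : C →* Q) :
    ∃ (H : Type u) (_ : Group H) (eP : P →* H) (eQ : Q →* H),
      (∀ c, eP (α c) = eQ (β c)) ∧
      (∀ (X : Type u) [Group X] (f : P →* X) (g : Q →* X), (∀ c, f (α c) = g (β c)) →
        ∃ h : H →* X, (∀ p, h (eP p) = f p) ∧ (∀ q, h (eQ q) = g q)) ∧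
      (∀ K : Subgroup H, (∀ p, eP p ∈ K) → (∀ q, eQ q ∈ K) → ∀ h, h ∈ K) := by
  let N := Subgroup.normalClosure (amRels α β)
  refine ⟨Monoid.Coprod P Q ⧸ N, inferInstance, (QuotientGroup.mk' N).comp Monoid.Coprod.inl,
    (QuotientGroup.mk' N).comp Monoid.Coprod.inr, ?_, ?_, ?_⟩
  · intro c
    have h1 : Monoid.Coprod.inl (α c) * (Monoid.Coprod.inr (β c))⁻¹ ∈ N :=
      Subgroup.subset_normalClosure ⟨c, rfl⟩
    have h2 := (QuotientGroup.eq_one_iff _).2 h1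
    exact mul_inv_eq_one.1 h2
  · intro X _ f g hfg
    refine ⟨QuotientGroup.lift N (Monoid.Coprod.lift f g) ?_, ?_, ?_⟩
    · intro x hx
      have : N ≤ (Monoid.Coprod.lift f g).ker := by
        refine Subgroup.normalClosure_le_normal ?_
        rintro _ ⟨c, rfl⟩
        simp [MonoidHom.mem_ker, hfg]
      exact this hx
    · intro p; exact Monoid.Coprod.lift_apply_inl f g p
    · intro q; exact Monoid.Coprod.lift_apply_inr f g q
  · intro K hP hQ h
    obtain ⟨x, rfl⟩ := QuotientGroup.mk'_surjective N h
    induction x using Monoid.Coprod.induction_on with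
    | inl m => exact hP m
    | inr m => exact hQ m
    | mul x y hx hy => rw [map_mul]; exact mul_mem hx hy

end binary

section chain

/-- `Q` is the chain amalgam of `n` copies of `G`. -/
structure IsChainGp (n : ℕ) (Q : Type u) [Group Q] (e : ℕ → G →* Q) : Prop where
  rel : ∀ i, i + 1 < n → ∀ b : B, e i b = e (i + 1) (φ b)
  lift : ∀ (X : Type u) [Group X] (f : ℕ → G →* X),
    (∀ i, i + 1 < n → ∀ b : B, f i b = f (i + 1) (φ b)) →
    ∃ h : Q →* X, ∀ i, i < n → ∀ g, h (e i g) = f i g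
  gen : ∀ K : Subgroup Q, (∀ i, i < n → ∀ g, e i g ∈ K) → ∀ h, h ∈ K

theorem exists_chain (hG : ResiduallySolvable G) (π : G →* A × B)
    (hπA : ∀ a : A, π (a : G) = (a, 1)) (hπB : ∀ b : B, π (b : G) = (1, b)) (n : ℕ) :
    ∃ (Q : Type u) (_ : Group Q) (e : ℕ → G →* Q), IsChainGp G A B φ (n + 1) Q e ∧
      ResiduallySolvable Q := by
  induction n with
  | zero =>
    refine ⟨G, inferInstance, fun _ => MonoidHom.id G, ⟨?_, ?_, ?_⟩, hG⟩
    · intro i hi; omega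
    · intro X _ f _
      refine ⟨f 0, ?_⟩
      intro i hi g
      obtain rfl : i = 0 := by omega
      rfl
    · intro K hK h
      exact hK 0 (by omega) h
  | succ n ih =>
    obtain ⟨Q, _, e, hQ, hrs⟩ := ih
    let α : B →* Q := (e n).comp B.subtype
    let β : B →* G := A.subtype.comp φ.toMonoidHom
    obtain ⟨H, _, eQ, eG, hcomm, hlift, hgen⟩ := exists_amalgam2 α β
    obtain ⟨rQ, hrQ⟩ := hQ.lift B
      (fun i => if i = n then (MonoidHom.snd A B).comp π else 1) (by
        intro i hi b
        have h1 : i ≠ n := by omega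
        by_cases h2 : i + 1 = n <;> simp [h1, h2, hπA])
    let rG : G →* B := φ.symm.toMonoidHom.comp ((MonoidHom.fst A B).comp π)
    refine ⟨H, inferInstance, fun i => if i = n + 1 then eG else eQ.comp (e i), ⟨?_, ?_, ?_⟩, ?_⟩
    · intro i hi b
      have h1 : i ≠ n + 1 := by omega
      by_cases h2 : i = n
      · subst h2
        simpa [α, β] using hcomm b
      · have h3 := hQ.rel i (by omega) b
        simp [h1, h2, h3]
    · intro X _ f hf
      obtain ⟨fQ, hfQ⟩ := hQ.lift X f (fun i hi => hf i (by omega))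
      obtain ⟨h, h1, h2⟩ := hlift X fQ (f (n + 1)) (by
        intro b
        exact (hfQ n (by omega) b).trans (hf n (by omega) b))
      refine ⟨h, ?_⟩
      intro i hi g
      by_cases hin : i = n + 1
      · subst hin; simpa using h2 g
      · simp [hin, h1, hfQ i (by omega)]
    · intro K hK
      refine hgen K ?_ ?_
      · intro p
        refine hQ.gen (K.comap eQ) ?_ p
        intro i hi g
        have := hK i (by omega) g
        rwa [if_neg (by omega)] at this
      · intro g
        simpa using hK (n + 1) (by omega) g
    · refine amalgam2_rs α β rQ rG eQ eG ?_ ?_ hcomm hlift hgen hrs hG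
      · intro b
        exact (hrQ n (by omega) b).trans (by simp [hπB])
      · intro b
        simp [rG, β, hπA]

end chain

section bar

theorem barHig_rel (i : ZMod k) (b : B) :
    (QuotientGroup.mk' (Subgroup.normalClosure (barHigRels G A B φ k)))
      (Monoid.CoprodI.of (M := fun _ : ZMod k => G) (i := i) (b : G)) =
    (QuotientGroup.mk' (Subgroup.normalClosure (barHigRels G A B φ k)))
      (Monoid.CoprodI.of (M := fun _ : ZMod k => G) (i := i + 1) (φ b : G)) := by
  have h1 : Monoid.CoprodI.of (M := fun _ : ZMod k => G) (i := i) ((b : G)) *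
      (Monoid.CoprodI.of (M := fun _ : ZMod k => G) (i := i + 1) ((φ b : G)))⁻¹ ∈
      Subgroup.normalClosure (barHigRels G A B φ k) :=
    Subgroup.subset_normalClosure (Set.mem_iUnion₂.2 ⟨i, b, rfl⟩)
  exact mul_inv_eq_one.1 ((QuotientGroup.eq_one_iff _).2 h1)

/-- The canonical maps into `BarHig`. -/
def barOf (i : ZMod k) : G →* BarHig G A B φ k :=
  (QuotientGroup.mk' (Subgroup.normalClosure (barHigRels G A B φ k))).comp
    (Monoid.CoprodI.of (M := fun _ : ZMod k => G) (i := i))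

theorem barOf_rel (i : ZMod k) (b : B) :
    barOf G A B φ k i b = barOf G A B φ k (i + 1) (φ b) := barHig_rel G A B φ k i b

theorem bar_lift (X : Type u) [Group X] (f : ZMod k → G →* X)
    (hf : ∀ i (b : B), f i b = f (i + 1) (φ b)) :
    ∃ h : BarHig G A B φ k →* X, ∀ i g, h (barOf G A B φ k i g) = f i g := by
  refine ⟨QuotientGroup.lift _ (Monoid.CoprodI.lift f) ?_, ?_⟩
  · intro x hx
    have : Subgroup.normalClosure (barHigRels G A B φ k) ≤ (Monoid.CoprodI.lift f).ker := by
      refine Subgroup.normalClosure_le_normal ?_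
      intro y hy
      obtain ⟨i, b, rfl⟩ := Set.mem_iUnion₂.1 hy
      simp [MonoidHom.mem_ker, ← hf]
    exact this hx
  · intro i g
    exact Monoid.CoprodI.lift_of f g

theorem bar_gen (K : Subgroup (BarHig G A B φ k)) (hK : ∀ i g, barOf G A B φ k i g ∈ K) :
    ∀ h, h ∈ K := by
  intro h
  obtain ⟨x, rfl⟩ := QuotientGroup.mk'_surjective
    (Subgroup.normalClosure (barHigRels G A B φ k)) h
  induction x using Monoid.CoprodI.induction_on with
  | one => exact one_mem _
  | of i m => exact hK i m
  | mul x y hx hy => rw [map_mul]; exact mul_mem hx hy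

theorem bar_rs (hG : ResiduallySolvable G) (π : G →* A × B)
    (hπA : ∀ a : A, π (a : G) = (a, 1)) (hπB : ∀ b : B, π (b : G) = (1, b)) (hk : 4 ≤ k) :
    ResiduallySolvable (BarHig G A B φ k) := by
  obtain ⟨n, rfl⟩ : ∃ n, k = n + 2 + 2 := ⟨k - 4, by omega⟩
  obtain ⟨P, _, eP, hP, hPrs⟩ := exists_chain G A B φ hG π hπA hπB 1
  obtain ⟨Q, _, eQ, hQ, hQrs⟩ := exists_chain G A B φ hG π hπA hπB (n + 1)
  let o : ZMod (n + 2 + 2) → G →* BarHig G A B φ (n + 2 + 2) := barOf G A B φ (n + 2 + 2)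
  have ho : ∀ i (b : B), o i b = o (i + 1) (φ b) := barOf_rel G A B φ (n + 2 + 2)
  let πA : G →* B := φ.symm.toMonoidHom.comp ((MonoidHom.fst A B).comp π)
  let πB : G →* B := (MonoidHom.snd A B).comp π
  have pAA : ∀ b : B, πA (φ b) = b := fun b => by simp [πA, hπA]
  have pAB : ∀ b : B, πA b = 1 := fun b => by simp [πA, hπB]
  have pBA : ∀ b : B, πB (φ b) = 1 := fun b => by simp [πB, hπA]
  have pBB : ∀ b : B, πB b = b := fun b => by simp [πB, hπB]
  let ψ : B →* G := A.subtype.comp φ.toMonoidHom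
  let α : Monoid.Coprod B B →* P :=
    Monoid.Coprod.lift ((eP 0).comp ψ) ((eP 1).comp B.subtype)
  let β : Monoid.Coprod B B →* Q :=
    Monoid.Coprod.lift ((eQ (n + 1)).comp B.subtype) ((eQ 0).comp ψ)
  obtain ⟨rP, hrP⟩ := hP.lift (Monoid.Coprod B B)
    (fun i => if i = 0 then Monoid.Coprod.inl.comp πA else Monoid.Coprod.inr.comp πB) (by
      intro i hi b
      obtain rfl : i = 0 := by omega
      simp [pAB, pBA])
  obtain ⟨rQ, hrQ⟩ := hQ.lift (Monoid.Coprod B B)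
    (fun i => if i = 0 then Monoid.Coprod.inr.comp πA else
      if i = n + 1 then Monoid.Coprod.inl.comp πB else 1) (by
      intro i hi b
      have h1 : i ≠ n + 1 := by omega
      by_cases h2 : i = 0 <;> simp [h1, h2, pAB] <;> split_ifs <;> simp [pBA])
  obtain ⟨jP, hjP⟩ := hP.lift _ (fun i => o ((n + 2 + i : ℕ) : ZMod (n + 2 + 2))) (by
    intro i hi b
    simp only [ho _ b]
    congr 2
    push_cast; ring)
  obtain ⟨jQ, hjQ⟩ := hQ.lift _ (fun i => o ((i : ℕ) : ZMod (n + 2 + 2))) (by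
    intro i hi b
    simp only [ho _ b]
    congr 2
    push_cast; ring)
  have cast0 : ((n + 2 + 1 : ℕ) : ZMod (n + 2 + 2)) + 1 = 0 := by
    have := ZMod.natCast_self (n + 2 + 2)
    rw [← this]; push_cast; ring
  refine amalgam2_rs α β rP rQ jP jQ ?_ ?_ ?_ ?_ ?_ hPrs hQrs
  · suffices h : rP.comp α = MonoidHom.id _ from fun c => DFunLike.congr_fun h c
    refine Monoid.Coprod.hom_ext ?_ ?_
    · ext b
      exact (hrP 0 (by omega) _).trans (by simp [ψ, pAA])
    · ext b
      exact (hrP 1 (by omega) _).trans (by simp [pBB])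
  · suffices h : rQ.comp β = MonoidHom.id _ from fun c => DFunLike.congr_fun h c
    refine Monoid.Coprod.hom_ext ?_ ?_
    · ext b
      exact (hrQ (n + 1) (by omega) _).trans (by simp [pBB])
    · ext b
      exact (hrQ 0 (by omega) _).trans (by simp [ψ, pAA])
  · suffices h : jP.comp α = jQ.comp β from fun c => DFunLike.congr_fun h c
    refine Monoid.Coprod.hom_ext ?_ ?_
    · ext b
      refine (hjP 0 (by omega) _).trans (Eq.trans ?_ (hjQ (n + 1) (by omega) _).symm)
      refine Eq.trans ?_ (ho _ b).symm
      simp only [ψ]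
      change o _ (φ b : G) = o _ (φ b : G)
      congr 2
      push_cast; ring
    · ext b
      refine (hjP 1 (by omega) _).trans (Eq.trans ?_ (hjQ 0 (by omega) _).symm)
      refine (ho _ b).trans ?_
      rw [cast0]
      change o _ (φ b : G) = o _ (φ b : G)
      congr 2
  · intro X _ f g hfg
    have hfg1 : ∀ b : B, f (eP 0 (φ b)) = g (eQ (n + 1) b) := fun b =>
      hfg (Monoid.Coprod.inl b)
    have hfg2 : ∀ b : B, f (eP 1 b) = g (eQ 0 (φ b)) := fun b => hfg (Monoid.Coprod.inr b)
    let F : ℕ → G →* X := fun v => if v < n + 2 then g.comp (eQ v) else f.comp (eP (v - (n + 2)))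
    obtain ⟨h, hh⟩ := bar_lift G A B φ (n + 2 + 2) X (fun z => F z.val) (by
      intro z b
      have hz := ZMod.val_lt z
      have hval : (z + 1).val = (z.val + 1) % (n + 2 + 2) := by
        rw [ZMod.val_add, ZMod.val_one'']
        omega
      simp only [hval]
      rcases lt_or_ge (z.val + 1) (n + 2) with h1 | h1
      · rw [Nat.mod_eq_of_lt (by omega)]
        have h2 : z.val < n + 2 := by omega
        simp [F, h1, h2, hQ.rel z.val h1 b]
      · rcases lt_or_ge z.val (n + 2) with h2 | h2
        · have h3 : z.val = n + 1 := by omega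
          rw [Nat.mod_eq_of_lt (by omega), h3]
          simp [F, hfg1]
        · rcases lt_or_ge z.val (n + 3) with h4 | h4
          · have h3 : z.val = n + 2 := by omega
            rw [Nat.mod_eq_of_lt (by omega), h3]
            simp [F, hP.rel 0 (by omega) b]
          · have h3 : z.val = n + 3 := by omega
            have h5 : n + 3 + 1 = n + 2 + 2 := rfl
            rw [h3, h5, Nat.mod_self]
            have h6 : n + 3 - (n + 2) = 1 := by omega
            simp [F, h6, hfg2])
    have vn : ∀ i, i < n + 2 + 2 → ((i : ℕ) : ZMod (n + 2 + 2)).val = i := fun i hi =>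
      ZMod.val_natCast_of_lt hi
    refine ⟨h, ?_, ?_⟩
    · suffices hs : ∀ p, p ∈ (h.comp jP).eqLocus f from hs
      refine hP.gen _ ?_
      intro i hi x
      change h (jP _) = _
      rw [hjP i hi]
      refine (hh _ _).trans ?_
      rw [vn _ (by omega)]
      simp [F]
    · suffices hs : ∀ p, p ∈ (h.comp jQ).eqLocus g from hs
      refine hQ.gen _ ?_
      intro i hi x
      change h (jQ _) = _
      rw [hjQ i hi]
      refine (hh _ _).trans ?_
      rw [vn _ (by omega)]
      have : i < n + 2 := hi
      simp [F, this]
  · intro K hKP hKQ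
    refine bar_gen G A B φ (n + 2 + 2) K ?_
    intro z x
    have hz := ZMod.val_lt z
    rcases lt_or_ge z.val (n + 2) with h2 | h2
    · have := hKQ (eQ z.val x)
      rw [hjQ _ (by omega)] at this
      simpa [o] using this
    · have := hKP (eP (z.val - (n + 2)) x)
      rw [hjP _ (by omega)] at this
      have h3 : n + 2 + (z.val - (n + 2)) = z.val := by omega
      rw [h3] at this
      simpa [o] using this

end bar

section higPart

theorem hig_rs (hk : k ≠ 0) (hbar : ResiduallySolvable (BarHig G A B φ k)) :
    ResiduallySolvable (Hig G A B φ k) := by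
  have : NeZero k := ⟨hk⟩
  let N0 := Subgroup.normalClosure (higRels G A B φ k)
  let mk : Monoid.Coprod G (FreeGroup Unit) →* Hig G A B φ k := QuotientGroup.mk' N0
  let γ : G →* Hig G A B φ k := mk.comp Monoid.Coprod.inl
  let t : Hig G A B φ k := mk (higT G)
  have ht : t ^ k = 1 := by
    have h1 : higT G ^ k ∈ N0 := Subgroup.subset_normalClosure (Or.inl rfl)
    have h2 : mk (higT G ^ k) = 1 := (QuotientGroup.eq_one_iff _).2 h1
    rwa [map_pow] at h2
  have hconj : ∀ b : B, t⁻¹ * γ b * t = γ (φ b) := by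
    intro b
    have h1 : (higT G)⁻¹ * Monoid.Coprod.inl (b : G) * higT G *
      (Monoid.Coprod.inl ((φ b : G)) : Monoid.Coprod G (FreeGroup Unit))⁻¹ ∈ N0 :=
      Subgroup.subset_normalClosure (Or.inr (Set.mem_iUnion.2 ⟨b, rfl⟩))
    have h2 : mk _ = 1 := (QuotientGroup.eq_one_iff _).2 h1
    simp only [map_mul, map_inv] at h2
    exact mul_inv_eq_one.1 h2
  have gen : ∀ K : Subgroup (Hig G A B φ k), (∀ g, γ g ∈ K) → t ∈ K → ∀ h, h ∈ K := by
    intro K hγ htK h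
    obtain ⟨x, rfl⟩ := QuotientGroup.mk'_surjective N0 h
    induction x using Monoid.Coprod.induction_on with
    | inl m => exact hγ m
    | inr m =>
      induction m using FreeGroup.induction_on with
      | C1 => rw [map_one, map_one]; exact one_mem _
      | of x => exact htK
      | inv_of x ih => rw [map_inv, map_inv]; exact inv_mem ih
      | mul x y hx hy => rw [map_mul, map_mul]; exact mul_mem hx hy
    | mul x y hx hy => rw [map_mul]; exact mul_mem hx hy
  -- powers of `t`
  have htz : ∀ m m' : ℤ, (m : ZMod k) = (m' : ZMod k) → t ^ m = t ^ m' := by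
    intro m m' h
    obtain ⟨d, hd⟩ := (ZMod.intCast_eq_intCast_iff_dvd_sub m m' k).1 h
    have : m' = m + k * d := by omega
    rw [this, zpow_add, zpow_mul, zpow_natCast, ht, one_zpow, mul_one]
  -- the map from `BarHig`
  obtain ⟨ψ, hψ⟩ := bar_lift G A B φ k (Hig G A B φ k)
    (fun i => (MulAut.conj (t ^ (i.val : ℤ))).toMonoidHom.comp γ) (by
      intro i b
      have h1 : t ^ ((i + 1).val : ℤ) = t ^ (i.val : ℤ) * t := by
        rw [← zpow_add_one]
        apply htz
        simp
      simp only [MonoidHom.comp_apply, ← hconj]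
      simp only [MulEquiv.coe_toMonoidHom, MulAut.conj_apply, h1]
      group)
  have hψ' : ∀ (m : ℤ) g, ψ (barOf G A B φ k (m : ZMod k) g) = t ^ m * γ g * (t ^ m)⁻¹ := by
    intro m g
    rw [hψ]
    have : t ^ (((m : ZMod k).val : ℕ) : ℤ) = t ^ m := htz _ _ (by simp)
    change t ^ (((m : ZMod k).val : ℕ) : ℤ) * γ g * (t ^ (((m : ZMod k).val : ℕ) : ℤ))⁻¹ = _
    rw [this]
  have hψ'' : ∀ i g, ψ (barOf G A B φ k i g) =
      t ^ (i.val : ℤ) * γ g * (t ^ (i.val : ℤ))⁻¹ := fun i g => hψ i g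
  have hψ0 : ∀ g, ψ (barOf G A B φ k 0 g) = γ g := by
    intro g
    simpa using hψ' 0 g
  -- the range is normal
  have conj_mem : ∀ (m : ℤ) y, t ^ m * ψ y * (t ^ m)⁻¹ ∈ ψ.range := by
    intro m
    suffices h : ∀ y, y ∈ (ψ.range.comap (MulAut.conj (t ^ m)).toMonoidHom).comap ψ from
      fun y => h y
    refine bar_gen G A B φ k _ ?_
    intro i g
    refine ⟨barOf G A B φ k (((m + (i.val : ℤ)) : ℤ) : ZMod k) g, ?_⟩
    rw [hψ']
    have h1 := hψ' (i.val : ℤ) g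
    have h2 : (((i.val : ℕ) : ℤ) : ZMod k) = i := by simp
    rw [h2] at h1
    rw [MulEquiv.coe_toMonoidHom, MulAut.conj_apply, h1, zpow_add]
    group
  have hnorm : ψ.range.Normal := by
    rw [← Subgroup.normalizer_eq_top_iff, eq_top_iff]
    intro x _
    refine gen _ ?_ ?_ x
    · intro g
      exact Subgroup.le_normalizer ⟨_, hψ0 g⟩
    · rw [Subgroup.mem_normalizer_iff]
      intro y
      constructor
      · rintro ⟨z, rfl⟩
        simpa using conj_mem 1 z
      · rintro ⟨z, hz⟩
        have := conj_mem (-1) z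
        rw [hz] at this
        simpa [mul_assoc] using this
  have hdecomp : ∀ x, ∃ y, ∃ m : ℤ, x = ψ y * t ^ m := by
    intro x
    have hx : x ∈ ψ.range ⊔ Subgroup.zpowers t := gen (ψ.range ⊔ Subgroup.zpowers t)
      (fun g => Subgroup.mem_sup_left (show γ g ∈ ψ.range from ⟨_, hψ0 g⟩))
      (Subgroup.mem_sup_right (Subgroup.mem_zpowers t)) x
    obtain ⟨_, ⟨y, rfl⟩, _, ⟨m, rfl⟩, h⟩ := Subgroup.mem_sup_of_normal_left.1 hx
    exact ⟨y, m, h.symm⟩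
  -- the map to the wreath product
  let o := barOf G A B φ k
  have ho : ∀ i (b : B), o i b = o (i + 1) (φ b) := barOf_rel G A B φ k
  let tW : (BarHig G A B φ k ≀ᵣ Multiplicative (ZMod k)) := ⟨1, Multiplicative.ofAdd 1⟩
  let gW : G →* (BarHig G A B φ k ≀ᵣ Multiplicative (ZMod k)) := MonoidHom.mk' (fun g => ⟨fun x => o (-(x.toAdd)) g, 1⟩)
    (by intro a b; ext <;> simp)
  have htWpow : ∀ m : ℤ, tW ^ m = ⟨1, Multiplicative.ofAdd (m : ZMod k)⟩ := by
    intro m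
    have h1 : tW = RegularWreathProduct.inl (Multiplicative.ofAdd (1 : ZMod k)) := rfl
    rw [h1, ← map_zpow, ← ofAdd_zsmul]
    simp [RegularWreathProduct.inl]
  let Θ0 : Monoid.Coprod G (FreeGroup Unit) →* (BarHig G A B φ k ≀ᵣ Multiplicative (ZMod k)) :=
    Monoid.Coprod.lift gW (FreeGroup.lift fun _ => tW)
  have hΘt : Θ0 (higT G) = tW := by simp [Θ0, higT]
  have hΘg : ∀ g, Θ0 (Monoid.Coprod.inl g) = gW g := fun g => by simp [Θ0]
  have hΘ0 : N0 ≤ Θ0.ker := by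
    refine Subgroup.normalClosure_le_normal ?_
    rintro x (hx | hx)
    · rw [Set.mem_singleton_iff.1 hx]
      change Θ0 (higT G ^ k) = 1
      rw [map_pow, hΘt, ← zpow_natCast, htWpow]
      ext <;> simp
    · obtain ⟨b, rfl⟩ := Set.mem_iUnion.1 hx
      change Θ0 _ = 1
      simp only [map_mul, map_inv, hΘt, hΘg]
      rw [mul_inv_eq_one]
      ext x
      · simp only [RegularWreathProduct.mul_left, RegularWreathProduct.inv_left,
          RegularWreathProduct.inv_right, RegularWreathProduct.mul_right, Pi.mul_apply, tW, gW,
          MonoidHom.mk'_apply]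
        have h1 := ho (-(1 + x.toAdd)) b
        have h2 : -(1 + x.toAdd) + 1 = - x.toAdd := by ring
        rw [h2] at h1
        simpa using h1
      · simp [tW, gW]
  let Θ : Hig G A B φ k →* (BarHig G A B φ k ≀ᵣ Multiplicative (ZMod k)) := QuotientGroup.lift N0 Θ0 hΘ0
  have hΘt' : Θ t = tW := hΘt
  have hΘg' : ∀ g, Θ (γ g) = gW g := hΘg
  have hΘψr : ∀ y, (Θ (ψ y)).right = 1 := by
    suffices h : ∀ y, y ∈ ((RegularWreathProduct.rightHom.comp Θ).comp ψ).ker from h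
    refine bar_gen G A B φ k _ ?_
    intro i g
    change (RegularWreathProduct.rightHom (Θ (ψ _))) = 1
    rw [hψ'']
    simp only [map_mul, map_inv, map_zpow, hΘt', hΘg', htWpow]
    simp [gW]
  let δ : BarHig G A B φ k →* BarHig G A B φ k := MonoidHom.mk' (fun y => (Θ (ψ y)).left 1) (by
    intro a b
    simp [hΘψr])
  have hδ : ∀ y, δ y = y := by
    suffices h : ∀ y, y ∈ δ.eqLocus (MonoidHom.id _) from h
    refine bar_gen G A B φ k _ ?_
    intro i g
    change (Θ (ψ _)).left 1 = _
    rw [hψ'']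
    simp only [map_mul, map_inv, map_zpow, hΘt', hΘg', htWpow]
    simp [gW, o]
  refine rs_of_injective Θ ?_ (wr_rs hbar inferInstance)
  rw [injective_iff_map_eq_one]
  intro x hx
  obtain ⟨y, m, rfl⟩ := hdecomp x
  rw [map_mul, map_zpow, hΘt', htWpow] at hx
  have hr := congrArg RegularWreathProduct.right hx
  rw [RegularWreathProduct.mul_right, hΘψr, one_mul] at hr
  have hm : (m : ZMod k) = ((0 : ℤ) : ZMod k) := by
    rw [Int.cast_zero]; exact hr
  have hl := congrFun (congrArg RegularWreathProduct.left hx) 1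
  have hy : y = 1 := by
    rw [← hδ y]
    change (Θ (ψ y)).left 1 = 1
    simpa using hl
  rw [hy, htz m 0 hm]
  simp

end higPart

/-- **Theorem (residual solvability of the Higman variations).**
If `G` is residually solvable, `φ : B → A` is an isomorphism between subgroups of `G`, and
there is a homomorphism `π : G → A × B` with `π(a) = (a,1)` for `a ∈ A` and `π(b) = (1,b)`
for `b ∈ B`, then `Hig_k(G,φ)` and `bar-Hig_k(G,φ)` are residually solvable for all `k ≥ 4`. -/
theorem residuallySolvable_hig_of_residuallySolvable
    (hG : ResiduallySolvable G) (π : G →* A × B)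
    (hπA : ∀ a : A, π (a : G) = (a, 1)) (hπB : ∀ b : B, π (b : G) = (1, b))
    (hk : 4 ≤ k) :
    ResiduallySolvable (Hig G A B φ k) ∧ ResiduallySolvable (BarHig G A B φ k) := by
  have hbar := bar_rs G A B φ k hG π hπA hπB hk
  exact ⟨hig_rs G A B φ k (by omega) hbar, hbar⟩
end

section
/- If Higman's group H4 is sofic, then for every ε > 0 there exists N ∈ ℕ such that for every odd n > N there exists a permutation f of ℤ/nℤ with f⁴ = id and f(x+1) = 2·f(x) for at least (1−ε)n elements x ∈ ℤ/nℤ. -/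
/-- The normalized Hamming distance on the symmetric group `Sym(n)`. -/
noncomputable def permDist {n : ℕ} (ρ σ : Equiv.Perm (Fin n)) : ℝ :=
  ((Finset.univ.filter fun i => ρ i ≠ σ i).card : ℝ) / n

/-- `ψ : G → Sym(n)` is an `(S, δ, n)`-approximation of `G`. -/
def IsApprox {G : Type*} [Group G] (S : Set G) (δ : ℝ) {n : ℕ}
    (ψ : G → Equiv.Perm (Fin n)) : Prop :=
  (∀ g ∈ S, ∀ h ∈ S, g * h ∈ S → permDist (ψ g * ψ h) (ψ (g * h)) < δ) ∧
  (∀ g ∈ S, g ≠ 1 → 1 - δ < permDist (ψ g) 1)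

/-- A group is sofic when for every finite subset `S` and every `δ > 0` there is an
`(S,δ,n)`-approximation for some `n`. -/
def IsSofic (G : Type*) [Group G] : Prop :=
  ∀ S : Set G, S.Finite → ∀ δ : ℝ, 0 < δ →
    ∃ (n : ℕ) (ψ : G → Equiv.Perm (Fin n)), IsApprox S δ ψ

/-- The relators of Higman's group: with generators `a = 0, b = 1, c = 2, d = 3`, the
relators are `x_i⁻¹ x_{i+1} x_i (x_{i+1}²)⁻¹` for `i ∈ ℤ/4ℤ`, i.e.
`b^a = b², c^b = c², d^c = d², a^d = a²`. -/
def higmanRels : Set (FreeGroup (Fin 4)) :=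
  {r | ∃ i : Fin 4, r = (FreeGroup.of i)⁻¹ * FreeGroup.of (i + 1) * FreeGroup.of i *
    ((FreeGroup.of (i + 1)) ^ 2)⁻¹}

/-- Higman's group `H₄ = ⟨a,b,c,d ∣ b^a = b², c^b = c², d^c = d², a^d = a²⟩`. -/
abbrev HigmanGroup : Type := PresentedGroup higmanRels


namespace HJ
open Monoid

/-- relators of BS(1,2) -/
def bsRels : Set (FreeGroup Bool) :=
  {FreeGroup.of false * FreeGroup.of true * (FreeGroup.of false)⁻¹ * (FreeGroup.of true ^ 2)⁻¹}

abbrev BSG : Type := PresentedGroup bsRels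

def gA : BSG := PresentedGroup.of false
def gB : BSG := PresentedGroup.of true

lemma bs_rel : gA * gB * gA⁻¹ = gB ^ 2 := by
  have := PresentedGroup.one_of_mem (rels := bsRels) (x := FreeGroup.of false * FreeGroup.of true * (FreeGroup.of false)⁻¹ * (FreeGroup.of true ^ 2)⁻¹) rfl
  rw [map_mul, map_inv, mul_inv_eq_one] at this
  simpa using! this

def bsLift {G : Type*} [Group G] (x y : G) (h : x * y * x⁻¹ = y ^ 2) : BSG →* G :=
  PresentedGroup.toGroup (f := fun i => cond i y x) (by
    intro r hr
    rw [bsRels, Set.mem_singleton_iff] at hr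
    subst hr
    simp [h])

lemma bsLift_A {G : Type*} [Group G] (x y : G) (h : x * y * x⁻¹ = y ^ 2) : bsLift x y h gA = x := by
  simp [bsLift, gA]

lemma bsLift_B {G : Type*} [Group G] (x y : G) (h : x * y * x⁻¹ = y ^ 2) : bsLift x y h gB = y := by
  simp [bsLift, gB]

lemma bs_conj_pow {G : Type*} [Group G] {x y : G} (h : x * y * x⁻¹ = y ^ 2) (m : ℕ) :
    x ^ m * y * (x ^ m)⁻¹ = y ^ (2 ^ m) := by
  induction m with
  | zero => simp
  | succ m ih =>
    have : x ^ (m+1) * y * (x ^ (m+1))⁻¹ = x * (x ^ m * y * (x ^ m)⁻¹) * x⁻¹ := by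
      rw [pow_succ']; group
    rw [this, ih, ← conj_pow, h, ← pow_mul, pow_succ' 2 m]

lemma bs_key_nat {G : Type*} [Group G] {x y : G} (h : x * y * x⁻¹ = y ^ 2)
    (hy : ∀ q : ℤ, y ^ q = 1 → q = 0) (m : ℕ) (q : ℤ) (e : x ^ m = y ^ q) : m = 0 := by
  have h1 := bs_conj_pow h m
  rw [e] at h1
  have h2 : y ^ q * y * (y ^ q)⁻¹ = y := by group
  rw [h2] at h1
  have h3 : y ^ ((2:ℤ) ^ m - 1) = 1 := by
    rw [zpow_sub, zpow_one]
    have : y ^ ((2:ℤ)^m) = y ^ (2 ^ m) := by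
      rw [← zpow_natCast]; congr 1
    rw [this, ← h1]; simp
  have h4 := hy _ h3
  by_contra hm
  have : (2:ℤ)^1 ≤ 2 ^ m := pow_le_pow_right₀ (by norm_num) (by omega)
  omega

lemma bs_key {G : Type*} [Group G] {x y : G} (h : x * y * x⁻¹ = y ^ 2)
    (hy : ∀ q : ℤ, y ^ q = 1 → q = 0) (s q : ℤ) (e : x ^ s = y ^ q) : s = 0 ∧ q = 0 := by
  have hs : s = 0 := by
    obtain ⟨m, rfl | rfl⟩ := s.eq_nat_or_neg
    · have := bs_key_nat h hy m q (by simpa using e)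
      simp [this]
    · have := bs_key_nat h hy m (-q) (by
        rw [zpow_neg, ← e]; simp)
      simp [this]
  subst hs
  exact ⟨rfl, hy _ (by simpa using e.symm)⟩

lemma gB_inf (q : ℤ) (h : gB ^ q = 1) : q = 0 := by
  let X : Equiv.Perm ℚ := Equiv.mulLeft₀ (2:ℚ) (by norm_num)
  let Y : Equiv.Perm ℚ := Equiv.addRight (1:ℚ)
  have hr : X * Y * X⁻¹ = Y ^ 2 := by
    rw [mul_inv_eq_iff_eq_mul]
    ext x
    simp [X, Y, pow_two]
    ring
  have h2 := congrArg (bsLift X Y hr) h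
  rw [map_zpow, bsLift_B, map_one] at h2
  have h3 := congrArg (fun e : Equiv.Perm ℚ => e 0) h2
  simp [Y] at h3
  exact_mod_cast h3

lemma gAB_key (s q : ℤ) (e : gA ^ s = gB ^ q) : s = 0 ∧ q = 0 := bs_key bs_rel gB_inf s q e

lemma gA_inf (s : ℤ) (h : gA ^ s = 1) : s = 0 := (gAB_key s 0 (by simpa using h)).1

/-- elements have the form a^{-p} b^q a^r -/
lemma bs_form (g : BSG) : ∃ (p r : ℕ) (q : ℤ), g = (gA ^ p)⁻¹ * gB ^ q * gA ^ r := by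
  have hBA : ∀ p : ℕ, ∀ k : ℤ, gB ^ k * (gA ^ p)⁻¹ = (gA ^ p)⁻¹ * gB ^ (2 ^ p * k) := by
    intro p k
    have h := bs_conj_pow bs_rel p
    have h2 : gA ^ p * gB ^ k * (gA ^ p)⁻¹ = gB ^ (2 ^ p * k) := by
      rw [← conj_zpow, h, zpow_mul]
      congr 1
    rw [← h2]; group
  have hmem : g ∈ Subgroup.closure (Set.range (PresentedGroup.of (rels := bsRels))) := by
    rw [PresentedGroup.closure_range_of]; trivial
  induction hmem using Subgroup.closure_induction_left with
  | one => exact ⟨0, 0, 0, by simp⟩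
  | mul_left x hx y hy ih =>
    obtain ⟨p, r, q, rfl⟩ := ih
    obtain ⟨i, rfl⟩ := hx
    cases i
    · change ∃ (p' r' : ℕ) (q' : ℤ), gA * _ = _
      cases p with
      | zero =>
        refine ⟨0, r + 1, 2 * q, ?_⟩
        have h2 : gA * gB ^ q * gA⁻¹ = gB ^ (2 * q) := by
          rw [← conj_zpow, bs_rel, zpow_mul]; rfl
        rw [← h2, pow_succ']
        simp [mul_assoc]
      | succ p =>
        refine ⟨p, r, q, ?_⟩
        rw [pow_succ]
        simp [mul_assoc]
    · change ∃ (p' r' : ℕ) (q' : ℤ), gB * _ = _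
      refine ⟨p, r, 2 ^ p * 1 + q, ?_⟩
      have := hBA p 1
      rw [zpow_one] at this
      rw [← mul_assoc, ← mul_assoc, this, zpow_add]
      simp only [mul_assoc]
  | inv_mul_cancel x hx y hy ih =>
    obtain ⟨p, r, q, rfl⟩ := ih
    obtain ⟨i, rfl⟩ := hx
    cases i
    · change ∃ (p' r' : ℕ) (q' : ℤ), gA⁻¹ * _ = _
      refine ⟨p + 1, r, q, ?_⟩
      rw [pow_succ]
      simp [mul_assoc]
    · change ∃ (p' r' : ℕ) (q' : ℤ), gB⁻¹ * _ = _
      refine ⟨p, r, 2 ^ p * (-1) + q, ?_⟩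
      have := hBA p (-1)
      rw [zpow_neg_one] at this
      rw [← mul_assoc, ← mul_assoc, this, zpow_add]
      simp only [mul_assoc]

/-- base maps of the first amalgam -/
def phi1 (i : Bool) : Multiplicative ℤ →* BSG := zpowersHom _ (cond i gA gB)

def fr1 (i : Bool) : Multiplicative ℤ →* BSG := zpowersHom _ (cond i gB gA)

lemma phi1_inj (i : Bool) : Function.Injective (phi1 i) := by
  rw [injective_iff_map_eq_one]
  intro m hm
  cases i <;> simp [phi1] at hm
  · exact gB_inf _ hm
  · exact gA_inf _ hm

lemma fr1_mem (i : Bool) (m : Multiplicative ℤ) (h : fr1 i m ∈ (phi1 i).range) : m = 1 := by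
  obtain ⟨k, hk⟩ := h
  cases i <;> simp [phi1, fr1] at hk
  · exact (gAB_key _ _ hk.symm).1
  · exact (gAB_key _ _ hk).2

abbrev K1 : Type := PushoutI phi1

abbrev FF : Type := CoprodI (fun _ : Bool => Multiplicative ℤ)

def jj : FF →* K1 := CoprodI.lift (fun i => (PushoutI.of (φ := phi1) i).comp (fr1 i))

def mapWord (w : CoprodI.Word (fun _ : Bool => Multiplicative ℤ)) :
    CoprodI.Word (fun _ : Bool => BSG) where
  toList := w.toList.map (fun l => ⟨l.1, fr1 l.1 l.2⟩)
  ne_one := by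
    intro l hl
    rw [List.mem_map] at hl
    obtain ⟨l', hl', rfl⟩ := hl
    intro h
    have h2 := fr1_mem l'.1 l'.2 (by
      change fr1 l'.1 l'.2 = 1 at h
      rw [h]; exact one_mem _)
    exact w.ne_one l' hl' h2
  chain_ne := by
    have := w.chain_ne
    rw [List.isChain_map]
    exact this

lemma mapWord_prod (w) : PushoutI.ofCoprodI (φ := phi1) (mapWord w).prod = jj w.prod := by
  simp [CoprodI.Word.prod, mapWord, jj, map_list_prod, Function.comp_def]

lemma mapWord_red (w) : PushoutI.Reduced phi1 (mapWord w) := by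
  intro l hl
  simp only [mapWord, List.mem_map] at hl
  obtain ⟨l', hl', rfl⟩ := hl
  intro h
  exact w.ne_one l' hl' (fr1_mem _ _ h)

lemma jj_inj : Function.Injective jj := by
  classical
  rw [injective_iff_map_eq_one]
  intro x hx
  obtain ⟨w, rfl⟩ := CoprodI.Word.equiv.symm.surjective x
  change jj w.prod = 1 at hx
  change w.prod = 1
  rw [← mapWord_prod] at hx
  have h := (mapWord_red w).eq_empty_of_mem_range phi1_inj (by rw [hx]; exact one_mem _)
  have h2 : (mapWord w).toList = [] := by rw [h]; rfl
  simp [mapWord] at h2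
  simp [CoprodI.Word.prod, h2]

def swapF : FF →* FF := CoprodI.lift (fun i => CoprodI.of (M := fun _ : Bool => Multiplicative ℤ) (i := !i))

lemma swapF_inj : Function.Injective swapF := by
  have : swapF.comp swapF = MonoidHom.id _ := by
    apply CoprodI.ext_hom
    intro i
    ext
    cases i <;> simp [swapF]
  intro x y h
  have h2 := congrArg swapF h
  have h3 := fun z => DFunLike.congr_fun this z
  simp only [MonoidHom.comp_apply, MonoidHom.id_apply] at h3
  rwa [h3, h3] at h2

def phi2 (i : Bool) : FF →* K1 := cond i (jj.comp swapF) jj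

lemma phi2_inj (i : Bool) : Function.Injective (phi2 i) := by
  cases i
  · exact jj_inj
  · exact jj_inj.comp swapF_inj

abbrev K2 : Type := PushoutI phi2

def kk (i j : Bool) : BSG →* K2 := (PushoutI.of (φ := phi2) i).comp (PushoutI.of (φ := phi1) j)

lemma kk_inj (i j : Bool) : Function.Injective (kk i j) :=
  (PushoutI.of_injective phi2_inj i).comp (PushoutI.of_injective phi1_inj j)

lemma kk_mid (i : Bool) : kk i true gA = kk i false gB := by
  have h1 := PushoutI.of_apply_eq_base phi1 true (Multiplicative.ofAdd 1)
  have h2 := PushoutI.of_apply_eq_base phi1 false (Multiplicative.ofAdd 1)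
  rw [← h2] at h1
  simp [phi1] at h1
  simp [kk, h1]

lemma kk_out (i : Bool) : kk (!i) true gB = kk i false gA := by
  have key : ∀ b : Bool, PushoutI.of (φ := phi2) true (phi2 true (CoprodI.of (i := b) (Multiplicative.ofAdd 1)))
     = PushoutI.of (φ := phi2) false (phi2 false (CoprodI.of (i := b) (Multiplicative.ofAdd 1))) := by
    intro b
    rw [PushoutI.of_apply_eq_base, PushoutI.of_apply_eq_base]
  have h1 := key true
  have h2 := key false
  simp [phi2, swapF, jj, fr1] at h1 h2
  cases i
  · simpa [kk] using h2
  · simpa [kk] using h1.symm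

def hgen (i : Fin 4) : HigmanGroup := PresentedGroup.of i

lemma higman_rel (i : Fin 4) : (hgen i)⁻¹ * hgen (i+1) * hgen i = hgen (i+1) ^ 2 := by
  have := PresentedGroup.one_of_mem (rels := higmanRels) (x := (FreeGroup.of i)⁻¹ * FreeGroup.of (i + 1) * FreeGroup.of i *
    ((FreeGroup.of (i + 1)) ^ 2)⁻¹) ⟨i, rfl⟩
  rw [map_mul, map_inv, mul_inv_eq_one] at this
  simpa using! this

lemma inv_form' {G : Type*} [Group G] {x y : G} (h : x * y * x⁻¹ = y ^ 2) :
    (x⁻¹)⁻¹ * y⁻¹ * x⁻¹ = (y⁻¹) ^ 2 := by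
  rw [← inv_inj, inv_pow]
  simpa [mul_assoc] using h

lemma inv_form {G : Type*} [Group G] {x y : G} : x⁻¹ * y * x = y ^ 2 ↔ x⁻¹ * y⁻¹ * (x⁻¹)⁻¹ = (y⁻¹) ^ 2 := by
  rw [← inv_inj, inv_pow]
  simp [mul_assoc]

lemma theta_rel (i : Fin 4) : (hgen i)⁻¹ * (hgen (i+1))⁻¹ * ((hgen i)⁻¹)⁻¹ = ((hgen (i+1))⁻¹) ^ 2 :=
  inv_form.1 (higman_rel i)

def theta (i : Fin 4) : BSG →* HigmanGroup := bsLift _ _ (theta_rel i)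

def kgen : Fin 4 → K2 := ![kk false false gA, kk false false gB, kk false true gB, kk true false gB]

lemma kgen_inf (i : Fin 4) (q : ℤ) (h : kgen i ^ q = 1) : q = 0 := by
  fin_cases i <;> simp only [kgen] at h
  · exact gA_inf q (kk_inj false false (by simpa using h))
  · exact gB_inf q (kk_inj false false (by simpa using h))
  · exact gB_inf q (kk_inj false true (by simpa using h))
  · exact gB_inf q (kk_inj true false (by simpa using h))

lemma kgen_rel (i : Fin 4) : kgen i * kgen (i+1) * (kgen i)⁻¹ = kgen (i+1) ^ 2 := by
  have hk : ∀ i j, kk i j gA * kk i j gB * (kk i j gA)⁻¹ = kk i j gB ^ 2 := by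
    intro i j
    have := congrArg (kk i j) bs_rel
    simpa using this
  fin_cases i
  · exact hk false false
  · have := hk false true
    rw [kk_mid] at this
    exact this
  · have := hk true false
    have e := kk_out true
    rw [← e] at this
    exact this
  · have := hk true true
    have e := kk_out false
    rw [kk_mid] at this
    rw [show (!false) = true from rfl] at e
    rw [e] at this
    exact this

def toK2 : HigmanGroup →* K2 := PresentedGroup.toGroup (f := fun i => (kgen i)⁻¹) (by
  rintro r ⟨i, rfl⟩
  rw [map_mul, map_inv, mul_inv_eq_one]
  have := kgen_rel i
  simp only [map_mul, map_inv, FreeGroup.lift_apply_of, map_pow]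
  exact inv_form' this)

lemma hgen_inf (i : Fin 4) (q : ℤ) (h : (hgen i)⁻¹ ^ q = 1) : q = 0 := by
  have := congrArg toK2 h
  simp [toK2, hgen] at this
  exact kgen_inf i q (by simpa using this)

lemma theta_inj (i : Fin 4) : Function.Injective (theta i) := by
  rw [injective_iff_map_eq_one]
  intro g hg
  obtain ⟨p, r, q, rfl⟩ := bs_form g
  simp only [map_mul, map_inv, map_pow, map_zpow, theta, bsLift_A, bsLift_B] at hg
  have e : (hgen i)⁻¹ ^ ((p:ℤ) - r) = (hgen (i+1))⁻¹ ^ q := by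
    rw [mul_assoc, inv_mul_eq_one] at hg
    rw [zpow_sub, zpow_natCast, zpow_natCast, hg]; group
  obtain ⟨h1, h2⟩ := bs_key (theta_rel i) (hgen_inf (i+1)) _ _ e
  have : p = r := by omega
  subst this h2
  simp

end HJ


namespace HJ
open scoped Classical

/-- size of the boundary of `F` in the direction `g` -/
noncomputable def bd {G : Type*} [Group G] (g : G) (F : Finset G) : ℕ :=
  (F.filter (fun f => g * f ∉ F)).card

def Folner (G : Type*) [Group G] : Prop :=
  ∀ (K : Finset G) (δ : ℝ), 0 < δ → ∃ F : Finset G, F.Nonempty ∧ ∀ g ∈ K, (bd g F : ℝ) ≤ δ * F.card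

section
variable {G : Type*} [Group G]

lemma bd_one (F : Finset G) : bd 1 F = 0 := by
  simp [bd]

lemma bd_mul (g h : G) (F : Finset G) : bd (g * h) F ≤ bd g F + bd h F := by
  unfold bd
  have hsub : F.filter (fun f => g * h * f ∉ F) ⊆
      ((F.filter (fun f => g * f ∉ F)).image (fun f => h⁻¹ * f)) ∪ F.filter (fun f => h * f ∉ F) := by
    intro f hf
    simp only [Finset.mem_filter, Finset.mem_union, Finset.mem_image] at hf ⊢
    by_cases hh : h * f ∈ F
    · left
      exact ⟨h * f, ⟨hh, by rw [← mul_assoc]; exact hf.2⟩, by simp⟩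
    · right; exact ⟨hf.1, hh⟩
  calc _ ≤ _ := Finset.card_le_card hsub
    _ ≤ _ := Finset.card_union_le _ _
    _ ≤ _ := Nat.add_le_add_right Finset.card_image_le _

lemma bd_inv_le (g : G) (F : Finset G) : bd g⁻¹ F ≤ bd g F := by
  unfold bd
  have h1 := Finset.card_filter_add_card_filter_not (s := F) (fun f => g⁻¹ * f ∈ F)
  have h2 := Finset.card_filter_add_card_filter_not (s := F) (fun f => g * f ∈ F)
  have h3 : (F.filter (fun f => g * f ∈ F)).card ≤ (F.filter (fun f => g⁻¹ * f ∈ F)).card := by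
    apply Finset.card_le_card_of_injOn (fun f => g * f)
    · intro f hf
      simp only [Finset.coe_filter, Set.mem_ofPred_eq] at hf ⊢
      exact ⟨hf.2, by simpa using hf.1⟩
    · intro x _ y _ hxy
      simpa using hxy
  omega

lemma bd_closure (s : Set G) (g : G) (hg : g ∈ Subgroup.closure s) :
    ∃ C : ℕ, ∀ (F : Finset G) (η : ℝ), 0 ≤ η → (∀ x ∈ s, (bd x F : ℝ) ≤ η) → (bd g F : ℝ) ≤ C * η := by
  induction hg using Subgroup.closure_induction with
  | mem x hx => exact ⟨1, fun F η _ h => by simpa using h x hx⟩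
  | one => exact ⟨0, fun F η _ h => by simp [bd_one]⟩
  | mul x y _ _ hx hy =>
    obtain ⟨C, hC⟩ := hx
    obtain ⟨D, hD⟩ := hy
    refine ⟨C + D, fun F η h0 h => ?_⟩
    have h1 := hC F η h0 h
    have h2 := hD F η h0 h
    have h3 : (bd (x * y) F : ℝ) ≤ bd x F + bd y F := by exact_mod_cast bd_mul x y F
    push_cast
    linarith
  | inv x _ hx =>
    obtain ⟨C, hC⟩ := hx
    refine ⟨C, fun F η h0 h => ?_⟩
    have h3 : (bd x⁻¹ F : ℝ) ≤ bd x F := by exact_mod_cast bd_inv_le x F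
    exact h3.trans (hC F η h0 h)

lemma folner_of_gens (s : Set G) (hs : Subgroup.closure s = ⊤)
    (h : ∀ δ : ℝ, 0 < δ → ∃ F : Finset G, F.Nonempty ∧ ∀ g ∈ s, (bd g F : ℝ) ≤ δ * F.card) :
    Folner G := by
  intro K δ hδ
  have hC : ∀ g : G, ∃ C : ℕ, ∀ (F : Finset G) (η : ℝ), 0 ≤ η → (∀ x ∈ s, (bd x F : ℝ) ≤ η) →
      (bd g F : ℝ) ≤ C * η := fun g => bd_closure s g (by rw [hs]; trivial)
  choose C hC using hC
  set B : ℕ := ∑ g ∈ K, C g with hB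
  obtain ⟨F, hF, hF2⟩ := h (δ / (B + 1)) (by positivity)
  refine ⟨F, hF, fun g hg => ?_⟩
  refine (hC g F _ (by positivity) hF2).trans ?_
  have h1 : C g ≤ B := Finset.single_le_sum (f := C) (fun _ _ => Nat.zero_le _) hg
  have h2 : (C g : ℝ) ≤ B + 1 := by
    have : (C g : ℝ) ≤ B := by exact_mod_cast h1
    linarith
  have h3 : (C g : ℝ) * (δ / (B + 1)) ≤ δ := by
    rw [mul_div_assoc', div_le_iff₀ (by positivity)]
    nlinarith
  calc (C g : ℝ) * (δ / (B + 1) * F.card) = ((C g : ℝ) * (δ / (B + 1))) * F.card := by ring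
    _ ≤ _ := by gcongr
end

noncomputable def tl (i j : ℕ) : BSG := (gA ^ i)⁻¹ * gB ^ j

lemma tl_inj {i j i' j' : ℕ} (h : tl i j = tl i' j') : i = i' ∧ j = j' := by
  unfold tl at h
  have e : gA ^ ((i':ℤ) - i) = gB ^ ((j':ℤ) - j) := by
    have h' : gA ^ i' * (gA ^ i)⁻¹ = gB ^ j' * (gB ^ j)⁻¹ := by
      rw [eq_mul_inv_iff_mul_eq, mul_assoc, h]; group
    rw [zpow_sub, zpow_sub]
    simpa using h'
  have := gAB_key _ _ e
  omega

noncomputable def tile (k : ℕ) : Finset BSG :=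
  (Finset.range k ×ˢ Finset.range (2 ^ k)).image (fun p => tl p.1 p.2)

lemma tile_card (k : ℕ) : (tile k).card = k * 2 ^ k := by
  unfold tile
  rw [Finset.card_image_of_injective]
  · simp
  · rintro ⟨i, j⟩ ⟨i', j'⟩ h
    have := tl_inj h
    exact Prod.ext this.1 this.2

lemma mem_tile {k i j : ℕ} (hi : i < k) (hj : j < 2 ^ k) : tl i j ∈ tile k :=
  Finset.mem_image.2 ⟨(i, j), by simp [hi, hj], rfl⟩

lemma bd_tile_A (k : ℕ) : bd gA⁻¹ (tile k) ≤ 2 ^ k := by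
  unfold bd
  have hsub : (tile k).filter (fun f => gA⁻¹ * f ∉ tile k) ⊆
      (Finset.range (2 ^ k)).image (fun j => tl (k - 1) j) := by
    intro f hf
    rw [Finset.mem_filter] at hf
    obtain ⟨hf1, hf2⟩ := hf
    obtain ⟨⟨i, j⟩, hij, rfl⟩ := Finset.mem_image.1 hf1
    simp at hij
    have e : gA⁻¹ * tl i j = tl (i + 1) j := by
      simp [tl, pow_succ, mul_assoc]
    by_cases h : i + 1 < k
    · exact absurd (e ▸ mem_tile h hij.2) hf2
    · have : i = k - 1 := by omega
      subst this
      exact Finset.mem_image.2 ⟨j, by simpa using hij.2, rfl⟩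
  calc _ ≤ _ := Finset.card_le_card hsub
    _ ≤ _ := Finset.card_image_le
    _ = _ := by simp

lemma bd_tile_B (k : ℕ) : bd gB (tile k) ≤ 2 ^ k := by
  unfold bd
  have hsub : (tile k).filter (fun f => gB * f ∉ tile k) ⊆
      (Finset.range k).biUnion (fun i => (Finset.Ico (2 ^ k - 2 ^ i) (2 ^ k)).image (fun j => tl i j)) := by
    intro f hf
    rw [Finset.mem_filter] at hf
    obtain ⟨hf1, hf2⟩ := hf
    obtain ⟨⟨i, j⟩, hij, rfl⟩ := Finset.mem_image.1 hf1
    simp at hij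
    have e : gB * tl i j = tl i (2 ^ i + j) := by
      have := bs_conj_pow bs_rel i
      rw [tl, tl, pow_add, ← this]
      group
    simp only [Finset.mem_biUnion, Finset.mem_image, Finset.mem_range, Finset.mem_Ico]
    refine ⟨i, hij.1, j, ⟨?_, hij.2⟩, rfl⟩
    by_contra h
    exact hf2 (e ▸ mem_tile hij.1 (by omega))
  calc _ ≤ _ := Finset.card_le_card hsub
    _ ≤ ∑ i ∈ Finset.range k, ((Finset.Ico (2 ^ k - 2 ^ i) (2 ^ k)).image (fun j => tl i j)).card :=
      Finset.card_biUnion_le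
    _ ≤ ∑ i ∈ Finset.range k, 2 ^ i := by
      apply Finset.sum_le_sum
      intro i hi
      refine Finset.card_image_le.trans ?_
      rw [Nat.card_Ico]
      have key : ∀ a b : ℕ, a - (a - b) ≤ b := by omega
      exact key _ _
    _ ≤ 2 ^ k := by
      have := Nat.geomSum_eq (le_refl 2) k
      rw [this]; simp

lemma bs_folner : Folner BSG := by
  apply folner_of_gens {gA⁻¹, gB}
  · rw [eq_top_iff, ← PresentedGroup.closure_range_of, Subgroup.closure_le]
    rintro _ ⟨i, rfl⟩
    cases i
    · have : gA⁻¹ ∈ Subgroup.closure ({gA⁻¹, gB} : Set BSG) := Subgroup.subset_closure (by simp)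
      have := inv_mem this
      rw [inv_inv] at this
      exact this
    · exact Subgroup.subset_closure (Set.mem_insert_of_mem _ rfl)
  · intro δ hδ
    obtain ⟨k, hk⟩ := exists_nat_gt (1 / δ)
    have hk0 : (0:ℝ) < k := lt_trans (by positivity) hk
    have hk1 : 0 < k := by exact_mod_cast hk0
    have h1 : (1:ℝ) ≤ δ * k := by
      rw [div_lt_iff₀ hδ] at hk; nlinarith
    have h2 : (2:ℝ) ^ k ≤ δ * (tile k).card := by
      rw [tile_card]; push_cast
      have : (0:ℝ) < 2 ^ k := by positivity
      nlinarith
    refine ⟨tile k, ⟨_, mem_tile hk1 (j := 0) (by positivity)⟩, ?_⟩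
    rintro g (rfl | rfl)
    · refine le_trans ?_ h2
      exact_mod_cast bd_tile_A k
    · refine le_trans ?_ h2
      exact_mod_cast bd_tile_B k

end HJ


namespace HJ
open scoped Classical
set_option linter.unusedSectionVars false

section
variable {G : Type*} [Group G] {X X' : Type} [Fintype X] [Fintype X']

/-- `x` is a point where `ψ` looks like a free action, as far as `T` can see. -/
def Good (T : Finset G) (ψ : G → Equiv.Perm X) (x : X) : Prop :=
  (∀ g ∈ T, ∀ h ∈ T, ψ g (ψ h x) = ψ (g * h) x) ∧ (∀ g ∈ T, ∀ h ∈ T, ψ g x = ψ h x → g = h)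

lemma Good.mono {T T' : Finset G} (h : T ⊆ T') {ψ : G → Equiv.Perm X} {x : X} (hx : Good T' ψ x) :
    Good T ψ x :=
  ⟨fun g hg k hk => hx.1 g (h hg) k (h hk), fun g hg k hk => hx.2 g (h hg) k (h hk)⟩

def Appr (T : Finset G) (δ : ℝ) (ψ : G → Equiv.Perm X) : Prop :=
  ((Finset.univ.filter (fun x => ¬ Good T ψ x)).card : ℝ) ≤ δ * Fintype.card X

lemma Appr.mono {T T' : Finset G} (h : T ⊆ T') {δ δ' : ℝ} (hδ : δ' ≤ δ) {ψ : G → Equiv.Perm X}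
    (hx : Appr T' δ' ψ) : Appr T δ ψ := by
  unfold Appr at *
  calc _ ≤ ((Finset.univ.filter (fun x => ¬ Good T' ψ x)).card : ℝ) := by
        exact_mod_cast Finset.card_le_card (fun x hx => by
          simp only [Finset.mem_filter, Finset.mem_univ, true_and] at hx ⊢
          exact fun hx' => hx (hx'.mono h))
    _ ≤ _ := hx
    _ ≤ _ := by gcongr

/-- boundary in `X` -/
noncomputable def bX (π : Equiv.Perm X) (U : Finset X) : ℕ := (U.filter (fun x => π x ∉ U)).card

lemma bX_union (π : Equiv.Perm X) (U V : Finset X) : bX π (U ∪ V) ≤ bX π U + bX π V := by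
  unfold bX
  refine le_trans (Finset.card_le_card ?_) (Finset.card_union_le _ _)
  intro x hx
  simp only [Finset.mem_filter, Finset.mem_union] at hx ⊢
  tauto

lemma bX_out (π : Equiv.Perm X) (U : Finset X) :
    (Finset.univ.filter (fun x => x ∉ U ∧ π x ∈ U)).card = bX π U := by
  unfold bX
  have h1 : (Finset.univ.filter (fun x => π x ∈ U)).card = U.card := by
    have : Finset.univ.filter (fun x => π x ∈ U) = U.map (π.symm.toEmbedding) := by
      ext x
      simp [Equiv.symm_apply_eq]
    rw [this, Finset.card_map]
  have h2 := Finset.card_filter_add_card_filter_not (s := U) (fun x => π x ∈ U)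
  have h3 := Finset.card_filter_add_card_filter_not
    (s := Finset.univ.filter (fun x => π x ∈ U)) (fun x => x ∈ U)
  rw [Finset.filter_filter, Finset.filter_filter] at h3
  have e1 : (Finset.univ.filter (fun x => π x ∈ U ∧ x ∈ U)) = U.filter (fun x => π x ∈ U) := by
    ext x; simp [and_comm]
  have e2 : (Finset.univ.filter (fun x => π x ∈ U ∧ x ∉ U)) = Finset.univ.filter (fun x => x ∉ U ∧ π x ∈ U) := by
    ext x; simp [and_comm]
  rw [e1, e2] at h3
  omega

/-- the tile at `c` -/
noncomputable def tileAt (ψ : G → Equiv.Perm X) (F : Finset G) (c : X) : Finset X :=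
  F.image (fun f => ψ f c)

lemma bX_tile (ψ : G → Equiv.Perm X) (T F : Finset G) (hF : F ⊆ T) (g : G) (hg : g ∈ T) (c : X)
    (hc : Good T ψ c) : bX (ψ g) (tileAt ψ F c) ≤ bd g F := by
  unfold bX bd
  have : (tileAt ψ F c).filter (fun x => ψ g x ∉ tileAt ψ F c) ⊆
      (F.filter (fun f => g * f ∉ F)).image (fun f => ψ f c) := by
    intro x hx
    rw [Finset.mem_filter] at hx
    obtain ⟨f, hf, rfl⟩ := Finset.mem_image.1 hx.1
    refine Finset.mem_image.2 ⟨f, Finset.mem_filter.2 ⟨hf, fun h => hx.2 ?_⟩, rfl⟩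
    rw [hc.1 g hg f (hF hf)]
    exact Finset.mem_image_of_mem _ h
  exact (Finset.card_le_card this).trans Finset.card_image_le

lemma stuck (ψ : G → Equiv.Perm X) (T F : Finset G) (hF0 : F.Nonempty) (U0 U : Finset X) (hU : U0 ⊆ U)
    {ε δ' δ0 : ℝ} (hε : 0 ≤ ε) (hε1 : ε ≤ 1)
    (hs : ∀ c, Good T ψ c → ((F.filter (fun f => ψ f c ∉ U)).card : ℝ) < (1 - ε) * F.card)
    (hbd : ∀ f ∈ F, (bX (ψ f) U0 : ℝ) ≤ δ' * Fintype.card X) (hbad : Appr T δ0 ψ) :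
    (Fintype.card X : ℝ) - U.card ≤ (1 - ε) * (Fintype.card X - U0.card) +
      (δ0 + F.card * δ') * Fintype.card X := by
  set n : ℝ := ((Fintype.card X : ℕ) : ℝ) with hn
  let Q : Finset X := Finset.univ.filter (fun c => c ∉ U0 ∧ Good T ψ c ∧ ∀ f ∈ F, ψ f c ∉ U0)
  -- lower bound on Q
  have hQ : n - U0.card - δ0 * n - F.card * δ' * n ≤ Q.card := by
    have hcov : (Finset.univ : Finset X) ⊆ U0 ∪ Finset.univ.filter (fun x => ¬ Good T ψ x) ∪
        F.biUnion (fun f => Finset.univ.filter (fun x => x ∉ U0 ∧ ψ f x ∈ U0)) ∪ Q := by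
      intro x _
      simp only [Q, Finset.mem_union, Finset.mem_filter, Finset.mem_univ, true_and, Finset.mem_biUnion]
      by_cases h1 : x ∈ U0
      · simp [h1]
      by_cases h2 : Good T ψ x
      · by_cases h3 : ∃ f ∈ F, ψ f x ∈ U0
        · obtain ⟨f, hf, h⟩ := h3
          left; right; exact ⟨f, hf, h1, h⟩
        · right; refine ⟨h1, h2, ?_⟩
          intro f hf h; exact h3 ⟨f, hf, h⟩
      · simp [h2]
    have h1 := Finset.card_le_card hcov
    have h2 := h1.trans ((Finset.card_union_le _ _).trans (Nat.add_le_add_right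
      ((Finset.card_union_le _ _).trans (Nat.add_le_add (Finset.card_union_le _ _) Finset.card_biUnion_le)) _))
    have h3 : ((∑ f ∈ F, (Finset.univ.filter (fun x => x ∉ U0 ∧ ψ f x ∈ U0)).card : ℕ) : ℝ) ≤ F.card * (δ' * n) := by
      push_cast
      rw [← nsmul_eq_mul]
      apply Finset.sum_le_card_nsmul
      intro f hf
      rw [bX_out]
      exact hbd f hf
    have h4 : (Fintype.card X : ℝ) ≤ U0.card + (Finset.univ.filter (fun x => ¬ Good T ψ x)).card +
        ((∑ f ∈ F, (Finset.univ.filter (fun x => x ∉ U0 ∧ ψ f x ∈ U0)).card : ℕ) : ℝ) + Q.card := by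
      rw [Finset.card_univ] at h2
      exact_mod_cast h2
    have h5 := hbad
    unfold Appr at h5
    linarith
  -- double counting
  have hV : ε * Q.card ≤ ((U \ U0).card : ℝ) := by
    have h1 : (∑ c ∈ Q, (F.filter (fun f => ψ f c ∈ U \ U0)).card) =
        ∑ f ∈ F, (Q.filter (fun c => ψ f c ∈ U \ U0)).card := by
      exact Finset.sum_card_bipartiteAbove_eq_sum_card_bipartiteBelow (fun c f => ψ f c ∈ U \ U0)
    have h2 : ∀ f ∈ F, (Q.filter (fun c => ψ f c ∈ U \ U0)).card ≤ (U \ U0).card := by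
      intro f _
      apply Finset.card_le_card_of_injOn (fun c => ψ f c)
      · intro c hc
        exact (Finset.mem_filter.1 hc).2
      · intro x _ y _ h
        exact (ψ f).injective h
    have h3 := Finset.sum_le_card_nsmul F _ _ h2
    have h4 : ∀ c ∈ Q, ε * F.card ≤ ((F.filter (fun f => ψ f c ∈ U \ U0)).card : ℝ) := by
      intro c hc
      simp only [Q, Finset.mem_filter, Finset.mem_univ, true_and] at hc
      have a1 := hs c hc.2.1
      have a2 := Finset.card_filter_add_card_filter_not (s := F) (fun f => ψ f c ∈ U)
      have a3 : F.filter (fun f => ψ f c ∈ U \ U0) = F.filter (fun f => ψ f c ∈ U) := by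
        apply Finset.filter_congr
        intro f hf
        simp [hc.2.2 f hf]
      rw [a3]
      have a4 : ((F.filter (fun f => ψ f c ∈ U)).card : ℝ) + (F.filter (fun f => ψ f c ∉ U)).card = F.card := by
        exact_mod_cast a2
      linarith
    have h5 : (Q.card : ℝ) * (ε * F.card) ≤ ((∑ c ∈ Q, (F.filter (fun f => ψ f c ∈ U \ U0)).card : ℕ) : ℝ) := by
      push_cast
      rw [← nsmul_eq_mul]
      exact Finset.card_nsmul_le_sum _ _ _ h4
    rw [h1] at h5
    have h6 : ((∑ f ∈ F, (Q.filter (fun c => ψ f c ∈ U \ U0)).card : ℕ) : ℝ) ≤ F.card * (U \ U0).card := by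
      exact_mod_cast h3
    have h7 : (0:ℝ) < F.card := by exact_mod_cast hF0.card_pos
    have h8 := h5.trans h6
    nlinarith
  have hc : ((U \ U0).card : ℝ) + U0.card = U.card := by
    exact_mod_cast Finset.card_sdiff_add_card_eq_card hU
  have hnn : 0 ≤ (δ0 + F.card * δ') * n := by
    have h1 : 0 ≤ δ0 * n := le_trans (by positivity) hbad
    obtain ⟨f, hf⟩ := hF0
    have h2 : 0 ≤ δ' * n := le_trans (by positivity) (hbd f hf)
    have h3 : 0 ≤ (F.card : ℝ) * (δ' * n) := by positivity
    linarith
  have hm := mul_le_mul_of_nonneg_left hQ hε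
  nlinarith

/-- partial matching state -/
structure St (U : Finset X) (U' : Finset X') (M : Finset (X × X')) : Prop where
  inj1 : ∀ p ∈ M, ∀ q ∈ M, p.1 = q.1 → p = q
  inj2 : ∀ p ∈ M, ∀ q ∈ M, p.2 = q.2 → p = q
  sub1 : ∀ p ∈ M, p.1 ∈ U
  sub2 : ∀ p ∈ M, (p.2 ∈ U')

noncomputable def dM (π : Equiv.Perm X) (π' : Equiv.Perm X') (M : Finset (X × X')) : ℕ :=
  (M.filter (fun p => (π p.1, π' p.2) ∉ M)).card

lemma dM_union (π : Equiv.Perm X) (π' : Equiv.Perm X') (M N : Finset (X × X')) :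
    dM π π' (M ∪ N) ≤ dM π π' M + dM π π' N := by
  unfold dM
  refine le_trans (Finset.card_le_card ?_) (Finset.card_union_le _ _)
  intro x hx
  simp only [Finset.mem_filter, Finset.mem_union] at hx ⊢
  tauto

noncomputable def addM (ψ : G → Equiv.Perm X) (ψ' : G → Equiv.Perm X') (c : X) (c' : X') (S : Finset G) :
    Finset (X × X') := S.image (fun f => (ψ f c, ψ' f c'))

lemma addM_card (ψ : G → Equiv.Perm X) (ψ' : G → Equiv.Perm X') (c : X) (c' : X') (S T : Finset G)
    (hS : S ⊆ T) (hc : Good T ψ c) : (addM ψ ψ' c c' S).card = S.card := by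
  unfold addM
  apply Finset.card_image_of_injOn
  intro f hf g hg h
  exact hc.2 f (hS hf) g (hS hg) (congrArg Prod.fst h)

lemma dM_addM (ψ : G → Equiv.Perm X) (ψ' : G → Equiv.Perm X') (c : X) (c' : X') (S F T : Finset G)
    (hSF : S ⊆ F) (hFT : F ⊆ T) (hc : Good T ψ c) (hc' : Good T ψ' c') (g : G) (hg : g ∈ T) :
    dM (ψ g) (ψ' g) (addM ψ ψ' c c' S) ≤ bd g F + (F.card - S.card) := by
  unfold dM
  have h1 : (addM ψ ψ' c c' S).filter (fun p => (ψ g p.1, ψ' g p.2) ∉ addM ψ ψ' c c' S) ⊆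
      (S.filter (fun f => g * f ∉ S)).image (fun f => (ψ f c, ψ' f c')) := by
    intro x hx
    rw [Finset.mem_filter] at hx
    obtain ⟨f, hf, rfl⟩ := Finset.mem_image.1 hx.1
    refine Finset.mem_image.2 ⟨f, Finset.mem_filter.2 ⟨hf, fun h => hx.2 ?_⟩, rfl⟩
    simp only
    rw [hc.1 g hg f (hFT (hSF hf)), hc'.1 g hg f (hFT (hSF hf))]
    exact Finset.mem_image_of_mem _ h
  refine (Finset.card_le_card h1).trans (Finset.card_image_le.trans ?_)
  have h2 : S.filter (fun f => g * f ∉ S) ⊆ F.filter (fun f => g * f ∉ F) ∪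
      (F \ S).image (fun f => g⁻¹ * f) := by
    intro f hf
    simp only [Finset.mem_filter, Finset.mem_union, Finset.mem_image, Finset.mem_sdiff] at hf ⊢
    by_cases h : g * f ∈ F
    · right; exact ⟨g * f, ⟨h, hf.2⟩, by simp⟩
    · left; exact ⟨hSF hf.1, h⟩
  refine (Finset.card_le_card h2).trans ((Finset.card_union_le _ _).trans ?_)
  refine Nat.add_le_add_left (Finset.card_image_le.trans ?_) _
  rw [Finset.card_sdiff_of_subset hSF]

end
end HJ


namespace HJ
open scoped Classical
set_option linter.unusedSectionVars false

section
variable {G : Type*} [Group G] {X X' : Type} [Fintype X] [Fintype X']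

structure Inv (ψ : G → Equiv.Perm X) (ψ' : G → Equiv.Perm X') (K : Finset G) (ε α β : ℝ)
    (U : Finset X) (U' : Finset X') (M : Finset (X × X')) : Prop where
  st : St U U' M
  c1 : (U.card : ℝ) ≤ (1 + 2 * ε) * M.card
  c2 : (U'.card : ℝ) ≤ (1 + 2 * ε) * M.card
  b1 : ∀ g ∈ K, (bX (ψ g) U : ℝ) ≤ α * Fintype.card X + β * M.card
  b2 : ∀ g ∈ K, (bX (ψ' g) U' : ℝ) ≤ α * Fintype.card X + β * M.card
  d : ∀ g ∈ K, (dM (ψ g) (ψ' g) M : ℝ) ≤ (4 * ε + β) * M.card + α * Fintype.card X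

lemma tile_union_card (ψ : G → Equiv.Perm X) (F : Finset G) (c : X) (U : Finset X) :
    (U ∪ tileAt ψ F c).card ≤ U.card + (F.filter (fun f => ψ f c ∉ U)).card := by
  have : U ∪ tileAt ψ F c ⊆ U ∪ (F.filter (fun f => ψ f c ∉ U)).image (fun f => ψ f c) := by
    intro x hx
    simp only [tileAt, Finset.mem_union, Finset.mem_image, Finset.mem_filter] at hx ⊢
    by_cases h : x ∈ U
    · exact Or.inl h
    · obtain h' | ⟨f, hf, rfl⟩ := hx
      · exact Or.inl h'
      · exact Or.inr ⟨f, ⟨hf, h⟩, rfl⟩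
  exact (Finset.card_le_card this).trans ((Finset.card_union_le _ _).trans
    (Nat.add_le_add_left Finset.card_image_le _))

lemma card_and_ge (F : Finset G) (p q : G → Prop) :
    (F.filter p).card + (F.filter q).card ≤ (F.filter (fun f => p f ∧ q f)).card + F.card := by
  have h := Finset.card_union_add_card_inter (F.filter p) (F.filter q)
  rw [← Finset.filter_and, ← Finset.filter_or] at h
  have h2 := Finset.card_filter_le F (fun a => p a ∨ q a)
  omega

lemma step (ψ : G → Equiv.Perm X) (ψ' : G → Equiv.Perm X') (K F T : Finset G) {ε α δ1 : ℝ}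
    (hε : 0 < ε) (hε4 : ε ≤ 1/4) (hδ1 : 0 ≤ δ1)
    (hF0 : F.Nonempty) (hKT : K ⊆ T) (hFT : F ⊆ T)
    (hF : ∀ g ∈ K, (bd g F : ℝ) ≤ δ1 * F.card)
    (U : Finset X) (U' : Finset X') (M : Finset (X × X')) (hI : Inv ψ ψ' K ε α (2 * δ1) U U' M)
    (c : X) (c' : X') (hc : Good T ψ c) (hc' : Good T ψ' c')
    (hn : (1 - ε) * F.card ≤ ((F.filter (fun f => ψ f c ∉ U)).card : ℝ))
    (hn' : (1 - ε) * F.card ≤ ((F.filter (fun f => ψ' f c' ∉ U')).card : ℝ)) :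
    ∃ U1 U1' M1, U ⊆ U1 ∧ U' ⊆ U1' ∧ M.card < M1.card ∧ Inv ψ ψ' K ε α (2 * δ1) U1 U1' M1 := by
  set S := F.filter (fun f => ψ f c ∉ U ∧ ψ' f c' ∉ U') with hS
  have hSF : S ⊆ F := Finset.filter_subset _ _
  have hf0 : (0:ℝ) < F.card := by exact_mod_cast hF0.card_pos
  have hs1 : ((F.filter (fun f => ψ f c ∉ U)).card : ℝ) + (F.filter (fun f => ψ' f c' ∉ U')).card
      ≤ S.card + F.card := by
    have h := card_and_ge F (fun f => ψ f c ∉ U) (fun f => ψ' f c' ∉ U')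
    have h' : (F.filter (fun f => ψ f c ∉ U)).card + (F.filter (fun f => ψ' f c' ∉ U')).card
      ≤ S.card + F.card := by convert h
    exact_mod_cast h'
  have hs2 : (1 - 2 * ε) * F.card ≤ S.card := by linarith
  have hs3 : (F.card : ℝ) ≤ 2 * S.card := by nlinarith
  have hdisj : Disjoint M (addM ψ ψ' c c' S) := by
    rw [Finset.disjoint_left]
    intro p hp hp'
    obtain ⟨f, hf, rfl⟩ := Finset.mem_image.1 hp'
    exact (Finset.mem_filter.1 hf).2.1 (hI.st.sub1 _ hp)
  have hMc : (M ∪ addM ψ ψ' c c' S).card = M.card + S.card := by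
    rw [Finset.card_union_of_disjoint hdisj, addM_card ψ ψ' c c' S T (hSF.trans hFT) hc]
  have hMr : ((M ∪ addM ψ ψ' c c' S).card : ℝ) = M.card + S.card := by exact_mod_cast hMc
  have hSpos : 0 < S.card := by
    have : (0:ℝ) < S.card := by linarith
    exact_mod_cast this
  refine ⟨U ∪ tileAt ψ F c, U' ∪ tileAt ψ' F c', M ∪ addM ψ ψ' c c' S, Finset.subset_union_left,
    Finset.subset_union_left, by omega, ?_⟩
  have hfle : ((F.filter (fun f => ψ f c ∉ U)).card : ℝ) ≤ F.card := by
    exact_mod_cast Finset.card_filter_le _ _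
  have hfle' : ((F.filter (fun f => ψ' f c' ∉ U')).card : ℝ) ≤ F.card := by
    exact_mod_cast Finset.card_filter_le _ _
  have hu : ((U ∪ tileAt ψ F c).card : ℝ) ≤ U.card + (F.filter (fun f => ψ f c ∉ U)).card := by
    exact_mod_cast tile_union_card ψ F c U
  have hu' : ((U' ∪ tileAt ψ' F c').card : ℝ) ≤ U'.card + (F.filter (fun f => ψ' f c' ∉ U')).card := by
    exact_mod_cast tile_union_card ψ' F c' U'
  have hεs : ε * F.card ≤ ε * (2 * S.card) := by gcongr
  have hδs : δ1 * F.card ≤ δ1 * (2 * S.card) := by gcongr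
  constructor
  · constructor
    · intro p hp q hq h
      rw [Finset.mem_union] at hp hq
      rcases hp with hp | hp <;> rcases hq with hq | hq
      · exact hI.st.inj1 p hp q hq h
      · obtain ⟨f, hf, rfl⟩ := Finset.mem_image.1 hq
        exact absurd (by have a := hI.st.sub1 p hp; rw [h] at a; exact a) (Finset.mem_filter.1 hf).2.1
      · obtain ⟨f, hf, rfl⟩ := Finset.mem_image.1 hp
        exact absurd (by have a := hI.st.sub1 q hq; rw [← h] at a; exact a) (Finset.mem_filter.1 hf).2.1
      · obtain ⟨f, hf, rfl⟩ := Finset.mem_image.1 hp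
        obtain ⟨f', hf', rfl⟩ := Finset.mem_image.1 hq
        have := hc.2 f (hFT (hSF hf)) f' (hFT (hSF hf')) h
        rw [this]
    · intro p hp q hq h
      rw [Finset.mem_union] at hp hq
      rcases hp with hp | hp <;> rcases hq with hq | hq
      · exact hI.st.inj2 p hp q hq h
      · obtain ⟨f, hf, rfl⟩ := Finset.mem_image.1 hq
        exact absurd (by have a := hI.st.sub2 p hp; rw [h] at a; exact a) (Finset.mem_filter.1 hf).2.2
      · obtain ⟨f, hf, rfl⟩ := Finset.mem_image.1 hp
        exact absurd (by have a := hI.st.sub2 q hq; rw [← h] at a; exact a) (Finset.mem_filter.1 hf).2.2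
      · obtain ⟨f, hf, rfl⟩ := Finset.mem_image.1 hp
        obtain ⟨f', hf', rfl⟩ := Finset.mem_image.1 hq
        have := hc'.2 f (hFT (hSF hf)) f' (hFT (hSF hf')) h
        rw [this]
    · intro p hp
      rw [Finset.mem_union] at hp ⊢
      rcases hp with hp | hp
      · exact Or.inl (hI.st.sub1 p hp)
      · obtain ⟨f, hf, rfl⟩ := Finset.mem_image.1 hp
        exact Or.inr (Finset.mem_image.2 ⟨f, hSF hf, rfl⟩)
    · intro p hp
      rw [Finset.mem_union] at hp ⊢
      rcases hp with hp | hp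
      · exact Or.inl (hI.st.sub2 p hp)
      · obtain ⟨f, hf, rfl⟩ := Finset.mem_image.1 hp
        exact Or.inr (Finset.mem_image.2 ⟨f, hSF hf, rfl⟩)
  · rw [hMr]
    have := hI.c1
    linarith
  · rw [hMr]
    have := hI.c2
    linarith
  · intro g hg
    rw [hMr]
    have h1 := hI.b1 g hg
    have h2 : (bX (ψ g) (U ∪ tileAt ψ F c) : ℝ) ≤ bX (ψ g) U + bd g F := by
      exact_mod_cast (bX_union _ _ _).trans (Nat.add_le_add_left (bX_tile ψ T F hFT g (hKT hg) c hc) _)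
    have h3 := hF g hg
    linarith
  · intro g hg
    rw [hMr]
    have h1 := hI.b2 g hg
    have h2 : (bX (ψ' g) (U' ∪ tileAt ψ' F c') : ℝ) ≤ bX (ψ' g) U' + bd g F := by
      exact_mod_cast (bX_union _ _ _).trans (Nat.add_le_add_left (bX_tile ψ' T F hFT g (hKT hg) c' hc') _)
    have h3 := hF g hg
    linarith
  · intro g hg
    rw [hMr]
    have h1 := hI.d g hg
    have h2 : (dM (ψ g) (ψ' g) (M ∪ addM ψ ψ' c c' S) : ℝ) ≤
        dM (ψ g) (ψ' g) M + (bd g F + ((F.card - S.card : ℕ) : ℝ)) := by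
      exact_mod_cast (dM_union _ _ _ _).trans
        (Nat.add_le_add_left (dM_addM ψ ψ' c c' S F T hSF hFT hc hc' g (hKT hg)) _)
    rw [Nat.cast_sub (Finset.card_le_card hSF)] at h2
    have h3 := hF g hg
    nlinarith

lemma St.card_le1 {U : Finset X} {U' : Finset X'} {M : Finset (X × X')} (h : St U U' M) :
    M.card ≤ Fintype.card X := by
  have : (M.image Prod.fst).card = M.card :=
    Finset.card_image_of_injOn (fun p hp q hq e => h.inj1 p hp q hq e)
  rw [← this]; exact Finset.card_le_univ _

/-- run the greedy procedure until stuck on one of the sides -/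
lemma greedy (ψ : G → Equiv.Perm X) (ψ' : G → Equiv.Perm X') (K F T : Finset G) {ε α δ1 : ℝ}
    (hε : 0 < ε) (hε4 : ε ≤ 1/4) (hδ1 : 0 ≤ δ1)
    (hF0 : F.Nonempty) (hKT : K ⊆ T) (hFT : F ⊆ T)
    (hF : ∀ g ∈ K, (bd g F : ℝ) ≤ δ1 * F.card)
    (U0 : Finset X) (U0' : Finset X') (M0 : Finset (X × X')) (hI : Inv ψ ψ' K ε α (2 * δ1) U0 U0' M0) :
    ∃ U U' M, U0 ⊆ U ∧ U0' ⊆ U' ∧ Inv ψ ψ' K ε α (2 * δ1) U U' M ∧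
      ((∀ c, Good T ψ c → ((F.filter (fun f => ψ f c ∉ U)).card : ℝ) < (1 - ε) * F.card) ∨
       (∀ c, Good T ψ' c → ((F.filter (fun f => ψ' f c ∉ U')).card : ℝ) < (1 - ε) * F.card)) := by
  by_contra hcon
  push Not at hcon
  have key : ∀ m : ℕ, ∃ U U' M, U0 ⊆ U ∧ U0' ⊆ U' ∧ Inv ψ ψ' K ε α (2 * δ1) U U' M ∧ m ≤ M.card := by
    intro m
    induction m with
    | zero => exact ⟨U0, U0', M0, subset_rfl, subset_rfl, hI, Nat.zero_le _⟩
    | succ m ih =>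
      obtain ⟨U, U', M, h1, h2, h3, h4⟩ := ih
      obtain ⟨⟨c, hc, hcn⟩, ⟨c', hc', hcn'⟩⟩ := hcon U U' M h1 h2 h3
      obtain ⟨U1, U1', M1, a1, a2, a3, a4⟩ :=
        step ψ ψ' K F T hε hε4 hδ1 hF0 hKT hFT hF U U' M h3 c c' hc hc' hcn hcn'
      exact ⟨U1, U1', M1, h1.trans a1, h2.trans a2, a4, by omega⟩
  obtain ⟨U, U', M, _, _, h3, h4⟩ := key (Fintype.card X + 1)
  have := h3.st.card_le1
  omega

end

lemma main_ind (G : Type*) [Group G] (hG : Folner G) {ε : ℝ} (hε : 0 < ε) (hε4 : ε ≤ 1/4) (k : ℕ) :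
    ∀ (K : Finset G) (δ : ℝ), 0 < δ → ∃ (T : Finset G) (δ0 : ℝ), 0 < δ0 ∧
      ∀ (X X' : Type) [Fintype X] [Fintype X'] (ψ : G → Equiv.Perm X) (ψ' : G → Equiv.Perm X'),
        Fintype.card X = Fintype.card X' → Appr T δ0 ψ → Appr T δ0 ψ' →
        ∃ U U' M, Inv ψ ψ' K ε δ 0 U U' M ∧
          ((Fintype.card X : ℝ) - U.card) * (Fintype.card X - U'.card) ≤
            ((1 - ε) ^ k + δ) * (Fintype.card X : ℝ) ^ 2 := by
  induction k with
  | zero =>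
    intro K δ hδ
    refine ⟨∅, 1, one_pos, ?_⟩
    intro X X' _ _ ψ ψ' hcard _ _
    refine ⟨∅, ∅, ∅, ?_, ?_⟩
    · constructor
      · constructor <;> simp
      · simp
      · simp
      · intro g _; simp [bX]; positivity
      · intro g _; simp [bX]; positivity
      · intro g _; simp [dM]; positivity
    · simp
      nlinarith [sq_nonneg (Fintype.card X : ℝ)]
  | succ k ih =>
    intro K δ hδ
    obtain ⟨F, hF0, hF⟩ := hG K (δ / 8) (by positivity)
    have hf0 : (0:ℝ) < F.card := by exact_mod_cast hF0.card_pos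
    have hf1 : (1:ℝ) ≤ F.card := by exact_mod_cast hF0.card_pos
    set δ' : ℝ := δ / (8 * F.card) with hδ'
    have hδ'0 : 0 < δ' := by positivity
    have hδ'1 : F.card * δ' = δ / 8 := by rw [hδ']; field_simp
    have hδ'2 : δ' ≤ δ / 8 := by nlinarith
    obtain ⟨T', δ0', hδ0', hT'⟩ := ih (K ∪ F) δ' hδ'0
    refine ⟨T' ∪ (K ∪ F), min δ0' (δ / 8), by positivity, ?_⟩
    intro X X' _ _ ψ ψ' hcard hψ hψ'
    obtain ⟨U0, U0', M0, hI, hr⟩ := hT' X X' ψ ψ' hcard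
      (hψ.mono Finset.subset_union_left (min_le_left _ _))
      (hψ'.mono Finset.subset_union_left (min_le_left _ _))
    set n : ℝ := ((Fintype.card X : ℕ) : ℝ) with hn
    have hn0 : 0 ≤ n := by positivity
    have hI2 : Inv ψ ψ' K ε δ' (2 * (δ / 8)) U0 U0' M0 := by
      refine ⟨hI.st, hI.c1, hI.c2, ?_, ?_, ?_⟩
      · intro g hg
        have := hI.b1 g (Finset.mem_union_left _ hg)
        have h2 : 0 ≤ 2 * (δ / 8) * (M0.card : ℝ) := by positivity
        linarith
      · intro g hg
        have := hI.b2 g (Finset.mem_union_left _ hg)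
        have h2 : 0 ≤ 2 * (δ / 8) * (M0.card : ℝ) := by positivity
        linarith
      · intro g hg
        have := hI.d g (Finset.mem_union_left _ hg)
        have h2 : 0 ≤ 2 * (δ / 8) * (M0.card : ℝ) := by positivity
        linarith
    obtain ⟨U, U', M, hU, hU', hI3, hst⟩ := greedy ψ ψ' K F (T' ∪ (K ∪ F)) hε hε4 (by positivity : 0 ≤ δ / 8) hF0
      (Finset.subset_union_left.trans Finset.subset_union_right)
      (Finset.subset_union_right.trans Finset.subset_union_right) hF U0 U0' M0 hI2
    have hM : (M.card : ℝ) ≤ n := by rw [hn]; exact_mod_cast hI3.st.card_le1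
    have hMδ : 2 * (δ / 8) * (M.card : ℝ) ≤ 2 * (δ / 8) * n := by gcongr
    have hδn : δ' * n ≤ δ / 8 * n := by gcongr
    have hδn0 : 0 ≤ δ * n := by positivity
    refine ⟨U, U', M, ⟨hI3.st, hI3.c1, hI3.c2, ?_, ?_, ?_⟩, ?_⟩
    · intro g hg
      have := hI3.b1 g hg
      linarith
    · intro g hg
      have := hI3.b2 g hg
      linarith
    · intro g hg
      have := hI3.d g hg
      linarith
    · have hbd1 : ∀ f ∈ F, (bX (ψ f) U0 : ℝ) ≤ δ' * (Fintype.card X) := by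
        intro f hf
        have := hI.b1 f (Finset.mem_union_right _ hf)
        simpa using this
      have hbd2 : ∀ f ∈ F, (bX (ψ' f) U0' : ℝ) ≤ δ' * (Fintype.card X') := by
        intro f hf
        have := hI.b2 f (Finset.mem_union_right _ hf)
        rw [← hcard]
        simpa using this
      have hnU : (U.card : ℝ) ≤ n := by rw [hn]; exact_mod_cast Finset.card_le_univ U
      have hnU' : (U'.card : ℝ) ≤ n := by
        rw [hn, hcard]; exact_mod_cast Finset.card_le_univ U'
      have hUU : (U0.card : ℝ) ≤ U.card := by exact_mod_cast Finset.card_le_card hU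
      have hUU' : (U0'.card : ℝ) ≤ U'.card := by exact_mod_cast Finset.card_le_card hU'
      have hmin : (min δ0' (δ / 8) + F.card * δ') * n ≤ δ / 4 * n := by
        gcongr
        have := min_le_right δ0' (δ / 8)
        linarith
      have e0 : (0:ℝ) ≤ 1 - ε := by linarith
      have hu0 : (0:ℝ) ≤ U0.card := by positivity
      have hu0' : (0:ℝ) ≤ U0'.card := by positivity
      have hpk : (1 - ε) * ((1 - ε) ^ k + δ') ≤ (1 - ε) ^ (k + 1) + δ / 8 := by
        rw [pow_succ]
        nlinarith
      have fin : (1 - ε) * ((n - U0.card) * (n - U0'.card)) + δ / 4 * n * n ≤ ((1 - ε) ^ (k+1) + δ) * n ^ 2 := by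
        have h1 := mul_le_mul_of_nonneg_left hr e0
        have h2 := mul_le_mul_of_nonneg_right hpk (sq_nonneg n)
        nlinarith [mul_nonneg hδ.le (sq_nonneg n)]
      rcases hst with hst | hst
      · have := stuck ψ _ F hF0 U0 U hU hε.le (by linarith) hst hbd1 hψ
        rw [← hn] at this
        have h1 : n - U.card ≤ (1 - ε) * (n - U0.card) + δ / 4 * n := by linarith
        refine le_trans ?_ fin
        have h2 : (n - U.card) * (n - U'.card) ≤ (n - U.card) * (n - U0'.card) := by
          apply mul_le_mul_of_nonneg_left <;> linarith
        have h3 : (n - U.card) * (n - U0'.card) ≤ ((1 - ε) * (n - U0.card) + δ / 4 * n) * (n - U0'.card) := by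
          apply mul_le_mul_of_nonneg_right <;> linarith
        have h4 : δ / 4 * n * (n - U0'.card) ≤ δ / 4 * n * n := by
          apply mul_le_mul_of_nonneg_left <;> linarith
        linarith
      · have := stuck ψ' _ F hF0 U0' U' hU' hε.le (by linarith) hst hbd2 hψ'
        rw [← hcard, ← hn] at this
        have h1 : n - U'.card ≤ (1 - ε) * (n - U0'.card) + δ / 4 * n := by linarith
        refine le_trans ?_ fin
        have h2 : (n - U.card) * (n - U'.card) ≤ (n - U0.card) * (n - U'.card) := by
          apply mul_le_mul_of_nonneg_right <;> linarith
        have h3 : (n - U0.card) * (n - U'.card) ≤ (n - U0.card) * ((1 - ε) * (n - U0'.card) + δ / 4 * n) := by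
          apply mul_le_mul_of_nonneg_left <;> linarith
        have h4 : (n - U0.card) * (δ / 4 * n) ≤ n * (δ / 4 * n) := by
          apply mul_le_mul_of_nonneg_right <;> linarith
        linarith

end HJ


namespace HJ
open scoped Classical
set_option linter.unusedSectionVars false

lemma extend_matching {X X' : Type} [Fintype X] [Fintype X'] (hcard : Fintype.card X = Fintype.card X')
    {U : Finset X} {U' : Finset X'} {M : Finset (X × X')} (h : St U U' M) :
    ∃ Φ : X ≃ X', ∀ p ∈ M, Φ p.1 = p.2 := by
  let e0 : X ≃ X' := Fintype.equivOfCardEq hcard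
  let f : X → X' := fun x => if h : ∃ x', (x, x') ∈ M then h.choose else e0 x
  have hf : ∀ p ∈ M, f p.1 = p.2 := by
    intro p hp
    have hex : ∃ x', (p.1, x') ∈ M := ⟨p.2, hp⟩
    have h1 : f p.1 = hex.choose := dif_pos hex
    rw [h1]
    have := h.inj1 _ hex.choose_spec p hp rfl
    exact congrArg Prod.snd this
  obtain ⟨g, hg⟩ := Finset.exists_equiv_extend_of_card_eq (t := (Finset.univ : Finset X'))
    (by rw [Finset.card_univ, hcard]) (s := M.image Prod.fst) (f := f) (Finset.subset_univ _) (by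
      intro x hx y hy hxy
      simp only [Finset.coe_image, Set.mem_image, Finset.mem_coe] at hx hy
      obtain ⟨p, hp, rfl⟩ := hx
      obtain ⟨q, hq, rfl⟩ := hy
      rw [hf p hp, hf q hq] at hxy
      rw [h.inj2 p hp q hq hxy])
  refine ⟨g.trans (Equiv.subtypeUnivEquiv (fun x => Finset.mem_univ x)), ?_⟩
  intro p hp
  have := hg p.1 (Finset.mem_image_of_mem _ hp)
  rw [hf p hp] at this
  simpa using this

theorem uniq (G : Type*) [Group G] (hG : Folner G) (K : Finset G) (η : ℝ) (hη : 0 < η) :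
    ∃ (T : Finset G) (δ0 : ℝ), 0 < δ0 ∧
      ∀ (X X' : Type) [Fintype X] [Fintype X'] (ψ : G → Equiv.Perm X) (ψ' : G → Equiv.Perm X'),
        Fintype.card X = Fintype.card X' → Appr T δ0 ψ → Appr T δ0 ψ' →
        ∃ Φ : X ≃ X', ∀ g ∈ K,
          ((Finset.univ.filter (fun x => Φ (ψ g x) ≠ ψ' g (Φ x))).card : ℝ) ≤ η * Fintype.card X := by
  set ε : ℝ := min (1/4) (η / 8) with hε
  have hε0 : 0 < ε := by positivity
  have hε4 : ε ≤ 1/4 := min_le_left _ _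
  have hεη : ε ≤ η / 8 := min_le_right _ _
  obtain ⟨k, hk⟩ := exists_pow_lt_of_lt_one (show 0 < ε ^ 2 / 2 by positivity) (show 1 - ε < 1 by linarith)
  obtain ⟨T, δ0, hδ0, h⟩ := main_ind G hG hε0 hε4 k K (ε ^ 2 / 2) (by positivity)
  refine ⟨T, δ0, hδ0, ?_⟩
  intro X X' _ _ ψ ψ' hcard hψ hψ'
  obtain ⟨U, U', M, hI, hr⟩ := h X X' ψ ψ' hcard hψ hψ'
  obtain ⟨Φ, hΦ⟩ := extend_matching hcard hI.st
  refine ⟨Φ, fun g hg => ?_⟩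
  set n : ℝ := ((Fintype.card X : ℕ) : ℝ) with hn
  have hn0 : 0 ≤ n := by positivity
  have hr2 : (n - U.card) * (n - U'.card) ≤ (ε * n) ^ 2 := by
    refine hr.trans ?_
    have := mul_le_mul_of_nonneg_right hk.le (sq_nonneg n)
    nlinarith
  have hMn : (M.card : ℝ) ≤ n := by rw [hn]; exact_mod_cast hI.st.card_le1
  have hεn : 0 ≤ ε * n := by positivity
  have hM : n - M.card ≤ 3 * ε * n := by
    have hcase : n - U.card ≤ ε * n ∨ n - U'.card ≤ ε * n := by
      by_contra hcon
      push Not at hcon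
      nlinarith
    have h2 : ε * M.card ≤ ε * n := by gcongr
    rcases hcase with hc | hc
    · have := hI.c1
      linarith
    · have := hI.c2
      linarith
  have hd := hI.d g hg
  rw [← hn] at hd
  have hsub : Finset.univ.filter (fun x => Φ (ψ g x) ≠ ψ' g (Φ x)) ⊆
      (Finset.univ \ M.image Prod.fst) ∪ (M.filter (fun p => (ψ g p.1, ψ' g p.2) ∉ M)).image Prod.fst := by
    intro x hx
    simp only [Finset.mem_filter, Finset.mem_univ, true_and, ne_eq] at hx
    rw [Finset.mem_union]
    by_cases hxM : x ∈ M.image Prod.fst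
    · right
      obtain ⟨p, hp, rfl⟩ := Finset.mem_image.1 hxM
      refine Finset.mem_image.2 ⟨p, Finset.mem_filter.2 ⟨hp, fun hq => hx ?_⟩, rfl⟩
      rw [hΦ p hp, hΦ _ hq]
    · left; simpa using hxM
  have hcM : (M.image Prod.fst).card = M.card :=
    Finset.card_image_of_injOn (fun p hp q hq e => hI.st.inj1 p hp q hq e)
  have h1 : (Finset.univ.filter (fun x => Φ (ψ g x) ≠ ψ' g (Φ x))).card ≤
      (Fintype.card X - M.card) + dM (ψ g) (ψ' g) M := by
    refine (Finset.card_le_card hsub).trans ((Finset.card_union_le _ _).trans ?_)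
    refine Nat.add_le_add ?_ Finset.card_image_le
    rw [Finset.card_sdiff_of_subset (Finset.subset_univ _), hcM, Finset.card_univ]
  have h2 : ((Finset.univ.filter (fun x => Φ (ψ g x) ≠ ψ' g (Φ x))).card : ℝ) ≤
      (n - M.card) + dM (ψ g) (ψ' g) M := by
    rw [hn, ← Nat.cast_sub hI.st.card_le1]
    exact_mod_cast h1
  have h3 : ε * M.card ≤ ε * n := by gcongr
  have h4 : ε ^ 2 / 2 * n ≤ ε * n := by
    gcongr
    nlinarith
  have h5 : ε * n ≤ η / 8 * n := by gcongr
  linarith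

end HJ


namespace HJ
open scoped Classical
set_option linter.unusedSectionVars false

/-! Standard model -/

lemma sol_bound (n : ℕ) [NeZero n] (m : ℕ) (hm : 0 < m) (y : ZMod n) :
    (Finset.univ.filter (fun x : ZMod n => (m : ZMod n) * x = y)).card ≤ m := by
  have hn : 0 < n := Nat.pos_of_ne_zero (NeZero.ne n)
  calc _ ≤ (Finset.range m).card := by
        apply Finset.card_le_card_of_injOn (fun x => m * x.val / n)
        · intro x _
          simp only [Finset.coe_range, Set.mem_Iio]
          rw [Nat.div_lt_iff_lt_mul hn]
          exact Nat.mul_lt_mul_of_pos_left (ZMod.val_lt x) hm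
        · intro x hx z hz hxz
          simp only [Finset.coe_filter, Finset.mem_univ, true_and, Set.mem_ofPred_eq] at hx hz
          simp only at hxz
          have h1 : ((m * x.val : ℕ) : ZMod n) = ((m * z.val : ℕ) : ZMod n) := by
            push_cast
            rw [ZMod.natCast_zmod_val, ZMod.natCast_zmod_val, hx, hz]
          rw [ZMod.natCast_eq_natCast_iff'] at h1
          have h2 := Nat.div_add_mod (m * x.val) n
          have h3 := Nat.div_add_mod (m * z.val) n
          rw [hxz, h1, h3] at h2
          exact ZMod.val_injective n (Nat.eq_of_mul_eq_mul_left hm h2.symm)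
    _ = m := Finset.card_range m

/-- multiplication by two, for odd `n` -/
noncomputable def dbl (n : ℕ) (hn : Odd n) : Equiv.Perm (ZMod n) :=
  Units.mulLeft (ZMod.unitOfCoprime 2 (Nat.coprime_two_left.2 hn))

lemma dbl_apply (n : ℕ) (hn : Odd n) (x : ZMod n) : dbl n hn x = 2 * x := by
  simp [dbl]

lemma dbl_rel (n : ℕ) (hn : Odd n) :
    dbl n hn * Equiv.addRight 1 * (dbl n hn)⁻¹ = (Equiv.addRight (1 : ZMod n)) ^ 2 := by
  rw [mul_inv_eq_iff_eq_mul]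
  ext x
  simp only [Equiv.Perm.mul_apply, pow_two, Equiv.coe_addRight, dbl_apply]
  ring

noncomputable def psi (n : ℕ) (hn : Odd n) : BSG →* Equiv.Perm (ZMod n) := bsLift _ _ (dbl_rel n hn)

lemma dbl_pow (n : ℕ) (hn : Odd n) (r : ℕ) (x : ZMod n) : (dbl n hn ^ r) x = 2 ^ r * x := by
  induction r with
  | zero => simp
  | succ r ih => rw [pow_succ', Equiv.Perm.mul_apply, ih, dbl_apply]; ring

lemma add_zpow' (n : ℕ) (q : ℤ) (x : ZMod n) : ((Equiv.addRight (1 : ZMod n)) ^ q) x = x + q := by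
  have hp : ∀ (k : ℕ) (x : ZMod n), ((Equiv.addRight (1 : ZMod n)) ^ k) x = x + k := by
    intro k
    induction k with
    | zero => simp
    | succ k ih => intro x; rw [pow_succ', Equiv.Perm.mul_apply, ih]; simp [add_assoc]
  rcases q with k | k
  · simp [hp]
  · rw [zpow_negSucc, Equiv.Perm.inv_eq_iff_eq, hp]
    push_cast
    ring

lemma psi_fix (g : BSG) (hg : g ≠ 1) : ∃ C N : ℕ, ∀ n (hn : Odd n) [NeZero n], N < n →
    (Finset.univ.filter (fun x => psi n hn g x = x)).card ≤ C := by
  obtain ⟨p, r, q, rfl⟩ := bs_form g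
  have key : ∀ n (hn : Odd n) (x : ZMod n), psi n hn ((gA ^ p)⁻¹ * gB ^ q * gA ^ r) x = x →
      (2:ZMod n) ^ r * x + q = 2 ^ p * x := by
    intro n hn x hx
    rw [map_mul, map_mul, map_inv, map_pow, map_pow, map_zpow, psi, bsLift_A, bsLift_B,
      Equiv.Perm.mul_apply, Equiv.Perm.mul_apply, Equiv.Perm.inv_eq_iff_eq, dbl_pow, dbl_pow, add_zpow'] at hx
    exact hx
  rcases lt_trichotomy p r with h | h | h
  · have h2 : 2 ^ p < 2 ^ r := Nat.pow_lt_pow_right (by norm_num) h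
    refine ⟨2 ^ r - 2 ^ p, 0, fun n hn _ _ => ?_⟩
    refine le_trans (Finset.card_le_card ?_) (sol_bound n (2 ^ r - 2 ^ p) (by omega) (-q))
    intro x hx
    simp only [Finset.mem_filter, Finset.mem_univ, true_and] at hx ⊢
    have := key n hn x hx
    rw [Nat.cast_sub h2.le]; push_cast
    linear_combination this
  · refine ⟨0, q.natAbs, fun n hn _ hN => ?_⟩
    rw [Nat.le_zero, Finset.card_eq_zero, Finset.filter_eq_empty_iff]
    intro x _ hx
    have := key n hn x hx
    subst h
    have h1 : (q : ZMod n) = 0 := by linear_combination this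
    rw [ZMod.intCast_zmod_eq_zero_iff_dvd] at h1
    have h2 : q = 0 := Int.eq_zero_of_abs_lt_dvd h1 (by rw [Int.abs_eq_natAbs]; exact_mod_cast hN)
    apply hg
    rw [h2]; simp
  · have h2 : 2 ^ r < 2 ^ p := Nat.pow_lt_pow_right (by norm_num) h
    refine ⟨2 ^ p - 2 ^ r, 0, fun n hn _ _ => ?_⟩
    refine le_trans (Finset.card_le_card ?_) (sol_bound n (2 ^ p - 2 ^ r) (by omega) q)
    intro x hx
    simp only [Finset.mem_filter, Finset.mem_univ, true_and] at hx ⊢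
    have := key n hn x hx
    rw [Nat.cast_sub h2.le]; push_cast
    linear_combination -this

lemma psi_appr (T : Finset BSG) (δ : ℝ) (hδ : 0 < δ) : ∃ N : ℕ, ∀ n (hn : Odd n) [NeZero n], N < n →
    Appr T δ (fun g => psi n hn g) := by
  have : ∀ g : BSG, ∃ C N : ℕ, g ≠ 1 → ∀ n (hn : Odd n) [NeZero n], N < n →
    (Finset.univ.filter (fun x => psi n hn g x = x)).card ≤ C := by
    intro g
    by_cases hg : g = 1
    · exact ⟨0, 0, fun h => absurd hg h⟩
    · obtain ⟨C, N, h⟩ := psi_fix g hg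
      exact ⟨C, N, fun _ => h⟩
  choose C N hC using this
  let P := ((T ×ˢ T).filter (fun p => p.1 ≠ p.2)).image (fun p => p.2⁻¹ * p.1)
  obtain ⟨M, hM⟩ := exists_nat_gt ((∑ g ∈ P, C g : ℕ) / δ)
  refine ⟨P.sup N ⊔ M, fun n hn _ hn' => ?_⟩
  unfold Appr
  have h1 : (Finset.univ.filter (fun x => ¬ Good T (fun g => psi n hn g) x)).card ≤ ∑ g ∈ P, C g := by
    calc _ ≤ (P.biUnion (fun g => Finset.univ.filter (fun x => psi n hn g x = x))).card := by
          apply Finset.card_le_card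
          intro x hx
          simp only [Finset.mem_filter, Finset.mem_univ, true_and, Finset.mem_biUnion] at hx ⊢
          by_contra hcon
          apply hx
          refine ⟨fun g _ h _ => by simp, fun g hg h hh e => ?_⟩
          by_contra hne
          apply hcon
          refine ⟨h⁻¹ * g, Finset.mem_image.2 ⟨(g, h), by simp [hg, hh, hne], rfl⟩, ?_⟩
          rw [map_mul, map_inv, Equiv.Perm.mul_apply, Equiv.Perm.inv_eq_iff_eq]
          exact e
      _ ≤ ∑ g ∈ P, (Finset.univ.filter (fun x => psi n hn g x = x)).card := Finset.card_biUnion_le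
      _ ≤ _ := by
          apply Finset.sum_le_sum
          intro g hg
          apply hC g _ n hn
          · have : N g ≤ P.sup N := Finset.le_sup hg
            have := le_max_left (P.sup N) M
            omega
          · obtain ⟨⟨u, v⟩, huv, rfl⟩ := Finset.mem_image.1 hg
            simp only [Finset.mem_filter] at huv
            intro h0
            exact huv.2 (inv_mul_eq_one.1 h0).symm
  rw [ZMod.card]
  have h2 : ((∑ g ∈ P, C g : ℕ) : ℝ) < M * δ := (div_lt_iff₀ hδ).1 hM
  have h3 : (M : ℝ) ≤ n := by
    have := le_max_right (P.sup N) M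
    exact_mod_cast (by omega : M ≤ n)
  have h4 : ((Finset.univ.filter (fun x => ¬ Good T (fun g => psi n hn g) x)).card : ℝ) ≤ (∑ g ∈ P, C g : ℕ) := by
    exact_mod_cast h1
  nlinarith

/-! From soficity to `Appr` -/

lemma sofic_appr {G : Type*} [Group G] (hG : IsSofic G) (g0 : G) (hg0 : g0 ≠ 1) (T : Finset G) (δ : ℝ)
    (hδ : 0 < δ) : ∃ (m : ℕ) (ψ : G → Equiv.Perm (Fin m)), 0 < m ∧ Appr T δ ψ := by
  let S0 : Finset G := T ∪ T.image (fun g => g⁻¹) ∪ {1}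
  let S : Finset G := S0 ∪ (S0 ×ˢ S0).image (fun p => p.1 * p.2) ∪ {g0}
  let D : ℝ := (S0 ×ˢ S0).card + S.card + 1
  have hD : 0 < D := by positivity
  obtain ⟨m, ψ, h1, h2⟩ := hG (S : Set G) S.finite_toSet (min 1 (δ / D)) (lt_min one_pos (div_pos hδ hD))
  have hm : 0 < m := by
    rcases Nat.eq_zero_or_pos m with rfl | h
    · have := h2 g0 (by simp [S]) hg0
      have h3 := min_le_left 1 (δ / D)
      simp only [permDist, Nat.cast_zero, div_zero] at this
      linarith
    · exact h
  have hm' : (0:ℝ) < m := by exact_mod_cast hm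
  refine ⟨m, ψ, hm, ?_⟩
  have hT0 : T ⊆ S0 := fun g hg => by simp [S0, hg]
  have hT0' : ∀ g ∈ T, g⁻¹ ∈ S0 := fun g hg => by simp [S0, hg]
  have h10 : (1:G) ∈ S0 := by simp [S0]
  have h0S : S0 ⊆ S := fun g hg => by simp [S, hg]
  have hmS : ∀ g ∈ S0, ∀ h ∈ S0, g * h ∈ S := fun g hg h hh => by
    simp only [S, Finset.mem_union, Finset.mem_image, Finset.mem_product]
    exact Or.inl (Or.inr ⟨(g, h), ⟨hg, hh⟩, rfl⟩)
  let E1 : G × G → Finset (Fin m) := fun p => Finset.univ.filter (fun x => ψ p.1 (ψ p.2 x) ≠ ψ (p.1 * p.2) x)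
  let E2 : G → Finset (Fin m) := fun g => Finset.univ.filter (fun x => ψ g x = x)
  have hE1 : ∀ p ∈ S0 ×ˢ S0, ((E1 p).card : ℝ) ≤ δ / D * m := by
    intro p hp
    rw [Finset.mem_product] at hp
    have := (h1 p.1 (h0S hp.1) p.2 (h0S hp.2) (hmS _ hp.1 _ hp.2)).trans_le (min_le_right _ _)
    rw [permDist, div_lt_iff₀ hm'] at this
    refine le_of_eq_of_le ?_ this.le
    congr 2
  have hE2 : ∀ g ∈ S.filter (fun g => g ≠ 1), ((E2 g).card : ℝ) ≤ δ / D * m := by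
    intro g hg
    rw [Finset.mem_filter] at hg
    have h3 := h2 g hg.1 hg.2
    have h4 := min_le_right 1 (δ / D)
    have h5 : 1 - δ / D < permDist (ψ g) 1 := by linarith
    rw [permDist, lt_div_iff₀ hm'] at h5
    have h6 := Finset.card_filter_add_card_filter_not (s := (Finset.univ : Finset (Fin m))) (fun x => ψ g x = x)
    rw [Finset.card_univ, Fintype.card_fin] at h6
    have h7 : ((E2 g).card : ℝ) + ((Finset.univ.filter (fun x => ¬ ψ g x = x)).card : ℝ) = m := by
      exact_mod_cast h6
    have h8 : ((Finset.univ.filter (fun x => ¬ ψ g x = x)).card : ℝ) > (1 - δ / D) * m := by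
      refine lt_of_lt_of_eq h5 ?_
      congr 2
    linarith
  unfold Appr
  have hsub : Finset.univ.filter (fun x => ¬ Good T ψ x) ⊆
      (S0 ×ˢ S0).biUnion E1 ∪ (S.filter (fun g => g ≠ 1)).biUnion E2 := by
    intro x hx
    simp only [Finset.mem_filter, Finset.mem_univ, true_and] at hx
    by_contra hcon
    rw [Finset.mem_union, not_or] at hcon
    obtain ⟨c1, c2⟩ := hcon
    have c1' : ∀ g ∈ S0, ∀ h ∈ S0, ψ g (ψ h x) = ψ (g * h) x := by
      intro g hg h hh
      by_contra hne
      exact c1 (Finset.mem_biUnion.2 ⟨(g, h), Finset.mem_product.2 ⟨hg, hh⟩, by simp [E1, hne]⟩)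
    have c2' : ∀ g ∈ S, ψ g x = x → g = 1 := by
      intro g hg e
      by_contra hne
      exact c2 (Finset.mem_biUnion.2 ⟨g, Finset.mem_filter.2 ⟨hg, hne⟩, by simp [E2, e]⟩)
    apply hx
    refine ⟨fun g hg h hh => c1' g (hT0 hg) h (hT0 hh), fun g hg h hh e => ?_⟩
    have e1 : ψ 1 x = x := by
      have := c1' 1 h10 1 h10
      rw [one_mul] at this
      exact (ψ 1).injective this
    have e2 := c1' h⁻¹ (hT0' h hh) g (hT0 hg)
    have e3 := c1' h⁻¹ (hT0' h hh) h (hT0 hh)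
    rw [e, e3, inv_mul_cancel, e1] at e2
    exact (inv_mul_eq_one.1 (c2' _ (hmS _ (hT0' h hh) _ (hT0 hg)) e2.symm)).symm
  have hc1 : ((Finset.univ.filter (fun x => ¬ Good T ψ x)).card : ℝ) ≤
      ∑ p ∈ S0 ×ˢ S0, ((E1 p).card : ℝ) + ∑ g ∈ S.filter (fun g => g ≠ 1), ((E2 g).card : ℝ) := by
    have := (Finset.card_le_card hsub).trans ((Finset.card_union_le _ _).trans
      (add_le_add Finset.card_biUnion_le Finset.card_biUnion_le))
    exact_mod_cast this
  have hc2 := Finset.sum_le_sum hE1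
  have hc3 := Finset.sum_le_sum hE2
  rw [Finset.sum_const, nsmul_eq_mul] at hc2 hc3
  have hc4 : ((S.filter (fun g => g ≠ 1)).card : ℝ) ≤ S.card := by
    exact_mod_cast Finset.card_filter_le _ _
  have hpos : 0 < δ / D * m := by positivity
  have hfin : D * (δ / D * m) = δ * m := by field_simp
  rw [Fintype.card_fin, ← hfin]
  have : D * (δ / D * m) = (S0 ×ˢ S0).card * (δ / D * m) + S.card * (δ / D * m) + δ / D * m := by
    simp only [D]; ring
  nlinarith

end HJ


namespace HJ
open scoped Classical
set_option linter.unusedSectionVars false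

/-! The model built from a sofic approximation of Higman's group -/

abbrev XX (m q r : ℕ) : Type := (Fin q × Fin 4 × Fin m) ⊕ Fin r

noncomputable def psiX {m : ℕ} (q r : ℕ) (ψ0 : HigmanGroup → Equiv.Perm (Fin m)) (g : BSG) :
    Equiv.Perm (XX m q r) where
  toFun := Sum.map (fun t => (t.1, t.2.1, ψ0 (theta t.2.1 g) t.2.2)) id
  invFun := Sum.map (fun t => (t.1, t.2.1, (ψ0 (theta t.2.1 g)).symm t.2.2)) id
  left_inv := by rintro (⟨j, i, y⟩ | x) <;> simp
  right_inv := by rintro (⟨j, i, y⟩ | x) <;> simp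

def fX (m q r : ℕ) : Equiv.Perm (XX m q r) where
  toFun := Sum.map (fun t => (t.1, t.2.1 + 1, t.2.2)) id
  invFun := Sum.map (fun t => (t.1, t.2.1 - 1, t.2.2)) id
  left_inv := by rintro (⟨j, i, y⟩ | x) <;> simp
  right_inv := by rintro (⟨j, i, y⟩ | x) <;> simp

lemma fX_pow (m q r : ℕ) : fX m q r ^ 4 = 1 := by
  apply Equiv.ext
  rintro (⟨j, i, y⟩ | x)
  · have : i + 1 + 1 + 1 + 1 = i := by revert i; decide
    simp [pow_succ, fX, this]
  · simp [pow_succ, fX]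

lemma fX_rel {m : ℕ} (q r : ℕ) (ψ0 : HigmanGroup → Equiv.Perm (Fin m)) (x : XX m q r) :
    fX m q r (psiX q r ψ0 gB x) = psiX q r ψ0 gA (fX m q r x) := by
  rcases x with ⟨j, i, y⟩ | x
  · have : theta i gB = theta (i+1) gA := by
      rw [theta, theta, bsLift_A, bsLift_B]
    simp [fX, psiX, this]
  · simp [fX, psiX]

lemma psiX_appr {m : ℕ} (q r : ℕ) (ψ0 : HigmanGroup → Equiv.Perm (Fin m)) (T : Finset BSG) (δ : ℝ)
    (h : Appr (Finset.univ.biUnion (fun i : Fin 4 => T.image (theta i))) (δ / 2) ψ0)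
    (hr : (r : ℝ) ≤ δ / 2 * (4 * m * q + r)) : Appr T δ (psiX q r ψ0) := by
  unfold Appr at *
  set T' := Finset.univ.biUnion (fun i : Fin 4 => T.image (theta i)) with hT'
  have hmem : ∀ i, ∀ g ∈ T, theta i g ∈ T' := fun i g hg =>
    Finset.mem_biUnion.2 ⟨i, Finset.mem_univ _, Finset.mem_image_of_mem _ hg⟩
  set Bd := Finset.univ.filter (fun x => ¬ Good T' ψ0 x) with hBd
  have hsub : Finset.univ.filter (fun x => ¬ Good T (psiX q r ψ0) x) ⊆
      ((Finset.univ : Finset (Fin q)) ×ˢ (Finset.univ : Finset (Fin 4)) ×ˢ Bd).disjSum (Finset.univ : Finset (Fin r)) := by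
    rintro (⟨j, i, y⟩ | x) hx
    · simp only [Finset.mem_filter, Finset.mem_univ, true_and] at hx
      rw [Finset.inl_mem_disjSum]
      simp only [Finset.mem_product, Finset.mem_univ, true_and, hBd, Finset.mem_filter]
      intro hg
      apply hx
      constructor
      · intro g hgT k hk
        have := hg.1 _ (hmem i g hgT) _ (hmem i k hk)
        simp [psiX, this]
      · intro g hgT k hk e
        simp only [psiX, Equiv.coe_fn_mk, Sum.map_inl, Sum.inl.injEq, Prod.mk.injEq, true_and] at e
        exact theta_inj i (hg.2 _ (hmem i g hgT) _ (hmem i k hk) e)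
    · simp
  have h1 := Finset.card_le_card hsub
  rw [Finset.card_disjSum, Finset.card_product, Finset.card_product] at h1
  simp only [Finset.card_univ, Fintype.card_fin] at h1
  have h2 : ((Finset.univ.filter (fun x => ¬ Good T (psiX q r ψ0) x)).card : ℝ) ≤ q * (4 * Bd.card) + r := by
    exact_mod_cast h1
  have h3 : (Fintype.card (XX m q r) : ℝ) = 4 * m * q + r := by
    simp [XX]; ring
  rw [h3]
  rw [Fintype.card_fin] at h
  have h4 : (q : ℝ) * (4 * Bd.card) ≤ q * (4 * (δ / 2 * m)) := by gcongr
  have h5 : 0 ≤ (r : ℝ) * (δ / 2) ∨ δ < 0 := by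
    rcases le_or_gt 0 δ with h | h
    · left; positivity
    · right; exact h
  rcases h5 with h5 | h5
  · nlinarith
  · have : (0:ℝ) ≤ r := by positivity
    have h7 : 0 ≤ (Bd.card : ℝ) := by positivity
    have h6 : (0:ℝ) ≤ 4 * m * q + r := by positivity
    have h8 : (0:ℝ) ≤ 4 * m * q := by positivity
    nlinarith

lemma main (hsofic : IsSofic HigmanGroup) (ε : ℝ) (hε : 0 < ε) :
    ∃ N : ℕ, ∀ n : ℕ, Odd n → n > N →
      ∃ f : Equiv.Perm (ZMod n), f ^ 4 = 1 ∧
        (1 - ε) * n ≤ (({x : ZMod n | f (x + 1) = 2 * f x}).ncard : ℝ) := by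
  obtain ⟨T, δ, hδ, hu⟩ := uniq BSG bs_folner {gA, gB} (ε / 2) (by positivity)
  obtain ⟨N1, hN1⟩ := psi_appr T δ hδ
  have hg0 : (hgen 0)⁻¹ ≠ 1 := by
    intro h
    have := hgen_inf 0 1 (by rw [h]; simp)
    norm_num at this
  obtain ⟨m, ψ0, hm, hψ0⟩ := sofic_appr hsofic _ hg0
    (Finset.univ.biUnion (fun i : Fin 4 => T.image (theta i))) (δ / 2) (by positivity)
  obtain ⟨N2, hN2⟩ := exists_nat_gt (8 * m / δ)
  refine ⟨N1 ⊔ N2, fun n hn hnN => ?_⟩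
  have hnN1 : N1 < n := lt_of_le_of_lt (le_max_left _ _) hnN
  have hnN2 : N2 < n := lt_of_le_of_lt (le_max_right _ _) hnN
  haveI : NeZero n := ⟨by omega⟩
  set q := n / (4 * m) with hq
  set r := n % (4 * m) with hr
  have hqr : 4 * m * q + r = n := Nat.div_add_mod n (4 * m)
  have hr4 : r < 4 * m := Nat.mod_lt _ (by omega)
  have hX : Appr T δ (psiX q r ψ0) := by
    apply psiX_appr q r ψ0 T δ hψ0
    have h1 : (4 * m * q + r : ℝ) = n := by exact_mod_cast hqr
    have h2 : (r : ℝ) < 4 * m := by exact_mod_cast hr4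
    have h3 : (N2 : ℝ) < n := by exact_mod_cast hnN2
    rw [div_lt_iff₀ hδ] at hN2
    rw [h1]
    nlinarith
  have hcard : Fintype.card (XX m q r) = n := by
    rw [← hqr]; simp [XX]; ring
  obtain ⟨Φ, hΦ⟩ := hu (XX m q r) (ZMod n) (psiX q r ψ0) (fun g => psi n hn g)
    (by rw [hcard, ZMod.card]) hX (hN1 n hn hnN1)
  have hA := hΦ gA (by simp)
  have hB := hΦ gB (by simp)
  have eA : ∀ x, psi n hn gA x = 2 * x := fun x => by rw [psi, bsLift_A, dbl_apply]
  have eB : ∀ x, psi n hn gB x = x + 1 := fun x => by rw [psi, bsLift_B]; rfl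
  simp only [eA, eB] at hA hB
  rw [hcard] at hA hB
  refine ⟨Φ.permCongr (fX m q r), ?_, ?_⟩
  · have : Φ.permCongr (fX m q r) = Φ.permCongrHom (fX m q r) := rfl
    rw [this, ← map_pow, fX_pow, map_one]
  · have hnc : ({x : ZMod n | Φ.permCongr (fX m q r) (x + 1) = 2 * Φ.permCongr (fX m q r) x}).ncard =
        (Finset.univ.filter (fun x : ZMod n => Φ.permCongr (fX m q r) (x + 1) = 2 * Φ.permCongr (fX m q r) x)).card := by
      rw [← Set.ncard_coe_finset]; simp only [Finset.coe_filter, Finset.mem_univ, true_and]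
    rw [hnc]
    set UA := Finset.univ.filter (fun x : XX m q r => Φ (psiX q r ψ0 gA x) ≠ 2 * Φ x) with hUA
    set UB := Finset.univ.filter (fun x : XX m q r => Φ (psiX q r ψ0 gB x) ≠ Φ x + 1) with hUB
    have hbad : (Finset.univ.filter (fun x : ZMod n => ¬ Φ.permCongr (fX m q r) (x + 1) = 2 * Φ.permCongr (fX m q r) x)) ⊆
        UB.image Φ ∪ UA.image (fun x => Φ ((fX m q r).symm x)) := by
      intro x hx
      simp only [Finset.mem_filter, Finset.mem_univ, true_and] at hx
      by_contra hcon
      rw [Finset.mem_union, not_or] at hcon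
      obtain ⟨c1, c2⟩ := hcon
      apply hx
      have d1 : Φ (psiX q r ψ0 gB (Φ.symm x)) = x + 1 := by
        by_contra hne
        exact c1 (Finset.mem_image.2 ⟨Φ.symm x, by simp [hUB, hne], by simp⟩)
      have d2 : Φ (psiX q r ψ0 gA (fX m q r (Φ.symm x))) = 2 * Φ (fX m q r (Φ.symm x)) := by
        by_contra hne
        exact c2 (Finset.mem_image.2 ⟨fX m q r (Φ.symm x), by simp [hUA, hne], by simp⟩)
      rw [Equiv.permCongr_apply, Equiv.permCongr_apply, ← d1, Equiv.symm_apply_apply, fX_rel, d2]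
    have h1 := (Finset.card_le_card hbad).trans ((Finset.card_union_le _ _).trans
      (add_le_add Finset.card_image_le Finset.card_image_le))
    have h2 := Finset.card_filter_add_card_filter_not (s := (Finset.univ : Finset (ZMod n)))
      (fun x => Φ.permCongr (fX m q r) (x + 1) = 2 * Φ.permCongr (fX m q r) x)
    rw [Finset.card_univ, ZMod.card] at h2
    have h3 : (n : ℝ) ≤ ((Finset.univ.filter (fun x : ZMod n => Φ.permCongr (fX m q r) (x + 1) = 2 * Φ.permCongr (fX m q r) x)).card : ℝ)
        + (UB.card + UA.card) := by
      exact_mod_cast (by omega)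
    linarith

end HJ

/-- **Theorem (Helfgott–Juschenko).** If Higman's group is sofic, then for every `ε > 0`
there is `N` such that for every odd `n > N` there is a permutation `f` of `ℤ/nℤ` of order
dividing 4 with `f(x+1) = 2·f(x)` for at least `(1-ε)n` elements `x` of `ℤ/nℤ`. -/
theorem exists_perm_of_isSofic_higman (hsofic : IsSofic HigmanGroup) :
    ∀ ε : ℝ, 0 < ε → ∃ N : ℕ, ∀ n : ℕ, Odd n → n > N →
      ∃ f : Equiv.Perm (ZMod n), f ^ 4 = 1 ∧
        (1 - ε) * n ≤ (({x : ZMod n | f (x + 1) = 2 * f x}).ncard : ℝ) := by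
  intro ε hε
  exact HJ.main hsofic ε hε
end

section
/- For every ε > 0 and every integer k ≥ 3 there exists N ∈ ℕ such that for all coprime integers m and n with n > N and ln ln n < m < ln n, there exists a permutation f of ℤ/nℤ with f^k = id and f(x+1) = m·f(x) for at least (1−ε)n elements x ∈ ℤ/nℤ. -/
namespace HigmanPerm

/-- The underlying set of the finite lamplighter group `C_L ≀ C_L`. -/
abbrev W (L : ℕ) := (ZMod L → ZMod L) × ZMod L

/-- Powers of the lamp generator. -/
def sPow {L : ℕ} (u : ZMod L) (w : W L) : W L := (w.1 + Pi.single w.2 u, w.2)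

/-- Powers of the shift generator. -/
def muPow {L : ℕ} (u : ZMod L) (w : W L) : W L := (w.1, w.2 - u)

lemma sPow_sPow {L : ℕ} (u v : ZMod L) (w : W L) : sPow u (sPow v w) = sPow (u + v) w := by
  simp only [sPow, Pi.single_add, Prod.mk.injEq, and_true]; abel

lemma muPow_muPow {L : ℕ} (u v : ZMod L) (w : W L) : muPow u (muPow v w) = muPow (u + v) w := by
  simp only [muPow, Prod.mk.injEq, true_and]; ring

lemma sPow_zero {L : ℕ} (w : W L) : sPow 0 w = w := by simp [sPow]
lemma muPow_zero {L : ℕ} (w : W L) : muPow 0 w = w := by simp [muPow]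

lemma sPow_inj {L : ℕ} (u : ZMod L) : Function.Injective (sPow u) := by
  intro a b h
  have := congrArg (sPow (-u)) h
  simpa [sPow_sPow, sPow_zero] using this

lemma muPow_inj {L : ℕ} (u : ZMod L) : Function.Injective (muPow (L := L) u) := by
  intro a b h
  have := congrArg (muPow (-u)) h
  simpa [muPow_muPow, muPow_zero] using this

/-- The trivialisation map. -/
def tau {L k : ℕ} [NeZero L] (i : ZMod k) (q : ZMod k → W L) : ZMod k → W L := fun j =>
  if j = i then q j else if j = i + 1 then muPow (-(∑ l, (q i).1 l)) (q j)
  else if j = i - 1 then sPow (q i).2 (q j) else q j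

/-- The action of the `i`-th generator. -/
def act {L k : ℕ} (i : ZMod k) (q : ZMod k → W L) : ZMod k → W L := fun j =>
  if j = i then sPow 1 (q j) else if j = i + 1 then muPow 1 (q j) else q j

lemma tau_self {L k : ℕ} [NeZero L] (i : ZMod k) (q : ZMod k → W L) : tau i q i = q i := by
  simp [tau]

lemma tau_inj {L k : ℕ} [NeZero L] (i : ZMod k) :
    Function.Injective (tau (L := L) i) := by
  intro q q' h
  have hi : q i = q' i := by
    have := congrFun h i
    simpa [tau_self] using this
  funext j
  have hj := congrFun h j
  unfold tau at hj
  rw [hi] at hj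
  split_ifs at hj with h1 h2 h3
  · exact hj
  · exact muPow_inj _ hj
  · exact sPow_inj _ hj
  · exact hj

lemma zmod_ne {k : ℕ} (hk : 3 ≤ k) : (1 : ZMod k) ≠ 0 ∧ (2 : ZMod k) ≠ 0 := by
  constructor
  · have := (ZMod.natCast_eq_zero_iff 1 k).not.2 (fun h => by have := Nat.le_of_dvd (by norm_num) h; omega)
    simpa using this
  · have := (ZMod.natCast_eq_zero_iff 2 k).not.2 (fun h => by have := Nat.le_of_dvd (by norm_num) h; omega)
    simpa using this

lemma tau_act {L k : ℕ} [NeZero L] (hk : 3 ≤ k) (i : ZMod k) (q : ZMod k → W L) :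
    tau i (act i q) = Function.update (tau i q) i (sPow 1 (q i)) := by
  obtain ⟨h1, h2⟩ := zmod_ne hk
  have hs : ∑ l, (sPow 1 (q i)).1 l = ∑ l, (q i).1 l + 1 := by
    simp [sPow, Finset.sum_add_distrib]
  have hm : i - 1 ≠ i + 1 := fun h => h2 (by linear_combination -h)
  funext j
  by_cases hj : j = i
  · subst hj; simp [tau, act]
  · rw [Function.update_of_ne hj]
    by_cases hj1 : j = i + 1
    · subst hj1
      simp only [tau, act, hj, if_false, if_true, hs]
      rw [muPow_muPow]; congr 1; ring
    · by_cases hj2 : j = i - 1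
      · subst hj2
        simp [tau, act, hj, hj1, sPow, h1]
      · simp [tau, act, hj, hj1, hj2]

lemma tau_act' {L k : ℕ} [NeZero L] (hk : 3 ≤ k) (i : ZMod k) (q : ZMod k → W L) :
    tau (i + 1) (act i q) = Function.update (tau (i + 1) q) (i + 1) (muPow 1 (q (i + 1))) := by
  obtain ⟨h1, h2⟩ := zmod_ne hk
  have hm : i ≠ i + 1 + 1 := fun h => h2 (by linear_combination -h)
  funext j
  by_cases hj : j = i + 1
  · subst hj; simp [tau, act, h1]
  · rw [Function.update_of_ne hj]
    by_cases hj1 : j = i + 1 + 1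
    · subst hj1
      simp [tau, act, hj, h1, hm.symm, muPow]
    · by_cases hj2 : j = i
      · subst hj2
        simp only [tau, act, hj, hj1, if_false, if_true, add_sub_cancel_right, add_eq_left, h1]
        rw [sPow_sPow]; congr 1; simp [muPow]
      · simp [tau, act, hj, hj1, hj2]

/-- Index set for tiles. -/
abbrev Z (L k : ℕ) := {z : ZMod k × (ZMod k → W L) // z.2 z.1 = 0}

/-- The decomposition into tiles. -/
def theta {L k : ℕ} [NeZero L] (x : ZMod k × (ZMod k → W L)) : Z L k × W L :=
  (⟨(x.1, Function.update (tau x.1 x.2) x.1 0), by simp⟩, x.2 x.1)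

lemma theta_bij {L k : ℕ} [NeZero L] [NeZero k] : Function.Bijective (theta (L := L) (k := k)) := by
  constructor
  · rintro ⟨i, q⟩ ⟨i', q'⟩ h
    simp only [theta, Prod.mk.injEq, Subtype.mk.injEq] at h
    obtain ⟨⟨rfl, h2⟩, h3⟩ := h
    congr 1
    apply tau_inj i
    funext j
    by_cases hj : j = i
    · subst hj; simpa [tau_self] using h3
    · simpa [hj] using congrFun h2 j
  · rintro ⟨⟨⟨i, q⟩, hq⟩, w⟩
    obtain ⟨q0, h0⟩ := (Finite.injective_iff_surjective.1 (tau_inj (L := L) i)) (Function.update q i w)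
    have hw : q0 i = w := by rw [← tau_self i q0, h0]; simp
    refine ⟨(i, q0), ?_⟩
    simp only [theta, Prod.mk.injEq, Subtype.mk.injEq, true_and]
    refine ⟨?_, hw⟩
    rw [h0]
    simp only [Function.update_idem]
    rw [← hq]; simp

lemma theta_act {L k : ℕ} [NeZero L] (hk : 3 ≤ k) (i : ZMod k) (q : ZMod k → W L) :
    theta (i, act i q) = ((theta (i, q)).1, sPow 1 (q i)) := by
  simp only [theta, Prod.mk.injEq, Subtype.mk.injEq, true_and, tau_act hk, Function.update_idem]
  simp [act]

lemma theta_act' {L k : ℕ} [NeZero L] (hk : 3 ≤ k) (i : ZMod k) (q : ZMod k → W L) :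
    theta (i + 1, act i q) = ((theta (i + 1, q)).1, muPow 1 (q (i + 1))) := by
  obtain ⟨h1, h2⟩ := zmod_ne hk
  simp only [theta, Prod.mk.injEq, Subtype.mk.injEq, true_and, tau_act' hk, Function.update_idem]
  simp [act, h1]

lemma card_fiber {P : Type*} [Fintype P] {L : ℕ} [NeZero L] (h : P → ZMod L) (σ : P → P)
    (hσ : Function.Injective σ) (hh : ∀ x, h (σ x) = h x + 1) (v : ZMod L) :
    L * (Finset.univ.filter (fun x => h x = v)).card = Fintype.card P := by
  classical
  set g : ZMod L → ℕ := fun v => (Finset.univ.filter (fun x => h x = v)).card with hg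
  have h1 : ∀ v, g v ≤ g (v + 1) := by
    intro v
    apply Finset.card_le_card_of_injOn σ
    · intro x hx
      simp only [Finset.coe_filter, Finset.mem_univ, true_and, Set.mem_ofPred_eq] at hx ⊢
      rw [hh, hx]
    · exact hσ.injOn
  have h2 : ∀ v (j : ℕ), g v ≤ g (v + j) := by
    intro v j
    induction j with
    | zero => simp
    | succ j ih => push_cast; rw [← add_assoc]; exact ih.trans (h1 _)
  have h3 : ∀ v w, g v ≤ g w := by
    intro v w
    have := h2 v (w - v).val
    simpa using this
  have h4 : ∀ w, g w = g v := fun w => le_antisymm (h3 _ _) (h3 _ _)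
  have h5 : Fintype.card P = ∑ w, g w := by
    rw [← Finset.card_univ]
    exact Finset.card_eq_sum_card_fiberwise (fun x _ => by simp)
  rw [h5, Finset.sum_congr rfl (fun w _ => h4 w)]
  simp [hg]

theorem partA {L k n m : ℕ} [NeZero L] [NeZero n] (hL2 : 2 ≤ L) (hk : 3 ≤ k) {Y : Type*} [Fintype Y]
    (Φ : Y × W L → ZMod n) (hΦ : Function.Injective Φ)
    (hS : ∀ y w, w.1 w.2 ≠ -1 → Φ (y, sPow 1 w) = Φ (y, w) + 1)
    (hM : ∀ y w, w.2 ≠ 0 → Φ (y, muPow 1 w) = m * Φ (y, w)) :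
    ∃ f : Equiv.Perm (ZMod n), f ^ k = 1 ∧
      ((Fintype.card Y : ℝ) - Nat.card (Z L k)) * Nat.card (W L) * (1 - 2 / L) ≤
        (({x : ZMod n | f (x + 1) = (m : ZMod n) * f x}).ncard : ℝ) := by
  classical
  have : NeZero k := ⟨by omega⟩
  obtain ⟨h1, h2⟩ := zmod_ne hk
  set C := Fintype.card (Z L k) with hC
  have hCpos : 0 < C := Fintype.card_pos_iff.2 ⟨⟨(0, 0), rfl⟩⟩
  set B := Fintype.card Y / C with hB
  have hemb : Nonempty (Fin B × Z L k ↪ Y) := by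
    apply Function.Embedding.nonempty_of_card_le
    simp only [Fintype.card_prod, Fintype.card_fin]
    exact Nat.div_mul_le_self _ _
  obtain ⟨g⟩ := hemb
  let P := Fin B × ZMod k × (ZMod k → W L)
  let Ψ : P → ZMod n := fun x => Φ (g (x.1, (theta x.2).1), (theta x.2).2)
  have hΨ : Function.Injective Ψ := by
    rintro ⟨b, x⟩ ⟨b', x'⟩ h
    have := hΦ h
    simp only [Prod.mk.injEq, EmbeddingLike.apply_eq_iff_eq] at this
    obtain ⟨⟨rfl, h3⟩, h4⟩ := this
    rw [theta_bij.1 (Prod.ext h3 h4)]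
  let e : Equiv.Perm P :=
    (Equiv.refl _).prodCongr ((Equiv.addRight (1 : ZMod k)).prodCongr (Equiv.refl _))
  have he : ∀ b i q, e (b, i, q) = (b, i + 1, q) := fun b i q => rfl
  have hej : ∀ (j : ℕ) b i q, (e ^ j) (b, i, q) = (b, i + j, q) := by
    intro j
    induction j with
    | zero => simp
    | succ j ih =>
      intro b i q
      rw [pow_succ', Equiv.Perm.mul_apply, ih, he]; push_cast; rw [add_assoc]
  have hek : e ^ k = 1 := by
    ext1 ⟨b, i, q⟩
    rw [hej]; simp
  refine ⟨e.viaEmbedding ⟨Ψ, hΨ⟩, ?_, ?_⟩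
  · rw [← Equiv.Perm.viaEmbeddingHom_apply, ← map_pow, hek, map_one]
  set f := e.viaEmbedding ⟨Ψ, hΨ⟩ with hf
  have hfΨ : ∀ x, f (Ψ x) = Ψ (e x) := fun x => Equiv.Perm.viaEmbedding_apply e ⟨Ψ, hΨ⟩ x
  let b1 : P → ZMod L := fun x => (x.2.2 x.2.1).1 (x.2.2 x.2.1).2
  let b2 : P → ZMod L := fun x => (x.2.2 (x.2.1 + 1)).2
  let bad1 : Finset P := Finset.univ.filter (fun x => b1 x = -1)
  let bad2 : Finset P := Finset.univ.filter (fun x => b2 x = 0)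
  have hb1 : L * bad1.card = Fintype.card P := by
    apply card_fiber b1 (fun x => (x.1, x.2.1, act x.2.1 x.2.2))
    · rintro ⟨b, i, q⟩ ⟨b', i', q'⟩ h
      obtain ⟨hb, h'⟩ := Prod.mk.inj h
      obtain ⟨hi, hq⟩ := Prod.mk.inj h'
      dsimp only at hb hi hq
      subst hb hi
      refine Prod.ext rfl (Prod.ext rfl ?_)
      funext j
      have hj := congrFun hq j
      unfold act at hj
      split_ifs at hj
      · exact sPow_inj _ hj
      · exact muPow_inj _ hj
      · exact hj
    · rintro ⟨b, i, q⟩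
      simp [b1, act, sPow]
  have hb2 : L * bad2.card = Fintype.card P := by
    apply card_fiber b2 (fun x => (x.1, x.2.1, fun j => muPow (-1) (x.2.2 j)))
    · rintro ⟨b, i, q⟩ ⟨b', i', q'⟩ h
      obtain ⟨hb, h'⟩ := Prod.mk.inj h
      obtain ⟨hi, hq⟩ := Prod.mk.inj h'
      dsimp only at hb hi hq
      subst hb hi
      refine Prod.ext rfl (Prod.ext rfl ?_)
      funext j
      exact muPow_inj _ (congrFun hq j)
    · rintro ⟨b, i, q⟩
      simp [b2, muPow]
  have hgood : ∀ x : P, x ∉ bad1 → x ∉ bad2 → f (Ψ x + 1) = m * f (Ψ x) := by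
    rintro ⟨b, i, q⟩ hx1 hx2
    have hx1' : (q i).1 (q i).2 ≠ -1 := by simpa [bad1, b1] using hx1
    have hx2' : (q (i+1)).2 ≠ 0 := by simpa [bad2, b2] using hx2
    have e1 : Ψ (b, i, q) + 1 = Ψ (b, i, act i q) := by
      simp only [Ψ, theta_act hk]
      rw [hS _ _ hx1']; rfl
    have e2 : Ψ (b, i + 1, act i q) = m * Ψ (b, i + 1, q) := by
      simp only [Ψ, theta_act' hk]
      rw [hM _ _ hx2']; rfl
    rw [e1, hfΨ, hfΨ, he, he, e2]
  have hsub : Ψ '' (↑((Finset.univ \ (bad1 ∪ bad2) : Finset P)) : Set P) ⊆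
      {x : ZMod n | f (x + 1) = (m : ZMod n) * f x} := by
    rintro _ ⟨x, hx, rfl⟩
    simp only [Finset.coe_sdiff, Finset.coe_univ, Finset.coe_union, Set.mem_sdiff, Set.mem_univ,
      Set.mem_union, Finset.mem_coe, not_or, true_and] at hx
    exact hgood x hx.1 hx.2
  have hcard := Set.ncard_le_ncard hsub (Set.toFinite _)
  rw [Set.ncard_image_of_injective _ hΨ, Set.ncard_coe_finset] at hcard
  have hc2 : Fintype.card P ≤ (Finset.univ \ (bad1 ∪ bad2) : Finset P).card + bad1.card + bad2.card := by
    have := Finset.le_card_sdiff (bad1 ∪ bad2) (Finset.univ : Finset P)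
    have h3 := Finset.card_union_le bad1 bad2
    rw [Finset.card_univ] at this
    omega
  have hPcard : Fintype.card P = B * (C * Fintype.card (W L)) := by
    simp only [P]
    rw [Fintype.card_prod, Fintype.card_fin,
      Fintype.card_congr (Equiv.ofBijective _ (theta_bij (L := L) (k := k))), Fintype.card_prod]
  have hLpos : (0 : ℝ) < L := by exact_mod_cast NeZero.pos L
  have hdm : Fintype.card Y < B * C + C := by
    have := Nat.div_add_mod (Fintype.card Y) C
    have h5 := Nat.mod_lt (Fintype.card Y) hCpos
    rw [← hB] at this
    nlinarith
  have r1 : (bad1.card : ℝ) = Fintype.card P / L := by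
    rw [eq_div_iff hLpos.ne', ← hb1]; push_cast; ring
  have r2 : (bad2.card : ℝ) = Fintype.card P / L := by
    rw [eq_div_iff hLpos.ne', ← hb2]; push_cast; ring
  have r3 : (Fintype.card P : ℝ) * (1 - 2 / L) ≤
      (({x : ZMod n | f (x + 1) = (m : ZMod n) * f x}).ncard : ℝ) := by
    have a1 : (Fintype.card P : ℝ) ≤ (Finset.univ \ (bad1 ∪ bad2) : Finset P).card + bad1.card + bad2.card := by
      exact_mod_cast hc2
    have a2 : ((Finset.univ \ (bad1 ∪ bad2) : Finset P).card : ℝ) ≤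
      (({x : ZMod n | f (x + 1) = (m : ZMod n) * f x}).ncard : ℝ) := by exact_mod_cast hcard
    rw [r1, r2] at a1
    calc _ = (Fintype.card P : ℝ) - Fintype.card P / L - Fintype.card P / L := by ring
      _ ≤ _ := by linarith
  have hL : 0 ≤ 1 - 2 / (L : ℝ) := by
    have : (2 : ℝ) ≤ L := by exact_mod_cast hL2
    rw [sub_nonneg, div_le_one hLpos]; exact this
  refine le_trans ?_ r3
  apply mul_le_mul_of_nonneg_right _ hL
  rw [Nat.card_eq_fintype_card, Nat.card_eq_fintype_card, hPcard]
  have : (Fintype.card Y : ℝ) - C ≤ B * C := by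
    have : (Fintype.card Y : ℝ) < B * C + C := by exact_mod_cast hdm
    linarith
  push_cast
  rw [← mul_assoc]
  exact mul_le_mul_of_nonneg_right this (by positivity)

/-- The marker set. -/
def U (m n u : ℕ) (x : ZMod n) : Prop := m * x.val / n < u

/-- The base of the tower. -/
def E (m n u R L : ℕ) (x : ZMod n) : Prop :=
  ∃ t < R, t % L = L - 1 ∧ U m n u ((m : ZMod n) ^ t * x) ∧ ∀ j < t, ¬ U m n u ((m : ZMod n) ^ j * x)

lemma E_disj {m n u R L : ℕ} {x : ZMod n} {i : ℕ} (hi : 1 ≤ i) (hiL : i < L)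
    (h : E m n u R L x) : ¬ E m n u R L ((m : ZMod n) ^ i * x) := by
  rintro ⟨t', -, ht'L, hU', hm'⟩
  obtain ⟨t, -, htL, hU, hm⟩ := h
  rw [← mul_assoc, ← pow_add] at hU'
  have hge : L - 1 ≤ t := htL ▸ Nat.mod_le _ _
  have h1 : t ≤ t' + i := by
    by_contra hlt
    exact hm _ (by omega) hU'
  have h2 : t' ≤ t - i := by
    by_contra hlt
    apply hm' (t - i) (by omega)
    rw [← mul_assoc, ← pow_add]
    rwa [show t - i + i = t by omega]
  have h3 : t = t' + i := by omega
  have h4 := Nat.div_add_mod t' L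
  have h5 : t = i - 1 + L * (t' / L + 1) := by
    rw [mul_add]; omega
  rw [h5, Nat.add_mul_mod_self_left, Nat.mod_eq_of_lt (by omega)] at htL
  omega

lemma E_cover {m n u R L : ℕ} (hL : 0 < L) (x : ZMod n) :
    (∃ j < L, U m n u ((m : ZMod n) ^ j * x)) ∨ (∀ j < R, ¬ U m n u ((m : ZMod n) ^ j * x)) ∨
      ∃ p < L, E m n u R L ((m : ZMod n) ^ p * x) := by
  classical
  by_cases h : ∃ j, j < R ∧ U m n u ((m : ZMod n) ^ j * x)
  · have hs := Nat.find_spec h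
    have hmin : ∀ j < Nat.find h, ¬ (j < R ∧ U m n u ((m : ZMod n) ^ j * x)) :=
      fun j hj => Nat.find_min h hj
    set t := Nat.find h
    by_cases htL : t < L
    · exact Or.inl ⟨t, htL, hs.2⟩
    · right; right
      have hp : (t + 1) % L < L := Nat.mod_lt _ hL
      refine ⟨(t + 1) % L, hp, t - (t + 1) % L, by omega, ?_, ?_, ?_⟩
      · have h4 := Nat.div_add_mod (t + 1) L
        have h6 : 1 ≤ (t + 1) / L := (Nat.one_le_div_iff hL).2 (by omega)
        obtain ⟨a, ha⟩ := Nat.exists_eq_add_of_le h6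
        rw [ha, mul_add] at h4
        have h5 : t - (t + 1) % L = (L - 1) + L * a := by omega
        rw [h5, Nat.add_mul_mod_self_left, Nat.mod_eq_of_lt (by omega)]
      · rw [← mul_assoc, ← pow_add, show t - (t + 1) % L + (t + 1) % L = t by omega]
        exact hs.2
      · intro j hj
        rw [← mul_assoc, ← pow_add]
        intro hU
        exact hmin _ (by omega) ⟨by omega, hU⟩
  · push Not at h
    exact Or.inr (Or.inl h)

lemma U_iff {m n u : ℕ} [NeZero n] (hm : 0 < m) (j : ℕ) (x : ZMod n) :
    U m n u ((m : ZMod n) ^ j * x) ↔ (m ^ (j + 1) * x.val / n) % m < u := by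
  have hn : 0 < n := NeZero.pos n
  have h1 : ((m : ZMod n) ^ j * x).val = (m ^ j * x.val) % n := by
    have : (m : ZMod n) ^ j * x = ((m ^ j * x.val : ℕ) : ZMod n) := by
      push_cast; simp
    rw [this, ZMod.val_natCast]
  unfold U
  rw [h1]
  set A := m ^ j * x.val with hA
  have h2 : m ^ (j + 1) * x.val = m * (A % n) + n * (m * (A / n)) := by
    have := Nat.mod_add_div A n
    calc m ^ (j + 1) * x.val = m * A := by rw [hA]; ring
      _ = m * (A % n + n * (A / n)) := by rw [this]
      _ = _ := by ring
  rw [h2, Nat.add_mul_div_left _ _ hn, Nat.add_mul_mod_self_left,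
    Nat.mod_eq_of_lt (a := m * (A % n) / n)]
  rw [Nat.div_lt_iff_lt_mul hn]
  exact Nat.mul_lt_mul_of_pos_left (Nat.mod_lt _ hn) hm

lemma U_iff' {m n u R : ℕ} [NeZero n] (hm : 0 < m) {j : ℕ} (hj : j < R) (x : ZMod n) :
    U m n u ((m : ZMod n) ^ j * x) ↔ (m ^ R * x.val / n) / m ^ (R - 1 - j) % m < u := by
  rw [U_iff hm, Nat.div_div_eq_div_mul, mul_comm n, ← Nat.div_div_eq_div_mul]
  have : m ^ R * x.val = m ^ (R - 1 - j) * (m ^ (j + 1) * x.val) := by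
    rw [← mul_assoc, ← pow_add]; congr 2; omega
  rw [this, Nat.mul_div_cancel_left _ (by positivity)]

lemma E_congr {m n u R L : ℕ} [NeZero n] (hm : 0 < m) {x y : ZMod n}
    (h : m ^ R * x.val / n = m ^ R * y.val / n) (hx : E m n u R L x) : E m n u R L y := by
  obtain ⟨t, htR, htL, hU, hmin⟩ := hx
  refine ⟨t, htR, htL, ?_, ?_⟩
  · rw [U_iff' hm htR] at hU ⊢; rwa [← h]
  · intro j hj hU'
    refine hmin j hj ?_
    rw [U_iff' hm (hj.trans htR)] at hU' ⊢; rwa [h]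

open Classical in
lemma card_U {m n u : ℕ} [NeZero n] (hm : 0 < m) :
    (Finset.univ.filter (fun x : ZMod n => U m n u x)).card ≤ u * n / m + 1 := by
  rw [← Finset.card_range (u * n / m + 1)]
  apply Finset.card_le_card_of_injOn ZMod.val
  · intro x hx
    simp only [Finset.coe_filter, Finset.mem_univ, true_and, Set.mem_ofPred_eq] at hx
    unfold U at hx
    rw [Nat.div_lt_iff_lt_mul (NeZero.pos n)] at hx
    simp only [Finset.coe_range, Set.mem_Iio, Nat.lt_succ_iff]
    rw [Nat.le_div_iff_mul_le hm]
    nlinarith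
  · exact (ZMod.val_injective n).injOn

lemma mul_inj {m n : ℕ} (hmn : Nat.Coprime m n) (j : ℕ) :
    Function.Injective (fun x : ZMod n => (m : ZMod n) ^ j * x) := by
  have hu : IsUnit ((m : ZMod n) ^ j) := ((ZMod.isUnit_iff_coprime m n).2 hmn).pow j
  exact hu.mul_right_injective

open Classical in
lemma card_pre {m n : ℕ} [NeZero n] (hmn : Nat.Coprime m n) (L : ℕ) (A : ZMod n → Prop) :
    (Finset.univ.filter (fun x : ZMod n => ∃ j < L, A ((m : ZMod n) ^ j * x))).card ≤
      L * (Finset.univ.filter (fun x : ZMod n => A x)).card := by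
  have : (Finset.univ.filter (fun x : ZMod n => ∃ j < L, A ((m : ZMod n) ^ j * x))) ⊆
    (Finset.range L).biUnion (fun j => Finset.univ.filter (fun x => A ((m : ZMod n) ^ j * x))) := by
    intro x hx
    simpa using hx
  refine (Finset.card_le_card this).trans ?_
  refine (Finset.card_biUnion_le_card_mul _ _ (Finset.univ.filter (fun x : ZMod n => A x)).card ?_).trans ?_
  · intro j _
    apply Finset.card_le_card_of_injOn _ _ (mul_inj hmn j).injOn
    intro x hx
    simpa using hx
  · simp

lemma card_words (m R u : ℕ) :
    ((Finset.range (m ^ R)).filter (fun w => ∀ j < R, u ≤ w / m ^ j % m)).card ≤ (m - u) ^ R := by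
  have h1 : (Fintype.piFinset (fun _ : Fin R => Finset.univ.filter (fun d : Fin m => u ≤ d))).card
      ≤ (m - u) ^ R := by
    rw [Fintype.card_piFinset]
    simp only [Finset.prod_const, Finset.card_univ, Fintype.card_fin]
    apply Nat.pow_le_pow_left
    have : (Finset.univ.filter (fun d : Fin m => u ≤ d)).card ≤ (Finset.Ico u m).card := by
      apply Finset.card_le_card_of_injOn (fun d : Fin m => (d : ℕ))
      · intro d hd
        simp at hd ⊢
        exact hd
      · exact Fin.val_injective.injOn
    simpa using this
  refine le_trans ?_ h1
  have h2 : ((Finset.range (m ^ R)).filter (fun w => ∀ j < R, u ≤ w / m ^ j % m)) ⊆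
     (Fintype.piFinset (fun _ : Fin R => Finset.univ.filter (fun d : Fin m => u ≤ d))).image
       (fun f => (finFunctionFinEquiv f : ℕ)) := by
    intro w hw
    simp only [Finset.mem_filter, Finset.mem_range] at hw
    rw [Finset.mem_image]
    refine ⟨finFunctionFinEquiv.symm ⟨w, hw.1⟩, ?_, by simp⟩
    rw [Fintype.mem_piFinset]
    intro j
    simp [finFunctionFinEquiv, hw.2 j j.2, Equiv.ofRightInverseOfCardLE]
  exact (Finset.card_le_card h2).trans Finset.card_image_le

open Classical in
lemma card_noU {m n u R : ℕ} [NeZero n] (hm : 0 < m) :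
    (Finset.univ.filter (fun x : ZMod n => ∀ j < R, ¬ U m n u ((m : ZMod n) ^ j * x))).card ≤
      (n / m ^ R + 1) * (m - u) ^ R := by
  have hn : 0 < n := NeZero.pos n
  have hmR : 0 < m ^ R := by positivity
  refine le_trans ?_ (Nat.mul_le_mul_left _ (card_words m R u))
  apply Finset.card_le_mul_card_image_of_maps_to (f := fun x : ZMod n => m ^ R * x.val / n)
  · intro x hx
    simp only [Finset.mem_filter, Finset.mem_univ, true_and, Finset.mem_range] at hx ⊢
    refine ⟨?_, ?_⟩
    · rw [Nat.div_lt_iff_lt_mul hn]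
      exact Nat.mul_lt_mul_of_pos_left (ZMod.val_lt x) hmR
    · intro j hj
      have := hx (R - 1 - j) (by omega)
      rw [U_iff' (R := R) hm (by omega), not_lt] at this
      rwa [show R - 1 - (R - 1 - j) = j by omega] at this
  · intro w _
    set s := (w * n + m ^ R - 1) / m ^ R with hs
    have hs1 : w * n ≤ m ^ R * s := by
      have h1 := Nat.div_add_mod (w * n + m ^ R - 1) (m ^ R)
      have h2 := Nat.mod_lt (w * n + m ^ R - 1) hmR
      rw [← hs] at h1
      omega
    have : (Finset.Ico s (s + (n / m ^ R + 1))).card = n / m ^ R + 1 := by simp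
    rw [← this]
    apply Finset.card_le_card_of_injOn ZMod.val _ (ZMod.val_injective n).injOn
    intro x hx
    simp only [Finset.coe_filter, Finset.mem_filter, Finset.mem_univ, true_and, Set.mem_ofPred_eq] at hx
    have h3 := hx.2
    rw [Nat.div_eq_iff hn] at h3
    simp only [Finset.coe_Ico, Set.mem_Ico]
    have hsx : s ≤ x.val := by
      rw [hs, ← Nat.lt_succ_iff, Nat.div_lt_iff_lt_mul hmR]
      have : m ^ R * x.val + m ^ R = (x.val).succ * m ^ R := by rw [Nat.succ_eq_add_one]; ring
      have := h3.1
      omega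
    refine ⟨hsx, ?_⟩
    have : x.val - s ≤ n / m ^ R := by
      rw [Nat.le_div_iff_mul_le hmR, Nat.sub_mul]
      have h5 := h3.2
      rw [mul_comm s, mul_comm x.val]
      have : w * n + n - 1 < w * n + n := by omega
      omega
    omega

open Classical in
/-- Good blocks. -/
noncomputable def Bset (m n u R L : ℕ) : Finset ℕ :=
  (Finset.range n).filter (fun b => m ^ L * b + m ^ L ≤ n ∧
    m ^ R * (m ^ L * b) / n = m ^ R * (m ^ L * b + (m ^ L - 1)) / n ∧
    E m n u R L ((m ^ L * b : ℕ) : ZMod n))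

lemma Bset_spec {m n u R L b r : ℕ} [NeZero n] (hm : 0 < m) (hb : b ∈ Bset m n u R L)
    (hr : r < m ^ L) : m ^ L * b + r < n ∧ E m n u R L ((m ^ L * b + r : ℕ) : ZMod n) := by
  classical
  simp only [Bset, Finset.mem_filter, Finset.mem_range] at hb
  obtain ⟨-, h1, h2, h3⟩ := hb
  refine ⟨by omega, ?_⟩
  refine E_congr hm ?_ h3
  rw [ZMod.val_natCast_of_lt (by omega), ZMod.val_natCast_of_lt (by omega)]
  apply le_antisymm
  · apply Nat.div_le_div_right; apply Nat.mul_le_mul_left; omega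
  · rw [h2]; apply Nat.div_le_div_right; apply Nat.mul_le_mul_left; omega

open Classical in
lemma card_E {m n u R L : ℕ} [NeZero n] (hm : 0 < m) :
    (Finset.univ.filter (fun x : ZMod n => E m n u R L x)).card ≤
      m ^ L * ((Bset m n u R L).card + (m ^ R + 1)) := by
  have hn : 0 < n := NeZero.pos n
  have hmR : 0 < m ^ R := by positivity
  have hmL : 0 < m ^ L := by positivity
  set w : ℕ → ℕ := fun z => m ^ R * z / n with hw
  have wmono : ∀ a b, a ≤ b → w a ≤ w b := fun a b h =>
    Nat.div_le_div_right (Nat.mul_le_mul_left _ h)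
  set Bad : Finset ℕ := (Finset.range n).filter (fun b => m ^ L * b + m ^ L ≤ n ∧
    w (m ^ L * b) < w (m ^ L * b + (m ^ L - 1))) with hBad
  have hBadc : Bad.card ≤ m ^ R := by
    rw [← Finset.card_range (m ^ R)]
    apply Finset.card_le_card_of_injOn (fun b => w (m ^ L * b))
    · intro b hb
      simp only [hBad, Finset.coe_filter, Finset.mem_range, Set.mem_ofPred_eq] at hb
      simp only [Finset.coe_range, Set.mem_Iio, hw]
      rw [Nat.div_lt_iff_lt_mul hn]
      exact Nat.mul_lt_mul_of_pos_left (by omega) hmR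
    · have key : ∀ b ∈ Bad, ∀ b', b < b' → w (m ^ L * b) < w (m ^ L * b') := by
        intro b hb b' hbb
        simp only [hBad, Finset.mem_filter] at hb
        refine hb.2.2.trans_le (wmono _ _ ?_)
        have : m ^ L * (b + 1) ≤ m ^ L * b' := Nat.mul_le_mul_left _ hbb
        rw [mul_add] at this
        omega
      intro b hb b' hb' h
      rcases lt_trichotomy b b' with h1 | h1 | h1
      · exact absurd h (key b hb b' h1).ne
      · exact h1
      · exact absurd h (key b' hb' b h1).ne'
  have hTc : (Bset m n u R L ∪ (Bad ∪ {n / m ^ L})).card ≤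
      (Bset m n u R L).card + (m ^ R + 1) := by
    refine (Finset.card_union_le _ _).trans (Nat.add_le_add_left ?_ _)
    refine (Finset.card_union_le _ _).trans ?_
    simpa using hBadc
  refine le_trans ?_ (Nat.mul_le_mul_left _ hTc)
  apply Finset.card_le_mul_card_image_of_maps_to (f := fun x : ZMod n => x.val / m ^ L)
  · intro x hx
    simp only [Finset.mem_filter, Finset.mem_univ, true_and] at hx
    have hxn := ZMod.val_lt x
    have h1 := Nat.mul_div_le x.val (m ^ L)
    have h2 := Nat.lt_mul_div_succ x.val hmL
    rw [mul_add, mul_one] at h2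
    simp only [Finset.mem_union, Finset.mem_singleton]
    set b := x.val / m ^ L with hb
    have hbn : b < n := (Nat.div_le_self _ _).trans_lt hxn
    by_cases hc : m ^ L * b + m ^ L ≤ n
    · by_cases hd : w (m ^ L * b) < w (m ^ L * b + (m ^ L - 1))
      · right; left
        simp [hBad, hbn, hc, hd]
      · left
        have he : w (m ^ L * b) = w (m ^ L * b + (m ^ L - 1)) :=
          le_antisymm (wmono _ _ (by omega)) (not_lt.1 hd)
        simp only [Bset, Finset.mem_filter, Finset.mem_range]
        refine ⟨hbn, hc, he, E_congr hm ?_ hx⟩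
        rw [ZMod.val_natCast_of_lt (by omega)]
        exact le_antisymm ((wmono _ _ (by omega)).trans he.ge) (wmono _ _ (by omega))
    · right; right
      symm
      rw [Nat.div_eq_iff hmL]
      rw [mul_comm b]
      omega
  · intro b _
    have : (Finset.Ico (m ^ L * b) (m ^ L * b + m ^ L)).card = m ^ L := by simp
    conv_rhs => rw [← this]
    apply Finset.card_le_card_of_injOn ZMod.val _ (ZMod.val_injective n).injOn
    intro x hx
    simp only [Finset.coe_filter, Finset.mem_filter, Finset.mem_univ, true_and, Set.mem_ofPred_eq] at hx
    have h1 := Nat.mul_div_le x.val (m ^ L)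
    have h2 := Nat.lt_mul_div_succ x.val hmL
    rw [mul_add, mul_one] at h2
    rw [hx.2] at h1 h2
    simp only [Finset.coe_Ico, Set.mem_Ico]
    omega

lemma card_main {m n u R L : ℕ} [NeZero n] (hm : 0 < m) (hL : 0 < L) (hmn : Nat.Coprime m n) :
    n ≤ L * (u * n / m + 1) + (n / m ^ R + 1) * (m - u) ^ R +
      L * (m ^ L * ((Bset m n u R L).card + (m ^ R + 1))) := by
  classical
  have h0 : (Finset.univ : Finset (ZMod n)) ⊆
      (Finset.univ.filter (fun x : ZMod n => ∃ j < L, U m n u ((m : ZMod n) ^ j * x))) ∪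
      ((Finset.univ.filter (fun x : ZMod n => ∀ j < R, ¬ U m n u ((m : ZMod n) ^ j * x))) ∪
      (Finset.univ.filter (fun x : ZMod n => ∃ j < L, E m n u R L ((m : ZMod n) ^ j * x)))) := by
    intro x _
    have := E_cover (m := m) (u := u) (R := R) hL x
    simpa using this
  have h1 := Finset.card_le_card h0
  rw [Finset.card_univ, ZMod.card] at h1
  have h2 := Finset.card_union_le (Finset.univ.filter (fun x : ZMod n => ∃ j < L, U m n u ((m : ZMod n) ^ j * x)))
     ((Finset.univ.filter (fun x : ZMod n => ∀ j < R, ¬ U m n u ((m : ZMod n) ^ j * x))) ∪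
      (Finset.univ.filter (fun x : ZMod n => ∃ j < L, E m n u R L ((m : ZMod n) ^ j * x))))
  have h3 := Finset.card_union_le
     (Finset.univ.filter (fun x : ZMod n => ∀ j < R, ¬ U m n u ((m : ZMod n) ^ j * x)))
      (Finset.univ.filter (fun x : ZMod n => ∃ j < L, E m n u R L ((m : ZMod n) ^ j * x)))
  have h4 := (card_pre hmn L (U m n u)).trans (Nat.mul_le_mul_left _ (card_U hm))
  have h5 := (card_pre hmn L (E m n u R L)).trans (Nat.mul_le_mul_left _ (card_E hm))
  have h6 := card_noU (n := n) (u := u) (R := R) hm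
  omega

/-- Residue inside a block. -/
def res {L : ℕ} (m : ℕ) (e : ZMod L → Fin (m / L)) (c : ZMod L → ZMod L) : ℕ :=
  ∑ j : Fin L, (L * (e ((j : ℕ) : ZMod L) : ℕ) + (c ((j : ℕ) : ZMod L)).val) * m ^ (j : ℕ)

lemma dig_lt {L m : ℕ} [NeZero L] (e : Fin (m / L)) (c : ZMod L) : L * (e : ℕ) + c.val < m := by
  have h1 := c.val_lt
  have h2 : L * ((e : ℕ) + 1) ≤ L * (m / L) := Nat.mul_le_mul_left _ e.2
  have h3 := Nat.mul_div_le m L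
  rw [mul_add] at h2
  omega

lemma res_eq {L m : ℕ} [NeZero L] (e : ZMod L → Fin (m / L)) (c : ZMod L → ZMod L) :
    res m e c = (finFunctionFinEquiv (fun j : Fin L =>
      (⟨L * (e ((j : ℕ) : ZMod L) : ℕ) + (c ((j : ℕ) : ZMod L)).val, dig_lt _ _⟩ : Fin m)) : ℕ) := by
  rw [finFunctionFinEquiv_apply]; rfl

lemma res_lt {L m : ℕ} [NeZero L] (e : ZMod L → Fin (m / L)) (c : ZMod L → ZMod L) :
    res m e c < m ^ L := by
  rw [res_eq]; exact Fin.is_lt _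

lemma res_inj {L m : ℕ} [NeZero L] {e e' : ZMod L → Fin (m / L)} {c c' : ZMod L → ZMod L}
    (h : res m e c = res m e' c') : e = e' ∧ c = c' := by
  rw [res_eq, res_eq] at h
  have h1 := finFunctionFinEquiv.injective (Fin.val_injective h)
  have h2 : ∀ j : ZMod L, L * (e j : ℕ) + (c j).val = L * (e' j : ℕ) + (c' j).val := by
    intro j
    have := congrFun h1 ⟨j.val, j.val_lt⟩
    simpa using this
  have hL := NeZero.pos L
  constructor
  · funext j
    have := congrArg (fun a => a / L) (h2 j)
    simp only [Nat.mul_add_div hL, Nat.div_eq_of_lt (ZMod.val_lt _), add_zero] at this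
    exact Fin.ext this
  · funext j
    have := congrArg (fun a => a % L) (h2 j)
    simp only [Nat.mul_add_mod, Nat.mod_eq_of_lt (ZMod.val_lt _)] at this
    exact ZMod.val_injective L this

lemma val_succ {L : ℕ} [NeZero L] {a : ZMod L} (h : a ≠ -1) : (a + 1).val = a.val + 1 := by
  have h1 := a.val_lt
  have h2 : a.val + 1 ≠ L := by
    intro h3
    apply h
    have h4 : ((a.val + 1 : ℕ) : ZMod L) = 0 := by rw [h3]; exact ZMod.natCast_self _
    push_cast at h4
    rw [ZMod.natCast_zmod_val] at h4
    linear_combination h4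
  have h5 : a + 1 = ((a.val + 1 : ℕ) : ZMod L) := by push_cast; rw [ZMod.natCast_zmod_val]
  rw [h5, ZMod.val_natCast_of_lt (by omega)]

lemma res_sPow {L m : ℕ} [NeZero L] (e : ZMod L → Fin (m / L)) (c : ZMod L → ZMod L) (p : ZMod L)
    (h : c p ≠ -1) : res m e (c + Pi.single p 1) = res m e c + m ^ p.val := by
  unfold res
  have h1 : m ^ p.val = ∑ j : Fin L, if j = ⟨p.val, p.val_lt⟩ then m ^ (j : ℕ) else 0 := by simp
  rw [h1, ← Finset.sum_add_distrib]
  apply Finset.sum_congr rfl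
  intro j _
  by_cases hj : j = ⟨p.val, p.val_lt⟩
  · subst hj
    simp only [ZMod.natCast_val, ZMod.cast_id', id_eq, Pi.add_apply, Pi.single_eq_same, if_true]
    rw [val_succ h]; ring
  · have : ((j : ℕ) : ZMod L) ≠ p := by
      intro h2
      apply hj
      rw [Fin.ext_iff]
      simp only
      rw [← h2, ZMod.val_natCast_of_lt j.2]
    simp [this, hj]

/-- The tiling map. -/
noncomputable def Phi {L : ℕ} (m n u R : ℕ)
    (x : (Bset m n u R L × (ZMod L → Fin (m / L))) × W L) : ZMod n :=
  ((m : ZMod n)⁻¹) ^ x.2.2.val * ((m ^ L * (x.1.1 : ℕ) + res m x.1.2 x.2.1 : ℕ) : ZMod n)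

lemma Phi_inj_aux {m n u R L : ℕ} (hmn : Nat.Coprime m n)
    {z z' : ZMod n} (hz : E m n u R L z) (hz' : E m n u R L z') {p p' : ℕ} (hp' : p' < L)
    (hpp : p ≤ p')
    (h : ((m : ZMod n)⁻¹) ^ p * z = ((m : ZMod n)⁻¹) ^ p' * z') : p = p' ∧ z = z' := by
  have hmi : (m : ZMod n) * (m : ZMod n)⁻¹ = 1 := ZMod.coe_mul_inv_eq_one m hmn
  obtain ⟨i, rfl⟩ := Nat.exists_eq_add_of_le hpp
  have h1 : (m : ZMod n) ^ i * z = z' := by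
    have := congrArg (fun y => (m : ZMod n) ^ (p + i) * y) h
    rw [← mul_assoc, ← mul_assoc, ← mul_pow, hmi, one_pow, one_mul, add_comm, pow_add,
      mul_assoc ((m : ZMod n) ^ i), ← mul_pow, hmi, one_pow, mul_one] at this
    exact this
  rcases Nat.eq_zero_or_pos i with rfl | hi
  · simpa using h1
  · exfalso
    rw [← h1] at hz'
    exact E_disj hi (by omega) hz hz'

lemma Phi_inj {m n u R L : ℕ} [NeZero L] [NeZero n] (hm : 0 < m) (hmn : Nat.Coprime m n) :
    Function.Injective (Phi (L := L) m n u R) := by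
  rintro ⟨⟨⟨b, hb⟩, e⟩, c, p⟩ ⟨⟨⟨b', hb'⟩, e'⟩, c', p'⟩ h
  obtain ⟨hz1, hz2⟩ := Bset_spec hm hb (res_lt e c)
  obtain ⟨hz1', hz2'⟩ := Bset_spec hm hb' (res_lt e' c')
  simp only [Phi] at h
  have key : p.val = p'.val ∧ ((m ^ L * b + res m e c : ℕ) : ZMod n) =
      ((m ^ L * b' + res m e' c' : ℕ) : ZMod n) := by
    rcases le_total p.val p'.val with hle | hle
    · exact Phi_inj_aux hmn hz2 hz2' p'.val_lt hle h
    · obtain ⟨h1, h2⟩ := Phi_inj_aux hmn hz2' hz2 p.val_lt hle h.symm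
      exact ⟨h1.symm, h2.symm⟩
  obtain ⟨h1, h2⟩ := key
  have hp : p = p' := ZMod.val_injective L h1
  have h3 := congrArg ZMod.val h2
  rw [ZMod.val_natCast_of_lt hz1, ZMod.val_natCast_of_lt hz1'] at h3
  have hmL : 0 < m ^ L := by positivity
  have h4 := congrArg (fun a => a / m ^ L) h3
  have h5 := congrArg (fun a => a % m ^ L) h3
  simp only [Nat.mul_add_div hmL, Nat.div_eq_of_lt (res_lt _ _), add_zero] at h4
  simp only [Nat.mul_add_mod, Nat.mod_eq_of_lt (res_lt _ _)] at h5
  obtain ⟨h6, h7⟩ := res_inj h5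
  subst hp h4 h6 h7
  rfl

theorem partB {L k n m u R : ℕ} [NeZero L] [NeZero n] (hL2 : 2 ≤ L) (hk : 3 ≤ k) (hm : 0 < m)
    (hmn : Nat.Coprime m n) :
    ∃ f : Equiv.Perm (ZMod n), f ^ k = 1 ∧
      (((Bset m n u R L).card * (m / L : ℕ) ^ L : ℝ) - Nat.card (Z L k)) * Nat.card (W L) * (1 - 2 / L) ≤
        (({x : ZMod n | f (x + 1) = (m : ZMod n) * f x}).ncard : ℝ) := by
  have hmi : (m : ZMod n) * (m : ZMod n)⁻¹ = 1 := ZMod.coe_mul_inv_eq_one m hmn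
  have := partA (L := L) (k := k) (n := n) (m := m) hL2 hk (Phi (L := L) m n u R) (Phi_inj hm hmn)
    ?_ ?_
  · simpa [ZMod.card] using this
  · rintro ⟨b, e⟩ ⟨c, p⟩ h
    simp only [Phi, sPow] at h ⊢
    rw [res_sPow _ _ _ h, ← add_assoc, Nat.cast_add _ (m ^ p.val), mul_add]
    push_cast
    rw [← mul_pow, mul_comm (m : ZMod n)⁻¹, hmi, one_pow]
  · rintro ⟨b, e⟩ ⟨c, p⟩ h
    simp only [Phi, muPow] at h ⊢
    have h1 : p.val = (p - 1).val + 1 := by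
      rw [← val_succ (a := p - 1), sub_add_cancel]
      intro h2
      exact h (by linear_combination h2)
    rw [h1, pow_succ']
    rw [← mul_assoc, ← mul_assoc, hmi, one_mul]

lemma asymp (M0 : ℝ) (A : ℕ) (c : ℝ) (hc : 0 < c) : ∃ N : ℕ, ∀ m n : ℕ, n > N →
    Real.log (Real.log n) < m → (m : ℝ) < Real.log n →
    M0 ≤ m ∧ (m : ℝ) ^ A ≤ c * n ∧ M0 ≤ n := by
  have h1 : ∀ᶠ x : ℝ in Filter.atTop, M0 ≤ Real.log (Real.log x) :=
    (Real.tendsto_log_atTop.comp Real.tendsto_log_atTop).eventually_ge_atTop M0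
  have h2 : ∀ᶠ x : ℝ in Filter.atTop, ‖Real.log x ^ A‖ ≤ c * ‖id x‖ :=
    (Real.isLittleO_pow_log_id_atTop (n := A)).bound hc
  have h3 : ∀ᶠ x : ℝ in Filter.atTop, M0 ≤ x := Filter.eventually_ge_atTop M0
  have h4 := tendsto_natCast_atTop_atTop (R := ℝ) |>.eventually (h1.and (h2.and h3))
  obtain ⟨N, hN⟩ := Filter.eventually_atTop.1 h4
  refine ⟨N, fun m n hn ha hb => ?_⟩
  obtain ⟨e1, e2, e3⟩ := hN n hn.le
  refine ⟨e1.trans ha.le, ?_, e3⟩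
  have : (m : ℝ) ^ A ≤ Real.log n ^ A := pow_le_pow_left₀ (by positivity) hb.le A
  refine this.trans ((le_abs_self _).trans ?_)
  simpa using e2

set_option maxHeartbeats 1000000 in
/-- The final real estimate. -/
lemma final_est {L K R m n u B : ℕ} {δ CW : ℝ} (hδ : 0 < δ) (hδ1 : δ ≤ 1 / 10)
    (hL : 2 ≤ L) (hLδ : 1 ≤ δ * L) (hK : K = L ^ 2) (hu : u = m / K + 1)
    (hR : 2 * (1 - 1 / (K : ℝ)) ^ R ≤ δ)
    (hm : (L : ℝ) ^ 2 ≤ δ * m) (hn1 : (L : ℝ) ≤ δ * n) (hn2 : CW ≤ δ * n)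
    (hmn : 2 * L * (m : ℝ) ^ (R + L) ≤ δ * n)
    (hmain : n ≤ L * (u * n / m + 1) + (n / m ^ R + 1) * (m - u) ^ R +
      L * (m ^ L * (B + (m ^ R + 1)))) :
    (1 - 9 * δ) * n ≤ ((B : ℝ) * (m / L : ℕ) ^ L * (L ^ L * L) - CW) * (1 - 2 / L) := by
  have hLr : (2 : ℝ) ≤ L := by exact_mod_cast hL
  have hL0 : (0 : ℝ) < L := by linarith
  have hm0 : (0 : ℝ) < m := by
    by_contra h
    have : (m : ℝ) ≤ 0 := not_lt.1 h
    nlinarith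
  have hmge : (40 : ℝ) ≤ m := by nlinarith
  have hmn0 : 40 ≤ m := by exact_mod_cast hmge
  have hn0 : (0 : ℝ) < n := by
    by_contra h
    have : (n : ℝ) ≤ 0 := not_lt.1 h
    nlinarith
  have hKr : (K : ℝ) = L ^ 2 := by rw [hK]; push_cast; rfl
  have hK4 : 4 ≤ K := by rw [hK]; nlinarith
  have hK0 : (0 : ℝ) < K := by rw [hKr]; positivity
  have hmR1 : (1 : ℝ) ≤ (m : ℝ) ^ R := one_le_pow₀ (by linarith)
  have hmL1 : (1 : ℝ) ≤ (m : ℝ) ^ L := one_le_pow₀ (by linarith)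
  -- u bounds
  have hu1 : (u : ℝ) ≤ m / K + 1 := by
    rw [hu]; push_cast
    have := Nat.cast_div_le (α := ℝ) (m := m) (n := K)
    linarith
  have hu2 : (m : ℝ) / K ≤ u := by
    rw [div_le_iff₀ hK0]
    have := Nat.lt_mul_div_succ m (show 0 < K by omega)
    rw [hu]
    have h' : (m : ℝ) < K * ((m / K : ℕ) + 1) := by exact_mod_cast this
    push_cast
    linarith
  have hum : u ≤ m := by
    have : m / K ≤ m / 4 := Nat.div_le_div_left hK4 (by norm_num)
    omega
  -- term 1
  have t1 : ((L * (u * n / m + 1) : ℕ) : ℝ) ≤ 3 * δ * n := by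
    push_cast
    have a1 : ((u * n / m : ℕ) : ℝ) ≤ u * n / m := by
      have := Nat.cast_div_le (α := ℝ) (m := u * n) (n := m)
      push_cast at this; exact this
    have a2 : (u : ℝ) * n / m ≤ n / K + n / m := by
      rw [div_le_iff₀ hm0]
      calc (u : ℝ) * n ≤ (m / K + 1) * n := by gcongr
        _ = _ := by field_simp
    have a3 : (L : ℝ) * (n / K) ≤ δ * n := by
      rw [hKr]
      have : (L : ℝ) * (n / L ^ 2) = n / L := by field_simp
      rw [this, div_le_iff₀ hL0]
      nlinarith
    have a4 : (L : ℝ) * (n / m) ≤ δ * n := by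
      rw [← mul_div_assoc, div_le_iff₀ hm0]
      have : (L : ℝ) ≤ δ * m := by nlinarith
      calc (L : ℝ) * n ≤ (δ * m) * n := by gcongr
        _ = _ := by ring
    calc (L : ℝ) * ((u * n / m : ℕ) + 1) ≤ L * (n / K + n / m + 1) := by gcongr; linarith
      _ = L * (n / K) + L * (n / m) + L := by ring
      _ ≤ _ := by linarith
  -- term 2
  have hmRn : (m : ℝ) ^ R ≤ n := by
    have h1 : (m : ℝ) ^ R ≤ (m : ℝ) ^ (R + L) := pow_le_pow_right₀ (by linarith) (by omega)
    have h2 : 1 * (m : ℝ) ^ (R + L) ≤ 2 * L * (m : ℝ) ^ (R + L) := by gcongr; linarith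
    have h3 : δ * n ≤ 1 * n := by gcongr; linarith
    linarith
  have t2 : (((n / m ^ R + 1) * (m - u) ^ R : ℕ) : ℝ) ≤ δ * n := by
    push_cast [Nat.cast_sub hum]
    have a1 : ((n / m ^ R : ℕ) : ℝ) ≤ n / m ^ R := by
      have := Nat.cast_div_le (α := ℝ) (m := n) (n := m ^ R)
      push_cast at this; exact this
    have a2 : (m : ℝ) - u ≤ m * (1 - 1 / K) := by
      have : (m : ℝ) * (1 - 1 / K) = m - m / K := by ring
      linarith
    have a3 : (0 : ℝ) ≤ m - u := sub_nonneg.2 (by exact_mod_cast hum)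
    have a4 : ((m : ℝ) - u) ^ R ≤ m ^ R * (1 - 1 / K) ^ R := by
      rw [← mul_pow]; exact pow_le_pow_left₀ a3 a2 R
    have a5 : (n : ℝ) / m ^ R + 1 ≤ 2 * n / m ^ R := by
      rw [le_div_iff₀ (by positivity), add_mul, div_mul_cancel₀ _ (by positivity)]
      linarith
    calc (((n / m ^ R : ℕ) : ℝ) + 1) * (m - u) ^ R ≤ (2 * n / m ^ R) * (m ^ R * (1 - 1 / K) ^ R) := by
          apply mul_le_mul _ a4 (by positivity) (by positivity)
          linarith
      _ = (2 * (1 - 1 / (K : ℝ)) ^ R) * n := by field_simp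
      _ ≤ _ := by gcongr
  -- term 3
  have t3 : (L : ℝ) * (m ^ L * (m ^ R + 1)) ≤ δ * n := by
    refine le_trans ?_ hmn
    rw [pow_add]
    calc (L : ℝ) * (m ^ L * (m ^ R + 1)) ≤ L * (m ^ L * (2 * m ^ R)) := by gcongr; linarith
      _ = _ := by ring
  have hX : (1 - 5 * δ) * n ≤ L * B * (m : ℝ) ^ L := by
    have h : (n : ℝ) ≤ ((L * (u * n / m + 1) : ℕ) : ℝ) + (((n / m ^ R + 1) * (m - u) ^ R : ℕ) : ℝ) +
      L * (m ^ L * (B + (m ^ R + 1))) := by exact_mod_cast hmain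
    have : (L : ℝ) * (m ^ L * (B + (m ^ R + 1))) = L * B * m ^ L + L * (m ^ L * (m ^ R + 1)) := by ring
    linarith
  -- floor
  have hfl : (1 - δ) * (m : ℝ) ^ L ≤ ((m / L : ℕ) : ℝ) ^ L * L ^ L := by
    rw [← mul_pow]
    have b1 : (m : ℝ) * (1 + -(L / m)) ≤ (m / L : ℕ) * L := by
      have := Nat.lt_mul_div_succ m (show 0 < L by omega)
      have h' : (m : ℝ) < L * ((m / L : ℕ) + 1) := by exact_mod_cast this
      have : (m : ℝ) * (1 + -(L / m)) = m - L := by field_simp; ring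
      rw [this]; linarith
    have hLm : (L : ℝ) / m ≤ 1 := by
      rw [div_le_one hm0]; nlinarith
    have b2 := one_add_mul_le_pow (a := -((L : ℝ) / m)) (by linarith) L
    have b3 : (L : ℝ) * (L / m) ≤ δ := by
      rw [← mul_div_assoc, div_le_iff₀ hm0]; nlinarith
    calc (1 - δ) * (m : ℝ) ^ L ≤ (1 + -(L / m)) ^ L * (m : ℝ) ^ L := by
          gcongr; linarith
      _ = ((m : ℝ) * (1 + -(L / m))) ^ L := by rw [mul_pow]; ring
      _ ≤ _ := by
          apply pow_le_pow_left₀ _ b1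
          apply mul_nonneg hm0.le; linarith
  have hY : (1 - 6 * δ) * n ≤ (B : ℝ) * (m / L : ℕ) ^ L * (L ^ L * L) := by
    calc (1 - 6 * δ) * n ≤ (1 - δ) * ((1 - 5 * δ) * n) := by nlinarith [mul_pos (mul_pos hδ hδ) hn0]
      _ ≤ (1 - δ) * (L * B * (m : ℝ) ^ L) := by
          apply mul_le_mul_of_nonneg_left hX; linarith
      _ = L * B * ((1 - δ) * (m : ℝ) ^ L) := by ring
      _ ≤ L * B * (((m / L : ℕ) : ℝ) ^ L * L ^ L) := by gcongr
      _ = _ := by ring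
  have h2L : 2 / (L : ℝ) ≤ 2 * δ := by
    rw [div_le_iff₀ hL0]; linarith
  calc (1 - 9 * δ) * n ≤ ((1 - 7 * δ) * n) * (1 - 2 * δ) := by nlinarith [mul_pos (mul_pos hδ hδ) hn0]
    _ ≤ ((B : ℝ) * (m / L : ℕ) ^ L * (L ^ L * L) - CW) * (1 - 2 / L) := by
      apply mul_le_mul _ _ (by linarith) _
      · linarith
      · linarith
      · have : 0 ≤ (1 - 7 * δ) * (n : ℝ) := mul_nonneg (by linarith) hn0.le
        linarith

end HigmanPerm

/-- **Theorem.** For all `ε > 0` and `k ≥ 3`, there is `N` such that for all coprime `m`, `n`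
with `n > N` and `ln ln n < m < ln n`, there is a permutation `f` of `ℤ/nℤ` of order dividing
`k` with `f(x+1) = m·f(x)` for at least `(1-ε)n` elements `x ∈ ℤ/nℤ`. -/
theorem exists_perm_conjugating_shift_to_mul (ε : ℝ) (hε : 0 < ε) (k : ℕ) (hk : 3 ≤ k) :
    ∃ N : ℕ, ∀ m n : ℕ, Nat.Coprime m n → n > N →
      Real.log (Real.log n) < m → (m : ℝ) < Real.log n →
      ∃ f : Equiv.Perm (ZMod n), f ^ k = 1 ∧
        (1 - ε) * n ≤ (({x : ZMod n | f (x + 1) = (m : ZMod n) * f x}).ncard : ℝ) := by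
  obtain ⟨δ, hδ, hδ1, hδε⟩ : ∃ δ : ℝ, 0 < δ ∧ δ ≤ 1 / 10 ∧ 9 * δ ≤ ε :=
    ⟨min (1 / 10) (ε / 9), by positivity, min_le_left _ _, by
      have := min_le_right (1 / 10) (ε / 9); linarith⟩
  obtain ⟨L, hLgt⟩ := exists_nat_gt (1 / δ)
  have hLδ : 1 ≤ δ * L := by
    rw [div_lt_iff₀ hδ] at hLgt; linarith
  have hL : 2 ≤ L := by
    have : (2 : ℝ) ≤ L := by nlinarith
    exact_mod_cast this
  have hLr : (2 : ℝ) ≤ L := by exact_mod_cast hL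
  have : NeZero L := ⟨by omega⟩
  obtain ⟨R, hR⟩ : ∃ R : ℕ, (1 - 1 / ((L ^ 2 : ℕ) : ℝ)) ^ R < δ / 2 := by
    apply exists_pow_lt_of_lt_one (by positivity)
    have : (0 : ℝ) < 1 / ((L ^ 2 : ℕ) : ℝ) := by
      push_cast; positivity
    linarith
  set CW : ℝ := Nat.card (HigmanPerm.Z L k) * Nat.card (HigmanPerm.W L) with hCW
  have hCW0 : 0 ≤ CW := by positivity
  obtain ⟨N, hN⟩ := HigmanPerm.asymp (((L : ℝ) ^ 2 + CW) / δ) (R + L) (δ / (2 * L)) (by positivity)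
  refine ⟨N, fun m n hmn hn ha hb => ?_⟩
  obtain ⟨e1, e2, e3⟩ := hN m n hn ha hb
  rw [div_le_iff₀ hδ] at e1 e3
  have : NeZero n := ⟨by omega⟩
  have hm0 : 0 < m := by
    rcases Nat.eq_zero_or_pos m with h | h
    · subst h; exfalso; push_cast at e1; nlinarith
    · exact h
  obtain ⟨f, hf, hcount⟩ := HigmanPerm.partB (L := L) (k := k) (n := n) (m := m)
    (u := m / L ^ 2 + 1) (R := R) hL hk hm0 hmn
  refine ⟨f, hf, le_trans ?_ hcount⟩
  have hmain := HigmanPerm.card_main (m := m) (n := n) (u := m / L ^ 2 + 1) (R := R) (L := L)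
    hm0 (by omega) hmn
  have hest := HigmanPerm.final_est (K := L ^ 2) (CW := CW) hδ hδ1 hL hLδ rfl rfl (by linarith)
    (by linarith) (by nlinarith) (by nlinarith) (by
      have : 2 * (L : ℝ) * (m : ℝ) ^ (R + L) ≤ 2 * L * (δ / (2 * L) * n) := by gcongr
      refine this.trans (le_of_eq ?_)
      field_simp) hmain
  have hW : (Nat.card (HigmanPerm.W L) : ℝ) = L ^ L * L := by
    simp [Nat.card_eq_fintype_card, ZMod.card]
  have hn0 : (0 : ℝ) ≤ n := Nat.cast_nonneg n
  calc (1 - ε) * n ≤ (1 - 9 * δ) * n := by gcongr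
    _ ≤ _ := hest
    _ = _ := by rw [hCW, hW]; ring
end
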